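/- Suppose G is a Finsler-type energy on ℝ^n and Φ defines a regular bounded domain Ω with constant δ₀. Let C ⊂ Mf be closed (with respect to the distance dist_*) such that C contains no V⁻-critical curve for J, and J(C) ⊂ [a₁,a₂] with 0 < a₁ ≤ a₂ < ∞. Then there exist a constant μ_C > 0 and a map W from C into H¹ curves [0,1] → ℝ^n, locally Lipschitz with respect to dist_*, such that for every x ∈ C: (1) W(x) ∈ W⁻(x,Mf); (2) ‖W(x)‖_* ≤ 1; (3) dJ(x)[W(x)] ≤ −μ_C. If moreover G is reversible (G(q,−v) = G(q,v)) and C is ℛ-invariant (ℛ(C) = C, where (ℛx)(s) := x(1−s)), then W can be chosen so that also W(ℛx)(s) = W(x)(1−s) for all x ∈ C and s ∈ [0,1]. -/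

import Mathlib

open MeasureTheory Set Filter RealInnerProductSpace

noncomputable section

/-- Euclidean space `ℝ^n`. -/
abbrev Evec (n : ℕ) := EuclideanSpace ℝ (Fin n)

/-- An `H¹` curve on `[a,b]`: an absolutely continuous curve whose a.e. derivative is
square-integrable, encoded by a choice of (integrable, square-integrable) derivative
together with the fundamental theorem of calculus identity. -/
structure H1Curve (n : ℕ) (a b : ℝ) where
  toFun : ℝ → Evec n
  deriv : ℝ → Evec n
  deriv_integrable : IntegrableOn deriv (Icc a b)
  deriv_sq_integrable : IntegrableOn (fun s => ‖deriv s‖ ^ 2) (Icc a b)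
  eq_add_integral : ∀ t ∈ Icc a b, toFun t = toFun a + ∫ s in a..t, deriv s

/-- The partial differential `d_qG(q,v)` of `G` in the first variable. -/
def dqCLM {n : ℕ} (G : Evec n → Evec n → ℝ) (q v : Evec n) : Evec n →L[ℝ] ℝ :=
  fderiv ℝ (fun z => G z v) q

/-- The partial differential `d_vG(q,v)` of `G` in the second variable. -/
def dvCLM {n : ℕ} (G : Evec n → Evec n → ℝ) (q v : Evec n) : Evec n →L[ℝ] ℝ :=
  fderiv ℝ (fun w => G q w) v

/-- A Finsler-type energy on `ℝ^n` with constants `ℓ ≥ 1` and `α > 0`. -/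
structure IsFinslerEnergy (n : ℕ) (G : Evec n → Evec n → ℝ) (ℓ α : ℝ) : Prop where
  continuous : Continuous fun p : Evec n × Evec n => G p.1 p.2
  smooth : ContDiffOn ℝ 2 (fun p : Evec n × Evec n => G p.1 p.2) {p | p.2 ≠ 0}
  homog : ∀ (q v : Evec n) (lam : ℝ), 0 < lam → G q (lam • v) = lam ^ 2 * G q v
  one_le_ell : 1 ≤ ℓ
  alpha_pos : 0 < α
  lower : ∀ q v, (1 / ℓ) * ‖v‖ ^ 2 ≤ G q v
  upper : ∀ q v, G q v ≤ ℓ * ‖v‖ ^ 2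
  dq_bound : ∀ q v, ‖dqCLM G q v‖ ≤ ℓ * (1 + ‖v‖ ^ 2)
  dv_bound : ∀ q v, ‖dvCLM G q v‖ ≤ ℓ * (1 + ‖v‖)
  vv_convex : ∀ (q v : Evec n), v ≠ 0 → ∀ w : Evec n,
    α * ‖w‖ ^ 2 ≤ fderiv ℝ (fun u => dvCLM G q u w) v w

/-- `Φ` defines a regular bounded domain `Ω = Φ⁻¹((−∞,0))` with constant `δ₀`. -/
structure IsRegularDomain (n : ℕ) (Φ : Evec n → ℝ) (δ₀ : ℝ) : Prop where
  smooth : ContDiff ℝ 2 Φ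
  nonempty : (Φ ⁻¹' Iio 0).Nonempty
  bounded : Bornology.IsBounded (Φ ⁻¹' Iio 0)
  boundary_eq : frontier (Φ ⁻¹' Iio 0) = Φ ⁻¹' {0}
  delta0_pos : 0 < δ₀
  grad_ne_zero : ∀ q : Evec n, |Φ q| ≤ δ₀ → gradient Φ q ≠ 0
  sublevel_compact : ∀ δ ∈ Icc (0:ℝ) δ₀, IsCompact (Φ ⁻¹' Iic δ)

/-- Membership in `Mf`: curves in `Ω̄` with endpoints on `∂Ω`. -/
def MemMf {n : ℕ} (Φ : Evec n → ℝ) (x : H1Curve n 0 1) : Prop :=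
  (∀ s ∈ Icc (0:ℝ) 1, Φ (x.toFun s) ≤ 0) ∧ Φ (x.toFun 0) = 0 ∧ Φ (x.toFun 1) = 0

/-- Membership in `V⁻(x,Mf)`. -/
def MemVminus {n : ℕ} (Φ : Evec n → ℝ) (x ξ : H1Curve n 0 1) : Prop :=
  ⟪gradient Φ (x.toFun 0), ξ.toFun 0⟫ = 0 ∧
  ⟪gradient Φ (x.toFun 1), ξ.toFun 1⟫ = 0 ∧
  ∀ s ∈ Ioo (0:ℝ) 1, Φ (x.toFun s) = 0 → ⟪gradient Φ (x.toFun s), ξ.toFun s⟫ ≤ 0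

/-- Membership in `W⁻(x,Mf)`: as `V⁻` but with strict inequality at interior touching points. -/
def MemWminus {n : ℕ} (Φ : Evec n → ℝ) (x ξ : H1Curve n 0 1) : Prop :=
  MemVminus Φ x ξ ∧
  ∀ s ∈ Ioo (0:ℝ) 1, Φ (x.toFun s) = 0 → ⟪gradient Φ (x.toFun s), ξ.toFun s⟫ < 0

/-- The energy functional `J(x) = (1/2)∫₀¹ G(x,ẋ)`. -/
def energy {n : ℕ} (G : Evec n → Evec n → ℝ) (x : H1Curve n 0 1) : ℝ :=
  (1 / 2) * ∫ s in (0:ℝ)..1, G (x.toFun s) (x.deriv s)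

/-- The differential `dJ(x)[ξ]`. -/
def dJ {n : ℕ} (G : Evec n → Evec n → ℝ) (x ξ : H1Curve n 0 1) : ℝ :=
  (1 / 2) * ∫ s in (0:ℝ)..1,
    (dqCLM G (x.toFun s) (x.deriv s) (ξ.toFun s) + dvCLM G (x.toFun s) (x.deriv s) (ξ.deriv s))

/-- `x` is a `V⁻`-critical curve for `J` on `Mf`. -/
def IsVCritical {n : ℕ} (G : Evec n → Evec n → ℝ) (Φ : Evec n → ℝ) (x : H1Curve n 0 1) : Prop :=
  MemMf Φ x ∧ ∀ ξ : H1Curve n 0 1, MemVminus Φ x ξ → 0 ≤ dJ G x ξ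

/-- The norm `‖ξ‖_*`. -/
def starNorm {n : ℕ} (ξ : H1Curve n 0 1) : ℝ :=
  max ‖ξ.toFun 0‖ ‖ξ.toFun 1‖ + Real.sqrt (∫ s in (0:ℝ)..1, ‖ξ.deriv s‖ ^ 2)

/-- The distance `dist_*`. -/
def starDist {n : ℕ} (x y : H1Curve n 0 1) : ℝ :=
  max ‖x.toFun 0 - y.toFun 0‖ ‖x.toFun 1 - y.toFun 1‖ +
    Real.sqrt (∫ s in (0:ℝ)..1, ‖x.deriv s - y.deriv s‖ ^ 2)

/-- The penalization function `χ_δ`. -/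
def chi (δ t : ℝ) : ℝ := if t ≤ 0 then 0 else t ^ 2 / (δ - t) ^ 2

/-- Membership in `C_δ = C([a,b],p,q,Ω_δ)`. -/
def MemC {n : ℕ} (Φ : Evec n → ℝ) (δ a b : ℝ) (p q : Evec n) (γ : H1Curve n a b) : Prop :=
  (∀ s ∈ Icc a b, Φ (γ.toFun s) < δ) ∧ γ.toFun a = p ∧ γ.toFun b = q

/-- The penalized functional `J_δ`. -/
def Jpen {n : ℕ} (G : Evec n → Evec n → ℝ) (Φ : Evec n → ℝ) (δ a b : ℝ)
    (γ : H1Curve n a b) : ℝ :=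
  (1 / 2) * (∫ s in a..b, G (γ.toFun s) (γ.deriv s)) + ∫ s in a..b, chi δ (Φ (γ.toFun s))

/-- `y` represents the backward parametrization `ℛx` of `x` (on `[0,1]`). -/
def RevRep {n : ℕ} (x y : H1Curve n 0 1) : Prop :=
  (∀ s, y.toFun s = x.toFun (1 - s)) ∧ (∀ s, y.deriv s = -x.deriv (1 - s))

set_option linter.all false

/-- Lebesgue measure on the unit interval. -/
def muI : Measure ℝ := volume.restrict (Ioc (0:ℝ) 1)

instance muI_prob : IsProbabilityMeasure muI := ⟨by simp [muI]⟩

abbrev L2 (F : Type) [NormedAddCommGroup F] := Lp F 2 muI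

abbrev HH (F : Type) [NormedAddCommGroup F] := F × L2 F

def clamp (s : ℝ) : ℝ := max 0 (min s 1)

theorem clamp_mem (s : ℝ) : clamp s ∈ Icc (0:ℝ) 1 := by
  unfold clamp
  exact ⟨le_max_left _ _, max_le zero_le_one (min_le_right _ _)⟩

theorem clamp_of_mem {s : ℝ} (hs : s ∈ Icc (0:ℝ) 1) : clamp s = s := by
  unfold clamp
  rw [min_eq_left hs.2, max_eq_right hs.1]

theorem clamp_one_sub (s : ℝ) : clamp (1 - s) = 1 - clamp s := by
  unfold clamp
  rcases le_total s 0 with h | h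
  · rw [min_eq_right (by linarith), min_eq_left (by linarith), max_eq_left h]; norm_num
  rcases le_total s 1 with h' | h'
  · rw [min_eq_left (by linarith), min_eq_left h', max_eq_right h, max_eq_right (by linarith)]
  · rw [min_eq_left (by linarith), min_eq_right h']; norm_num; linarith

section basics
variable {F : Type} [NormedAddCommGroup F] [InnerProductSpace ℝ F]
variable {F' : Type} [NormedAddCommGroup F'] [InnerProductSpace ℝ F']

theorem L2_integrable (f : L2 F) : Integrable f muI :=
  (Lp.memLp f).integrable one_le_two

theorem ii_of_muI {f : ℝ → F} (hf : Integrable f muI) {a b : ℝ} (ha : a ∈ Icc (0:ℝ) 1)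
    (hb : b ∈ Icc (0:ℝ) 1) : IntervalIntegrable f volume a b := by
  have h : IntegrableOn f (Ioc 0 1) volume := hf
  rw [intervalIntegrable_iff]
  apply h.mono_set
  intro x hx
  rw [uIoc, mem_Ioc] at hx
  exact ⟨lt_of_le_of_lt (le_min ha.1 hb.1) hx.1, hx.2.trans (max_le ha.2 hb.2)⟩

theorem integral_muI (f : ℝ → F) : ∫ s, f s ∂muI = ∫ s in (0:ℝ)..1, f s := by
  rw [intervalIntegral.integral_of_le zero_le_one]; rfl

theorem ii_congr {f g : ℝ → F} (h : f =ᵐ[muI] g) {a b : ℝ} (ha : a ∈ Icc (0:ℝ) 1)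
    (hb : b ∈ Icc (0:ℝ) 1) : ∫ s in a..b, f s = ∫ s in a..b, g s := by
  apply intervalIntegral.integral_congr_ae
  have h' := (ae_restrict_iff' measurableSet_Ioc).1 h
  filter_upwards [h'] with x hx hx'
  apply hx
  rw [uIoc, mem_Ioc] at hx'
  exact ⟨lt_of_le_of_lt (le_min ha.1 hb.1) hx'.1, hx'.2.trans (max_le ha.2 hb.2)⟩

def nrm (f : L2 F) : L2 ℝ := lipschitzWith_one_norm.compLp norm_zero f

theorem nrm_coe (f : L2 F) : nrm f =ᵐ[muI] fun s => ‖f s‖ :=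
  lipschitzWith_one_norm.coeFn_compLp norm_zero f

theorem nrm_sub_le (f g : L2 F) : ‖nrm f - nrm g‖ ≤ ‖f - g‖ := by
  simpa [nrm] using lipschitzWith_one_norm.norm_compLp_sub_le norm_zero f g

theorem L2_norm_sq (f : L2 F) : ‖f‖ ^ 2 = ∫ s, ‖f s‖ ^ 2 ∂muI := by
  rw [← real_inner_self_eq_norm_sq, L2.inner_def]
  simp

theorem nrm_norm (f : L2 F) : ‖nrm f‖ = ‖f‖ := by
  have : ‖nrm f‖ ^ 2 = ‖f‖ ^ 2 := by
    rw [L2_norm_sq, L2_norm_sq]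
    apply integral_congr_ae
    filter_upwards [nrm_coe f] with s hs
    rw [hs, norm_norm]
  exact (pow_left_inj₀ (norm_nonneg _) (norm_nonneg _) two_ne_zero).1 this

theorem int_mul_integrable (f : L2 F) (g : L2 F') :
    Integrable (fun s => ‖f s‖ * ‖g s‖) muI := by
  have h := L2.integrable_inner (𝕜 := ℝ) (nrm g) (nrm f)
  apply h.congr
  filter_upwards [nrm_coe f, nrm_coe g] with s h1 h2
  rw [h1, h2]; simp [mul_comm]

theorem int_mul_le (f : L2 F) (g : L2 F') :
    ∫ s, ‖f s‖ * ‖g s‖ ∂muI ≤ ‖f‖ * ‖g‖ := by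
  have h := real_inner_le_norm (nrm f) (nrm g)
  rw [nrm_norm, nrm_norm, L2.inner_def] at h
  refine le_trans (le_of_eq ?_) h
  apply integral_congr_ae
  filter_upwards [nrm_coe f, nrm_coe g] with s h1 h2
  rw [h1, h2]; simp [mul_comm]

theorem sq_integrable (f : L2 F) : Integrable (fun s => ‖f s‖ ^ 2) muI := by
  simpa [sq] using int_mul_integrable f f

def oneL : L2 ℝ := Lp.const 2 muI (1:ℝ)

theorem oneL_coe : oneL =ᵐ[muI] fun _ => (1:ℝ) := Lp.coeFn_const _ _ _

theorem oneL_norm : ‖oneL‖ = 1 := by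
  have : ‖oneL‖ ^ 2 = 1 := by
    rw [L2_norm_sq]
    have : ∫ s, ‖oneL s‖ ^ 2 ∂muI = ∫ s, (1:ℝ) ∂muI := by
      apply integral_congr_ae
      filter_upwards [oneL_coe] with s hs
      rw [hs]; simp
    rw [this]; simp
  nlinarith [norm_nonneg oneL]

theorem int_norm_le (f : L2 F) : ∫ s, ‖f s‖ ∂muI ≤ ‖f‖ := by
  have h := int_mul_le f oneL
  rw [oneL_norm, mul_one] at h
  refine le_trans (le_of_eq ?_) h
  apply integral_congr_ae
  filter_upwards [oneL_coe] with s h1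
  rw [h1]; simp

/-- Evaluation of the curve at time `s`. -/
def ev (e : HH F) (s : ℝ) : F := e.1 + ∫ r in (0:ℝ)..(clamp s), e.2 r

theorem zero_mem01 : (0:ℝ) ∈ Icc (0:ℝ) 1 := ⟨le_rfl, zero_le_one⟩
theorem one_mem01 : (1:ℝ) ∈ Icc (0:ℝ) 1 := ⟨zero_le_one, le_rfl⟩

theorem ev_of_mem (e : HH F) {s : ℝ} (hs : s ∈ Icc (0:ℝ) 1) :
    ev e s = e.1 + ∫ r in (0:ℝ)..s, e.2 r := by rw [ev, clamp_of_mem hs]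

theorem ev_zero (e : HH F) : ev e 0 = e.1 := by
  rw [ev_of_mem e zero_mem01]; simp

theorem ev_clamp (e : HH F) (s : ℝ) : ev e (clamp s) = ev e s := by
  rw [ev, ev, clamp_of_mem (clamp_mem s)]

theorem ev_add (e e' : HH F) (s : ℝ) : ev (e + e') s = ev e s + ev e' s := by
  unfold ev
  rw [ii_congr (f := (e + e').2) (g := fun r => e.2 r + e'.2 r) (Lp.coeFn_add _ _) zero_mem01
    (clamp_mem s), intervalIntegral.integral_add
    (ii_of_muI (L2_integrable _) zero_mem01 (clamp_mem s))
    (ii_of_muI (L2_integrable _) zero_mem01 (clamp_mem s))]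
  simp only [Prod.fst_add]; abel

theorem ev_smul (c : ℝ) (e : HH F) (s : ℝ) : ev (c • e) s = c • ev e s := by
  unfold ev
  rw [ii_congr (f := (c • e).2) (g := fun r => c • e.2 r) (Lp.coeFn_smul _ _) zero_mem01
    (clamp_mem s), intervalIntegral.integral_smul]
  simp

/-- Evaluation as a linear map. -/
def evL (s : ℝ) : HH F →ₗ[ℝ] F where
  toFun e := ev e s
  map_add' a b := ev_add a b s
  map_smul' c a := ev_smul c a s

theorem ev_sub (e e' : HH F) (s : ℝ) : ev (e - e') s = ev e s - ev e' s :=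
  (evL s).map_sub e e'

theorem ev_sub_ev (e : HH F) {s t : ℝ} (hs : s ∈ Icc (0:ℝ) 1) (ht : t ∈ Icc (0:ℝ) 1) :
    ev e t - ev e s = ∫ r in s..t, e.2 r := by
  rw [ev_of_mem e hs, ev_of_mem e ht, add_sub_add_left_eq_sub,
    intervalIntegral.integral_interval_sub_left
    (ii_of_muI (L2_integrable _) zero_mem01 ht) (ii_of_muI (L2_integrable _) zero_mem01 hs)]

theorem norm_ev_sub_le (e : HH F) {s t : ℝ} (hs : s ∈ Icc (0:ℝ) 1) (ht : t ∈ Icc (0:ℝ) 1)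
    (hst : s ≤ t) : ‖ev e t - ev e s‖ ≤ ∫ r in s..t, ‖e.2 r‖ := by
  rw [ev_sub_ev e hs ht]
  exact intervalIntegral.norm_integral_le_integral_norm hst

theorem ii_le_muI {g : ℝ → ℝ} (hg : Integrable g muI) (h0 : ∀ s, 0 ≤ g s) {s t : ℝ}
    (hs : s ∈ Icc (0:ℝ) 1) (ht : t ∈ Icc (0:ℝ) 1)
    (hst : s ≤ t) : ∫ r in s..t, g r ≤ ∫ r, g r ∂muI := by
  rw [integral_muI]
  exact intervalIntegral.integral_mono_interval hs.1 hst ht.2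
    (Eventually.of_forall h0) (ii_of_muI hg zero_mem01 one_mem01)

theorem norm_ev_sub_le' (e : HH F) {s t : ℝ} (hs : s ∈ Icc (0:ℝ) 1) (ht : t ∈ Icc (0:ℝ) 1) :
    ‖ev e t - ev e s‖ ≤ ‖e.2‖ := by
  wlog hst : s ≤ t generalizing s t
  · rw [norm_sub_rev]; exact this ht hs (le_of_not_ge hst)
  exact (norm_ev_sub_le e hs ht hst).trans ((ii_le_muI (L2_integrable e.2).norm
    (fun _ => norm_nonneg _) hs ht hst).trans (int_norm_le _))

theorem norm_ev_le (e : HH F) (s : ℝ) : ‖ev e s‖ ≤ 2 * ‖e‖ := by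
  rw [← ev_clamp]
  have h := norm_ev_sub_le' e zero_mem01 (clamp_mem s)
  rw [ev_zero] at h
  have h1 : ‖e.1‖ ≤ ‖e‖ := norm_fst_le e
  have h2 : ‖e.2‖ ≤ ‖e‖ := norm_snd_le e
  have := norm_sub_norm_le (ev e (clamp s)) e.1
  linarith

/-- Hölder estimate. -/
theorem norm_ev_sub_sq_le (e : HH F) {s t : ℝ} (hs : s ∈ Icc (0:ℝ) 1) (ht : t ∈ Icc (0:ℝ) 1)
    (hst : s ≤ t) : ‖ev e t - ev e s‖ ≤ Real.sqrt (t - s) * ‖e.2‖ := by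
  refine (norm_ev_sub_le e hs ht hst).trans ?_
  have hm : MeasurableSet (Ioc s t) := measurableSet_Ioc
  have hf : muI (Ioc s t) ≠ ⊤ := measure_ne_top _ _
  have hsub : Ioc s t ⊆ Ioc 0 1 := fun x hx => ⟨lt_of_le_of_lt hs.1 hx.1, hx.2.trans ht.2⟩
  let φ : L2 ℝ := indicatorConstLp 2 hm hf (1:ℝ)
  have hφn : ‖φ‖ = Real.sqrt (t - s) := by
    rw [norm_indicatorConstLp (by norm_num) (by norm_num)]
    rw [Measure.real, muI, Measure.restrict_apply hm, inter_eq_left.2 hsub, Real.volume_Ioc,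
      ENNReal.toReal_ofReal (by linarith)]
    simp [Real.sqrt_eq_rpow]
  have h := int_mul_le φ e.2
  rw [hφn] at h
  refine le_trans (le_of_eq ?_) h
  have : ∫ r, ‖φ r‖ * ‖e.2 r‖ ∂muI = ∫ r, (Ioc s t).indicator (fun r => ‖e.2 r‖) r ∂muI := by
    apply integral_congr_ae
    filter_upwards [indicatorConstLp_coeFn (p := 2) (hs := hm) (hμs := hf) (c := (1:ℝ))] with r hr
    change ‖φ r‖ * ‖e.2 r‖ = _
    rw [hr]
    by_cases h : r ∈ Ioc s t <;> simp [h]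
  have hr : muI.restrict (Ioc s t) = volume.restrict (Ioc s t) := by
    rw [muI, Measure.restrict_restrict hm, inter_eq_left.2 hsub]
  rw [this, integral_indicator hm, hr, intervalIntegral.integral_of_le hst]

theorem ev_continuous (e : HH F) : Continuous (ev e) := by
  have hcl : Continuous clamp := by unfold clamp; fun_prop
  have hc : ContinuousOn (ev e) (Icc 0 1) := by
    intro s hs
    have key : ∀ t ∈ Icc (0:ℝ) 1, dist (ev e t) (ev e s) ≤ Real.sqrt |t - s| * ‖e.2‖ := by
      intro t ht
      rw [dist_eq_norm]
      rcases le_total s t with h | h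
      · rw [abs_of_nonneg (by linarith)]; exact norm_ev_sub_sq_le e hs ht h
      · rw [abs_of_nonpos (by linarith), norm_sub_rev, neg_sub]; exact norm_ev_sub_sq_le e ht hs h
    rw [ContinuousWithinAt, tendsto_iff_dist_tendsto_zero]
    refine squeeze_zero' (g := fun t => Real.sqrt |t - s| * ‖e.2‖)
      (Eventually.of_forall fun _ => dist_nonneg) ?_ ?_
    · filter_upwards [self_mem_nhdsWithin] with t ht using key t ht
    · have : Continuous (fun t : ℝ => Real.sqrt |t - s| * ‖e.2‖) := by fun_prop
      have h := this.tendsto s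
      simp at h
      exact h.mono_left nhdsWithin_le_nhds
  have : ev e = fun s => ev e (clamp s) := by ext s; rw [ev_clamp]
  rw [this]
  exact hc.comp_continuous hcl clamp_mem

end basics

section Gest
variable {n : ℕ} {G : Evec n → Evec n → ℝ} {ℓ α : ℝ}

theorem G_zero (hG : IsFinslerEnergy n G ℓ α) (q : Evec n) : G q 0 = 0 := by
  have h1 := hG.lower q 0
  have h2 := hG.upper q 0
  simp at h1 h2
  linarith

theorem G_diffAt (hG : IsFinslerEnergy n G ℓ α) (q v : Evec n) (hv : v ≠ 0) :
    ContDiffAt ℝ 2 (fun p : Evec n × Evec n => G p.1 p.2) (q, v) := by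
  apply hG.smooth.contDiffAt
  have : IsOpen {p : Evec n × Evec n | p.2 ≠ 0} :=
    isOpen_ne_fun continuous_snd continuous_const
  exact this.mem_nhds hv

/-- joint derivative -/
def DG (G : Evec n → Evec n → ℝ) (p : Evec n × Evec n) : Evec n × Evec n →L[ℝ] ℝ :=
  fderiv ℝ (fun p : Evec n × Evec n => G p.1 p.2) p

theorem dv_eq (hG : IsFinslerEnergy n G ℓ α) (q v : Evec n) (hv : v ≠ 0) :
    dvCLM G q v = (DG G (q, v)).comp (ContinuousLinearMap.inr ℝ (Evec n) (Evec n)) := by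
  have h := ((G_diffAt hG q v hv).differentiableAt (by norm_num)).hasFDerivAt
  exact (h.comp v (hasFDerivAt_prodMk_right q v)).fderiv

theorem dq_eq (hG : IsFinslerEnergy n G ℓ α) (q v : Evec n) (hv : v ≠ 0) :
    dqCLM G q v = (DG G (q, v)).comp (ContinuousLinearMap.inl ℝ (Evec n) (Evec n)) := by
  have h := ((G_diffAt hG q v hv).differentiableAt (by norm_num)).hasFDerivAt
  exact (HasFDerivAt.comp (f := fun e => (e, v)) (g := fun p : Evec n × Evec n => G p.1 p.2) q h (hasFDerivAt_prodMk_left q v)).fderiv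

theorem DG_contDiffAt (hG : IsFinslerEnergy n G ℓ α) (q v : Evec n) (hv : v ≠ 0) :
    ContDiffAt ℝ 1 (DG G) (q, v) :=
  (G_diffAt hG q v hv).fderiv_right (by norm_num)

theorem dv_zero (hG : IsFinslerEnergy n G ℓ α) (q : Evec n) : dvCLM G q 0 = 0 := by
  apply HasFDerivAt.fderiv
  rw [hasFDerivAt_iff_isLittleO_nhds_zero]
  have : (fun h : Evec n => G q (0 + h) - G q 0 - (0 : Evec n →L[ℝ] ℝ) h) =O[nhds 0]
      fun h => ‖h‖ ^ 2 := by
    apply Asymptotics.IsBigO.of_bound ℓ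
    refine Eventually.of_forall fun h => ?_
    have h1 := hG.lower q h
    have h2 := hG.upper q h
    have h3 : 0 ≤ G q h := le_trans (by have := hG.one_le_ell; positivity) h1
    simp [G_zero hG, abs_of_nonneg h3]
    exact h2
  refine this.trans_isLittleO ?_
  simpa using Asymptotics.isLittleO_norm_pow_id (E' := Evec n) one_lt_two

theorem dq_zero (hG : IsFinslerEnergy n G ℓ α) (q : Evec n) : dqCLM G q 0 = 0 := by
  unfold dqCLM
  have : (fun z => G z 0) = fun _ => (0:ℝ) := by ext z; exact G_zero hG z
  rw [this]; simp

theorem dq_hom (hG : IsFinslerEnergy n G ℓ α) (q v : Evec n) (c : ℝ) (hc : 0 < c) :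
    dqCLM G q (c • v) = c ^ 2 • dqCLM G q v := by
  by_cases hv : v = 0
  · simp [hv, dq_zero hG]
  unfold dqCLM
  have : (fun z => G z (c • v)) = fun z => c ^ 2 * G z v := by
    ext z; rw [hG.homog z v c hc]
  rw [this]
  have hd : DifferentiableAt ℝ (fun z => G z v) q := by
    have h := ((G_diffAt hG q v hv).differentiableAt (by norm_num)).hasFDerivAt
    exact (HasFDerivAt.comp (f := fun e => (e, v)) (g := fun p : Evec n × Evec n => G p.1 p.2) q h (hasFDerivAt_prodMk_left q v)).differentiableAt
  exact fderiv_const_mul hd _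

theorem dv_hom (hG : IsFinslerEnergy n G ℓ α) (q v : Evec n) (c : ℝ) (hc : 0 < c) :
    dvCLM G q (c • v) = c • dvCLM G q v := by
  by_cases hv : v = 0
  · simp [hv, dv_zero hG]
  have hcv : c • v ≠ 0 := smul_ne_zero hc.ne' hv
  have hd : ∀ w : Evec n, w ≠ 0 → HasFDerivAt (fun z => G q z) (dvCLM G q w) w := by
    intro w hw
    have h := ((G_diffAt hG q w hw).differentiableAt (by norm_num)).hasFDerivAt
    exact (h.comp w (hasFDerivAt_prodMk_right q w)).differentiableAt.hasFDerivAt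
  have h1 : HasFDerivAt (fun w => G q (c • w))
      ((dvCLM G q (c • v)).comp (c • ContinuousLinearMap.id ℝ (Evec n))) v :=
    (hd _ hcv).comp v ((hasFDerivAt_id v).const_smul c)
  have h2 : HasFDerivAt (fun w => G q (c • w)) (c ^ 2 • dvCLM G q v) v := by
    have : (fun w => G q (c • w)) = fun w => c ^ 2 * G q w := by
      ext z; rw [hG.homog q z c hc]
    rw [this]
    exact (hd v hv).const_mul _
  have h3 := h1.unique h2
  ext w
  have h4 := congrArg (fun T => T w) h3
  simp at h4
  have : c * (dvCLM G q (c • v) w) = c * (c * dvCLM G q v w) := by rw [h4]; ring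
  simpa using mul_left_cancel₀ hc.ne' this

theorem dv_le (hG : IsFinslerEnergy n G ℓ α) (q v : Evec n) :
    ‖dvCLM G q v‖ ≤ 2 * ℓ * ‖v‖ := by
  by_cases hv : v = 0
  · simp [hv, dv_zero hG]
  have hn : 0 < ‖v‖ := norm_pos_iff.2 hv
  have h : v = ‖v‖ • (‖v‖⁻¹ • v) := by rw [smul_smul, mul_inv_cancel₀ hn.ne', one_smul]
  have h1 := hG.dv_bound q (‖v‖⁻¹ • v)
  have h2 : ‖(‖v‖⁻¹ • v)‖ = 1 := by rw [norm_smul]; simp [hn.ne']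
  rw [h2] at h1
  conv_lhs => rw [h, dv_hom hG _ _ _ hn, norm_smul]
  rw [norm_norm]
  nlinarith

theorem dq_le (hG : IsFinslerEnergy n G ℓ α) (q v : Evec n) :
    ‖dqCLM G q v‖ ≤ 2 * ℓ * ‖v‖ ^ 2 := by
  by_cases hv : v = 0
  · simp [hv, dq_zero hG]
  have hn : 0 < ‖v‖ := norm_pos_iff.2 hv
  have h : v = ‖v‖ • (‖v‖⁻¹ • v) := by rw [smul_smul, mul_inv_cancel₀ hn.ne', one_smul]
  have h1 := hG.dq_bound q (‖v‖⁻¹ • v)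
  have h2 : ‖(‖v‖⁻¹ • v)‖ = 1 := by rw [norm_smul]; simp [hn.ne']
  rw [h2] at h1
  conv_lhs => rw [h, dq_hom hG _ _ _ hn, norm_smul]
  rw [norm_pow, norm_norm]
  have : 0 < ‖v‖ ^ 2 := by positivity
  nlinarith

/-- Lipschitz estimate for functions homogeneous of degree one. -/
theorem hom_lip {X : Type} [NormedAddCommGroup X] [NormedSpace ℝ X] (A : Evec n → Evec n → X)
    (hA : ∀ q v (c : ℝ), 0 < c → A q (c • v) = c • A q v) (B L R : ℝ) (hL : 0 ≤ L)
    (hB : ∀ q v, ‖A q v‖ ≤ B * ‖v‖)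
    (hlip : ∀ q q' u u' : Evec n, ‖q‖ ≤ R → ‖q'‖ ≤ R → ‖u‖ = 1 → ‖u'‖ = 1 →
      ‖A q u - A q' u'‖ ≤ L * (‖q - q'‖ + ‖u - u'‖))
    (q q' v v' : Evec n) (hq : ‖q‖ ≤ R) (hq' : ‖q'‖ ≤ R) :
    ‖A q v - A q' v'‖ ≤ (B + 2 * L) * (‖v'‖ * ‖q - q'‖ + ‖v - v'‖) := by
  have h0 : ∀ q, A q 0 = 0 := fun q => by simpa using hB q 0
  have hBv : ∀ v : Evec n, 0 ≤ B * ‖v‖ := fun v => (norm_nonneg _).trans (hB 0 v)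
  by_cases hv : v = 0
  · have h1 := hB q' v'
    have h2 := hBv v'
    simp only [hv, h0, zero_sub, norm_neg]
    have : 0 ≤ ‖v'‖ * ‖q - q'‖ := by positivity
    have h4 : 0 ≤ B * ‖v'‖ * ‖q - q'‖ := by positivity
    nlinarith [mul_nonneg hL this, mul_nonneg hL (norm_nonneg v')]
  by_cases hv' : v' = 0
  · have h1 := hB q v
    simp only [hv', h0, sub_zero, norm_zero, zero_mul, zero_add]
    nlinarith [mul_nonneg hL (norm_nonneg v)]
  have hn : 0 < ‖v‖ := norm_pos_iff.2 hv
  have hn' : 0 < ‖v'‖ := norm_pos_iff.2 hv'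
  have hBn : 0 ≤ B := by
    have := hBv v
    by_contra h
    push Not at h
    nlinarith
  set u := ‖v‖⁻¹ • v with hu
  set u' := ‖v'‖⁻¹ • v' with hu'
  have h : v = ‖v‖ • u := by rw [hu, smul_smul, mul_inv_cancel₀ hn.ne', one_smul]
  have h' : v' = ‖v'‖ • u' := by rw [hu', smul_smul, mul_inv_cancel₀ hn'.ne', one_smul]
  have un : ‖u‖ = 1 := by rw [hu, norm_smul]; simp [hn.ne']
  have un' : ‖u'‖ = 1 := by rw [hu', norm_smul]; simp [hn'.ne']
  have e1 : A q v = ‖v‖ • A q u := by conv_lhs => rw [h]; rw [hA _ _ _ hn]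
  have e2 : A q' v' = ‖v'‖ • A q' u' := by conv_lhs => rw [h']; rw [hA _ _ _ hn']
  have e3 : A q v - A q' v' = (‖v‖ - ‖v'‖) • A q u + ‖v'‖ • (A q u - A q' u') := by
    rw [e1, e2, sub_smul, smul_sub]; abel
  have a1 : ‖(‖v‖ - ‖v'‖) • A q u‖ ≤ ‖v - v'‖ * B := by
    rw [norm_smul]
    have := hB q u
    rw [un, mul_one] at this
    exact mul_le_mul (abs_norm_sub_norm_le v v') this (norm_nonneg _) (norm_nonneg _)
  have a2 : ‖v'‖ * ‖u - u'‖ ≤ 2 * ‖v - v'‖ := by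
    have : ‖v'‖ * ‖u - u'‖ = ‖(‖v'‖ - ‖v‖) • u + (v - v')‖ := by
      rw [← norm_norm v', ← norm_smul, norm_norm]
      congr 1
      rw [smul_sub, ← h', sub_smul, ← h]; abel
    rw [this]
    refine (norm_add_le _ _).trans ?_
    rw [norm_smul, un, mul_one, Real.norm_eq_abs, abs_sub_comm]
    linarith [abs_norm_sub_norm_le v v']
  have a3 : ‖‖v'‖ • (A q u - A q' u')‖ ≤ L * (‖v'‖ * ‖q - q'‖ + 2 * ‖v - v'‖) := by
    rw [norm_smul, norm_norm]
    have := hlip q q' u u' hq hq' un un'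
    calc ‖v'‖ * ‖A q u - A q' u'‖ ≤ ‖v'‖ * (L * (‖q - q'‖ + ‖u - u'‖)) := by gcongr
      _ = L * (‖v'‖ * ‖q - q'‖ + ‖v'‖ * ‖u - u'‖) := by ring
      _ ≤ _ := by gcongr
  rw [e3]
  refine (norm_add_le _ _).trans ((add_le_add a1 a3).trans ?_)
  have : 0 ≤ ‖v'‖ * ‖q - q'‖ := by positivity
  nlinarith [mul_nonneg hL this, mul_nonneg hBn this]

theorem DG_lip (hG : IsFinslerEnergy n G ℓ α) (R : ℝ) : ∃ L : ℝ, 0 ≤ L ∧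
    ∀ q q' u u' : Evec n, ‖q‖ ≤ R → ‖q'‖ ≤ R → ‖u‖ = 1 → ‖u'‖ = 1 →
      ‖DG G (q, u) - DG G (q', u')‖ ≤ L * (‖q - q'‖ + ‖u - u'‖) := by
  let K : Set (Evec n × Evec n) := Metric.closedBall 0 R ×ˢ Metric.sphere 0 1
  have hK : IsCompact K := (isCompact_closedBall 0 R).prod (isCompact_sphere 0 1)
  have hl : LocallyLipschitzOn K (DG G) := by
    rintro ⟨q, u⟩ hqu
    have hu : u ≠ 0 := by
      have : ‖u‖ = 1 := by simpa using hqu.2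
      intro h; simp [h] at this
    obtain ⟨C, t, ht, h⟩ := (DG_contDiffAt hG q u hu).exists_lipschitzOnWith
    exact ⟨C, t, mem_nhdsWithin_of_mem_nhds ht, h⟩
  obtain ⟨C, hC⟩ := hl.exists_lipschitzOnWith_of_compact hK
  refine ⟨C, C.2, fun q q' u u' hq hq' hu hu' => ?_⟩
  have h := hC.dist_le_mul (q, u) (by simp [K, hq, hu]) (q', u') (by simp [K, hq', hu'])
  rw [dist_eq_norm] at h
  refine h.trans ?_
  gcongr
  rw [Prod.dist_eq, dist_eq_norm, dist_eq_norm]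
  exact max_le (by simp) (by simp)

theorem dv_lip (hG : IsFinslerEnergy n G ℓ α) (R : ℝ) : ∃ L : ℝ, 0 ≤ L ∧
    ∀ q q' v v' : Evec n, ‖q‖ ≤ R → ‖q'‖ ≤ R →
      ‖dvCLM G q v - dvCLM G q' v'‖ ≤ L * (‖v'‖ * ‖q - q'‖ + ‖v - v'‖) := by
  obtain ⟨L, hL, h⟩ := DG_lip hG R
  have hl := hG.one_le_ell
  refine ⟨2 * ℓ + 2 * L, by positivity, fun q q' v v' hq hq' => ?_⟩
  refine hom_lip (fun q v => dvCLM G q v) (fun q v c hc => dv_hom hG q v c hc) (2 * ℓ) L R hL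
    (dv_le hG) ?_ q q' v v' hq hq'
  intro q q' u u' hq hq' hu hu'
  have hu0 : u ≠ 0 := by intro h; simp [h] at hu
  have hu0' : u' ≠ 0 := by intro h; simp [h] at hu'
  rw [dv_eq hG q u hu0, dv_eq hG q' u' hu0', ← ContinuousLinearMap.sub_comp]
  refine (ContinuousLinearMap.opNorm_comp_le _ _).trans ?_
  have := h q q' u u' hq hq' hu hu'
  have h2 := ContinuousLinearMap.norm_inr_le_one ℝ (Evec n) (Evec n)
  nlinarith [norm_nonneg (DG G (q, u) - DG G (q', u'))]

theorem dq_lip (hG : IsFinslerEnergy n G ℓ α) (R : ℝ) : ∃ L : ℝ, 0 ≤ L ∧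
    ∀ q q' v v' : Evec n, ‖q‖ ≤ R → ‖q'‖ ≤ R →
      ‖dqCLM G q v - dqCLM G q' v'‖ ≤ L * (‖v'‖ ^ 2 * ‖q - q'‖ + (‖v‖ + ‖v'‖) * ‖v - v'‖) := by
  obtain ⟨L, hL, h⟩ := DG_lip hG R
  have hl := hG.one_le_ell
  refine ⟨2 * ℓ + (2 * ℓ + 2 * L), by positivity, fun q q' v v' hq hq' => ?_⟩
  have hBB : ∀ q v : Evec n, ‖‖v‖⁻¹ • dqCLM G q v‖ ≤ 2 * ℓ * ‖v‖ := by
    intro q v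
    by_cases hv : v = 0
    · simp [hv]
    have hn : 0 < ‖v‖ := norm_pos_iff.2 hv
    rw [norm_smul, norm_inv, norm_norm, inv_mul_le_iff₀ hn]
    refine (dq_le hG q v).trans (le_of_eq (by ring))
  have key := hom_lip (fun q v => ‖v‖⁻¹ • dqCLM G q v) ?_ (2 * ℓ) L R hL
    hBB ?_ q q' v v' hq hq'
  · have e : ∀ q v : Evec n, dqCLM G q v = ‖v‖ • (‖v‖⁻¹ • dqCLM G q v) := by
      intro q v
      by_cases hv : v = 0
      · simp [hv, dq_zero hG]
      rw [smul_smul, mul_inv_cancel₀ (norm_ne_zero_iff.2 hv), one_smul]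
    have e3 : dqCLM G q v - dqCLM G q' v' = (‖v‖ - ‖v'‖) • (‖v‖⁻¹ • dqCLM G q v) +
        ‖v'‖ • (‖v‖⁻¹ • dqCLM G q v - ‖v'‖⁻¹ • dqCLM G q' v') := by
      rw [smul_sub, ← e q' v', sub_smul (‖v‖) (‖v'‖) (‖v‖⁻¹ • dqCLM G q v), ← e q v]; abel
    rw [e3]
    refine (norm_add_le _ _).trans ?_
    rw [norm_smul (‖v‖ - ‖v'‖) (‖v‖⁻¹ • dqCLM G q v), norm_smul (‖v'‖), norm_norm v']
    have a1 : ‖‖v‖ - ‖v'‖‖ * ‖‖v‖⁻¹ • dqCLM G q v‖ ≤ ‖v - v'‖ * (2 * ℓ * ‖v‖) :=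
      mul_le_mul (abs_norm_sub_norm_le v v') (hBB q v) (norm_nonneg _) (norm_nonneg _)
    have a2 := mul_le_mul_of_nonneg_left key (norm_nonneg v')
    refine (add_le_add a1 a2).trans ?_
    have p1 : 0 ≤ ‖v'‖ ^ 2 * ‖q - q'‖ := by positivity
    have p2 : 0 ≤ ‖v‖ * ‖v - v'‖ := by positivity
    have p3 : 0 ≤ ‖v'‖ * ‖v - v'‖ := by positivity
    have l1 : 0 ≤ ℓ := by linarith
    nlinarith [mul_nonneg l1 p1, mul_nonneg l1 p2, mul_nonneg l1 p3, mul_nonneg hL p1,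
      mul_nonneg hL p2, mul_nonneg hL p3]
  · intro q v c hc
    by_cases hv : v = 0
    · simp [hv]
    have hn : ‖v‖ ≠ 0 := norm_ne_zero_iff.2 hv
    show _ = c • (‖v‖⁻¹ • dqCLM G q v)
    show ‖c • v‖⁻¹ • dqCLM G q (c • v) = _
    rw [dq_hom hG q v c hc, norm_smul, Real.norm_of_nonneg hc.le, smul_smul, smul_smul]
    congr 1
    field_simp
  intro q q' u u' hq hq' hu hu'
  have hu0 : u ≠ 0 := by intro h; simp [h] at hu
  have hu0' : u' ≠ 0 := by intro h; simp [h] at hu'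
  simp only [hu, hu', inv_one, one_smul]
  rw [dq_eq hG q u hu0, dq_eq hG q' u' hu0', ← ContinuousLinearMap.sub_comp]
  refine (ContinuousLinearMap.opNorm_comp_le _ _).trans ?_
  have := h q q' u u' hq hq' hu hu'
  have h2 := ContinuousLinearMap.norm_inl_le_one ℝ (Evec n) (Evec n)
  nlinarith [norm_nonneg (DG G (q, u) - DG G (q', u'))]

theorem dv_cont (hG : IsFinslerEnergy n G ℓ α) :
    Continuous fun p : Evec n × Evec n => dvCLM G p.1 p.2 := by
  rw [continuous_iff_continuousAt]
  rintro ⟨q, v⟩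
  obtain ⟨L, hL, h⟩ := dv_lip hG (‖q‖ + 1)
  rw [ContinuousAt, tendsto_iff_norm_sub_tendsto_zero]
  refine squeeze_zero' (g := fun p : Evec n × Evec n => L * (‖v‖ * ‖p.1 - q‖ + ‖p.2 - v‖))
    (Eventually.of_forall fun _ => norm_nonneg _) ?_ ?_
  · have : ∀ᶠ p : Evec n × Evec n in nhds (q, v), ‖p.1‖ < ‖q‖ + 1 :=
      (continuous_fst.norm.tendsto (q, v)).eventually (gt_mem_nhds (by simp))
    filter_upwards [this] with p hp
    exact h p.1 q p.2 v hp.le (by simp)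
  · have : Continuous fun p : Evec n × Evec n => L * (‖v‖ * ‖p.1 - q‖ + ‖p.2 - v‖) := by fun_prop
    simpa using this.tendsto (q, v)

theorem dq_cont (hG : IsFinslerEnergy n G ℓ α) :
    Continuous fun p : Evec n × Evec n => dqCLM G p.1 p.2 := by
  rw [continuous_iff_continuousAt]
  rintro ⟨q, v⟩
  obtain ⟨L, hL, h⟩ := dq_lip hG (‖q‖ + 1)
  rw [ContinuousAt, tendsto_iff_norm_sub_tendsto_zero]
  refine squeeze_zero' (g := fun p : Evec n × Evec n =>
      L * (‖v‖ ^ 2 * ‖p.1 - q‖ + (‖p.2‖ + ‖v‖) * ‖p.2 - v‖))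
    (Eventually.of_forall fun _ => norm_nonneg _) ?_ ?_
  · have : ∀ᶠ p : Evec n × Evec n in nhds (q, v), ‖p.1‖ < ‖q‖ + 1 :=
      (continuous_fst.norm.tendsto (q, v)).eventually (gt_mem_nhds (by simp))
    filter_upwards [this] with p hp
    exact h p.1 q p.2 v hp.le (by simp)
  · have : Continuous fun p : Evec n × Evec n =>
      L * (‖v‖ ^ 2 * ‖p.1 - q‖ + (‖p.2‖ + ‖v‖) * ‖p.2 - v‖) := by fun_prop
    simpa using this.tendsto (q, v)

theorem dv_mono (hG : IsFinslerEnergy n G ℓ α) (q v w : Evec n) :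
    α * ‖v - w‖ ^ 2 ≤ (dvCLM G q v - dvCLM G q w) (v - w) := by
  by_cases hvw : v = w
  · simp [hvw]
  set d := v - w with hd
  have hd0 : d ≠ 0 := sub_ne_zero.2 hvw
  let γ : ℝ → Evec n := fun t => w + t • d
  let φ : ℝ → ℝ := fun t => dvCLM G q (γ t) d - α * ‖d‖ ^ 2 * t
  have hφc : Continuous φ := by
    have : Continuous fun t => dvCLM G q (γ t) :=
      (dv_cont hG).comp (f := fun t => (q, γ t)) (by fun_prop)
    have h2 : Continuous fun t => dvCLM G q (γ t) d := this.clm_apply continuous_const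
    fun_prop
  have hder : ∀ t, γ t ≠ 0 → ∃ m, 0 ≤ m ∧ HasDerivAt φ m t := by
    intro t ht
    have hdiff : DifferentiableAt ℝ (fun u => dvCLM G q u d) (γ t) := by
      have h1 : DifferentiableAt ℝ (fun u => DG G (q, u) (0, d)) (γ t) := by
        have := (DG_contDiffAt hG q (γ t) ht).differentiableAt (by norm_num)
        have h2 : DifferentiableAt ℝ (fun u => DG G (q, u)) (γ t) :=
          this.comp (γ t) (hasFDerivAt_prodMk_right q (γ t)).differentiableAt
        exact h2.clm_apply (differentiableAt_const _)
      refine h1.congr_of_eventuallyEq ?_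
      filter_upwards [isOpen_ne.mem_nhds ht] with u hu
      rw [dv_eq hG q u hu]; simp
    have hγ : HasDerivAt γ d t := by
      have := ((hasDerivAt_id t).smul_const d).const_add w
      rwa [one_smul] at this
    have h3 := hdiff.hasFDerivAt.comp_hasDerivAt t hγ
    have h4 : HasDerivAt (fun t : ℝ => α * ‖d‖ ^ 2 * t) (α * ‖d‖ ^ 2) t := by
      simpa using (hasDerivAt_id t).const_mul (α * ‖d‖ ^ 2)
    refine ⟨_, ?_, h3.sub h4⟩
    have := hG.vv_convex q (γ t) ht d
    linarith
  have hmono : ∀ a b : ℝ, (∀ t ∈ Ioo a b, γ t ≠ 0) → MonotoneOn φ (Icc a b) := by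
    intro a b hab
    apply monotoneOn_of_deriv_nonneg (convex_Icc a b) hφc.continuousOn
    · intro t ht
      rw [interior_Icc] at ht
      obtain ⟨m, _, h⟩ := hder t (hab t ht)
      exact h.differentiableAt.differentiableWithinAt
    · intro t ht
      rw [interior_Icc] at ht
      obtain ⟨m, hm, h⟩ := hder t (hab t ht)
      rw [h.deriv]; exact hm
  have hfin : φ 0 ≤ φ 1 := by
    by_cases hz : ∃ t ∈ Ioo (0:ℝ) 1, γ t = 0
    · obtain ⟨t, ht, h0⟩ := hz
      have huniq : ∀ r, r ≠ t → γ r ≠ 0 := by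
        intro r hr h
        have : (r - t) • d = 0 := by
          have : γ r - γ t = (r - t) • d := by simp only [γ]; rw [sub_smul]; abel
          rw [← this, h, h0, sub_zero]
        rcases smul_eq_zero.1 this with h | h
        · exact hr (by linarith)
        · exact hd0 h
      have m1 := hmono 0 t (fun r hr => huniq r hr.2.ne)
      have m2 := hmono t 1 (fun r hr => huniq r hr.1.ne')
      exact (m1 (left_mem_Icc.2 ht.1.le) (right_mem_Icc.2 ht.1.le) ht.1.le).trans
        (m2 (left_mem_Icc.2 ht.2.le) (right_mem_Icc.2 ht.2.le) ht.2.le)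
    · push Not at hz
      exact hmono 0 1 hz (by simp) (by simp) zero_le_one
  simp only [φ, γ, zero_smul, add_zero, one_smul, mul_zero, sub_zero, mul_one] at hfin
  have hwd : w + d = v := by rw [hd]; abel
  rw [hwd] at hfin
  rw [_root_.sub_apply]
  linarith

end Gest

section dJsec
variable {n : ℕ} {G : Evec n → Evec n → ℝ} {ℓ α : ℝ}

theorem clm_abs_le (T : Evec n →L[ℝ] ℝ) (x : Evec n) : |T x| ≤ ‖T‖ * ‖x‖ := T.le_opNorm x

theorem int_add3 {f g h : ℝ → ℝ} (hf : Integrable f muI) (hg : Integrable g muI)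
    (hh : Integrable h muI) : ∫ s, (f s + g s + h s) ∂muI =
    ∫ s, f s ∂muI + ∫ s, g s ∂muI + ∫ s, h s ∂muI := by
  have h1 : Integrable (fun s => f s + g s) muI := hf.add hg
  rw [integral_add h1 hh, integral_add hf hg]

/-- The integrand of the differential. -/
def dJint (G : Evec n → Evec n → ℝ) (e η : HH (Evec n)) (s : ℝ) : ℝ :=
  dqCLM G (ev e s) (e.2 s) (ev η s) + dvCLM G (ev e s) (e.2 s) (η.2 s)

def dJE (G : Evec n → Evec n → ℝ) (e η : HH (Evec n)) : ℝ :=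
  (1 / 2) * ∫ s, dJint G e η s ∂muI

theorem dJint_meas (hG : IsFinslerEnergy n G ℓ α) (e η : HH (Evec n)) :
    AEStronglyMeasurable (dJint G e η) muI := by
  have h1 : AEStronglyMeasurable (fun s => ev e s) muI :=
    (ev_continuous e).aestronglyMeasurable
  have h2 : AEStronglyMeasurable (fun s => e.2 s) muI := (Lp.memLp e.2).1
  have h3 : AEStronglyMeasurable (fun s => ev η s) muI :=
    (ev_continuous η).aestronglyMeasurable
  have h4 : AEStronglyMeasurable (fun s => η.2 s) muI := (Lp.memLp η.2).1
  have hq : AEStronglyMeasurable (fun s => dqCLM G (ev e s) (e.2 s)) muI :=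
    (dq_cont hG).comp_aestronglyMeasurable (h1.prodMk h2)
  have hv : AEStronglyMeasurable (fun s => dvCLM G (ev e s) (e.2 s)) muI :=
    (dv_cont hG).comp_aestronglyMeasurable (h1.prodMk h2)
  have c : Continuous fun p : (Evec n →L[ℝ] ℝ) × Evec n => p.1 p.2 := by fun_prop
  exact (c.comp_aestronglyMeasurable (hq.prodMk h3)).add
    (c.comp_aestronglyMeasurable (hv.prodMk h4))

theorem dJint_le (hG : IsFinslerEnergy n G ℓ α) (e η : HH (Evec n)) (s : ℝ) :
    |dJint G e η s| ≤ 2 * ℓ * (2 * ‖η‖) * ‖e.2 s‖ ^ 2 + 2 * ℓ * (‖e.2 s‖ * ‖η.2 s‖) := by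
  have hl := hG.one_le_ell
  have h1 := (dqCLM G (ev e s) (e.2 s)).le_opNorm (ev η s)
  have h2 := (dvCLM G (ev e s) (e.2 s)).le_opNorm (η.2 s)
  have h3 : ‖dqCLM G (ev e s) (e.2 s)‖ * ‖ev η s‖ ≤ 2 * ℓ * ‖e.2 s‖ ^ 2 * (2 * ‖η‖) :=
    mul_le_mul (dq_le hG _ _) (norm_ev_le _ _) (norm_nonneg _) (by positivity)
  have h4 : ‖dvCLM G (ev e s) (e.2 s)‖ * ‖η.2 s‖ ≤ 2 * ℓ * ‖e.2 s‖ * ‖η.2 s‖ :=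
    mul_le_mul_of_nonneg_right (dv_le hG _ _) (norm_nonneg _)
  rw [Real.norm_eq_abs] at h1 h2
  unfold dJint
  refine (abs_add_le _ _).trans ?_
  linarith

theorem dJint_integrable (hG : IsFinslerEnergy n G ℓ α) (e η : HH (Evec n)) :
    Integrable (dJint G e η) muI := by
  refine Integrable.mono' (((sq_integrable e.2).const_mul (2 * ℓ * (2 * ‖η‖))).add
    ((int_mul_integrable e.2 η.2).const_mul (2 * ℓ))) (dJint_meas hG e η) ?_
  exact Eventually.of_forall fun s => dJint_le hG e η s

theorem dJE_add (hG : IsFinslerEnergy n G ℓ α) (e η η' : HH (Evec n)) :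
    dJE G e (η + η') = dJE G e η + dJE G e η' := by
  unfold dJE
  rw [← mul_add, ← integral_add (dJint_integrable hG e η) (dJint_integrable hG e η')]
  congr 1
  apply integral_congr_ae
  filter_upwards [Lp.coeFn_add η.2 η'.2] with s hs
  have : (η + η').2 s = η.2 s + η'.2 s := hs
  simp only [dJint, ev_add, this, map_add]
  ring

theorem dJE_smul (c : ℝ) (e η : HH (Evec n)) :
    dJE G e (c • η) = c * dJE G e η := by
  unfold dJE
  suffices h : ∫ s, dJint G e (c • η) s ∂muI = c * ∫ s, dJint G e η s ∂muI by rw [h]; ring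
  rw [← integral_const_mul]
  apply integral_congr_ae
  filter_upwards [Lp.coeFn_smul c η.2] with s hs
  have : (c • η).2 s = c • η.2 s := hs
  simp only [dJint, ev_smul, this, map_smul, smul_eq_mul]
  ring

/-- `dJE` as a linear map in the second variable. -/
def dJL (hG : IsFinslerEnergy n G ℓ α) (e : HH (Evec n)) : HH (Evec n) →ₗ[ℝ] ℝ where
  toFun η := dJE G e η
  map_add' a b := dJE_add hG e a b
  map_smul' c a := dJE_smul c e a

theorem dJE_sub (hG : IsFinslerEnergy n G ℓ α) (e η η' : HH (Evec n)) :
    dJE G e (η - η') = dJE G e η - dJE G e η' := (dJL hG e).map_sub η η'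

theorem int_sq_le {f : L2 (Evec n)} {R : ℝ} (h : ‖f‖ ≤ R) : ∫ s, ‖f s‖ ^ 2 ∂muI ≤ R ^ 2 := by
  rw [← L2_norm_sq]; gcongr

theorem dJE_bound (hG : IsFinslerEnergy n G ℓ α) (R : ℝ) : ∃ K : ℝ, 0 ≤ K ∧
    ∀ e η : HH (Evec n), ‖e.2‖ ≤ R → |dJE G e η| ≤ K * ‖η‖ := by
  have hl := hG.one_le_ell
  refine ⟨2 * ℓ * R ^ 2 + ℓ * |R|, by positivity, fun e η he => ?_⟩
  have hR : 0 ≤ R := (norm_nonneg _).trans he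
  rw [abs_of_nonneg hR]
  have h1 := abs_integral_le_integral_abs (f := dJint G e η) (μ := muI)
  have h2 : ∫ s, |dJint G e η s| ∂muI ≤ ∫ s, (2 * ℓ * (2 * ‖η‖) * ‖e.2 s‖ ^ 2 +
      2 * ℓ * (‖e.2 s‖ * ‖η.2 s‖)) ∂muI :=
    integral_mono (dJint_integrable hG e η).abs (((sq_integrable e.2).const_mul _).add
      ((int_mul_integrable e.2 η.2).const_mul _)) (fun s => dJint_le hG e η s)
  rw [integral_add ((sq_integrable e.2).const_mul _) ((int_mul_integrable e.2 η.2).const_mul _),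
    integral_const_mul, integral_const_mul] at h2
  have h3 := int_sq_le he
  have h4 : ∫ s, ‖e.2 s‖ * ‖η.2 s‖ ∂muI ≤ R * ‖η‖ :=
    (int_mul_le e.2 η.2).trans (mul_le_mul he (norm_snd_le η) (norm_nonneg _) hR)
  have h5 : 2 * ℓ * (2 * ‖η‖) * ∫ s, ‖e.2 s‖ ^ 2 ∂muI ≤ 2 * ℓ * (2 * ‖η‖) * R ^ 2 := by gcongr
  have h6 : 2 * ℓ * ∫ s, ‖e.2 s‖ * ‖η.2 s‖ ∂muI ≤ 2 * ℓ * (R * ‖η‖) := by gcongr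
  unfold dJE
  rw [abs_mul, abs_of_pos (by norm_num : (0:ℝ) < 1 / 2)]
  linarith

theorem dJE_lip (hG : IsFinslerEnergy n G ℓ α) (R : ℝ) : ∃ K : ℝ, 0 ≤ K ∧
    ∀ e e' η : HH (Evec n), ‖e‖ ≤ R → ‖e'‖ ≤ R →
      |dJE G e η - dJE G e' η| ≤ K * ‖e - e'‖ * ‖η‖ := by
  obtain ⟨L, hL, hdv⟩ := dv_lip hG (2 * R)
  obtain ⟨L', hL', hdq⟩ := dq_lip hG (2 * R)
  refine ⟨L' * (2 * R ^ 2 + 2 * |R|) + L * (|R| + 1), by positivity, fun e e' η he he' => ?_⟩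
  have hR : 0 ≤ R := (norm_nonneg _).trans he
  rw [abs_of_nonneg hR]
  have he2 : ‖e.2‖ ≤ R := (norm_snd_le e).trans he
  have he2' : ‖e'.2‖ ≤ R := (norm_snd_le e').trans he'
  set d := e - e' with hd
  have hdn : ‖d.2‖ ≤ ‖d‖ := norm_snd_le d
  have hev : ∀ s, ‖ev e s‖ ≤ 2 * R := fun s => (norm_ev_le e s).trans (by linarith)
  have hev' : ∀ s, ‖ev e' s‖ ≤ 2 * R := fun s => (norm_ev_le e' s).trans (by linarith)
  let B : ℝ → ℝ := fun s => L' * (2 * ‖η‖) * (2 * ‖d‖) * ‖e'.2 s‖ ^ 2 +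
    L' * (2 * ‖η‖) * (‖e.2 s‖ * ‖d.2 s‖) + L' * (2 * ‖η‖) * (‖e'.2 s‖ * ‖d.2 s‖) +
    L * (2 * ‖d‖) * (‖e'.2 s‖ * ‖η.2 s‖) + L * (‖d.2 s‖ * ‖η.2 s‖)
  have hpt : ∀ᵐ s ∂muI, |dJint G e η s - dJint G e' η s| ≤ B s := by
    filter_upwards [Lp.coeFn_sub e.2 e'.2] with s hs
    have hs' : d.2 s = e.2 s - e'.2 s := hs
    have hes : ‖ev e s - ev e' s‖ ≤ 2 * ‖d‖ := by rw [← ev_sub]; exact norm_ev_le d s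
    have a1 := hdq (ev e s) (ev e' s) (e.2 s) (e'.2 s) (hev s) (hev' s)
    have a2 := hdv (ev e s) (ev e' s) (e.2 s) (e'.2 s) (hev s) (hev' s)
    rw [← hs'] at a1 a2
    have b1 : |(dqCLM G (ev e s) (e.2 s) - dqCLM G (ev e' s) (e'.2 s)) (ev η s)| ≤
        L' * (‖e'.2 s‖ ^ 2 * (2 * ‖d‖) + (‖e.2 s‖ + ‖e'.2 s‖) * ‖d.2 s‖) * (2 * ‖η‖) := by
      refine (clm_abs_le _ _).trans ?_
      refine mul_le_mul (a1.trans ?_) (norm_ev_le η s) (norm_nonneg _) (by positivity)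
      gcongr
    have b2 : |(dvCLM G (ev e s) (e.2 s) - dvCLM G (ev e' s) (e'.2 s)) (η.2 s)| ≤
        L * (‖e'.2 s‖ * (2 * ‖d‖) + ‖d.2 s‖) * ‖η.2 s‖ := by
      refine (clm_abs_le _ _).trans ?_
      refine mul_le_mul_of_nonneg_right (a2.trans ?_) (norm_nonneg _)
      gcongr
    have e1 : dJint G e η s - dJint G e' η s =
        (dqCLM G (ev e s) (e.2 s) - dqCLM G (ev e' s) (e'.2 s)) (ev η s) +
        (dvCLM G (ev e s) (e.2 s) - dvCLM G (ev e' s) (e'.2 s)) (η.2 s) := by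
      simp only [dJint, _root_.sub_apply]; ring
    rw [e1]
    refine (abs_add_le _ _).trans ((add_le_add b1 b2).trans (le_of_eq ?_))
    simp only [B]; ring
  have i1 := (sq_integrable e'.2).const_mul (L' * (2 * ‖η‖) * (2 * ‖d‖))
  have i2 := (int_mul_integrable e.2 d.2).const_mul (L' * (2 * ‖η‖))
  have i3 := (int_mul_integrable e'.2 d.2).const_mul (L' * (2 * ‖η‖))
  have i4 := (int_mul_integrable e'.2 η.2).const_mul (L * (2 * ‖d‖))
  have i5 := (int_mul_integrable d.2 η.2).const_mul L
  have hB : ∫ s, B s ∂muI = L' * (2 * ‖η‖) * (2 * ‖d‖) * ∫ s, ‖e'.2 s‖ ^ 2 ∂muI +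
      L' * (2 * ‖η‖) * (∫ s, ‖e.2 s‖ * ‖d.2 s‖ ∂muI) +
      L' * (2 * ‖η‖) * (∫ s, ‖e'.2 s‖ * ‖d.2 s‖ ∂muI) +
      L * (2 * ‖d‖) * (∫ s, ‖e'.2 s‖ * ‖η.2 s‖ ∂muI) + L * ∫ s, ‖d.2 s‖ * ‖η.2 s‖ ∂muI := by
    simp only [B]
    have i123 : Integrable (fun s => L' * (2 * ‖η‖) * (2 * ‖d‖) * ‖e'.2 s‖ ^ 2 +
      L' * (2 * ‖η‖) * (‖e.2 s‖ * ‖d.2 s‖) + L' * (2 * ‖η‖) * (‖e'.2 s‖ * ‖d.2 s‖)) muI :=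
      (i1.add i2).add i3
    rw [int_add3 i123 i4 i5, int_add3 i1 i2 i3]
    simp only [integral_const_mul]
  have hIntg := (dJint_integrable hG e η).sub (dJint_integrable hG e' η)
  have h1 : |∫ s, (dJint G e η s - dJint G e' η s) ∂muI| ≤ ∫ s, B s ∂muI := by
    refine abs_integral_le_integral_abs.trans ?_
    exact integral_mono_ae hIntg.abs ((((i1.add i2).add i3).add i4).add i5) hpt
  rw [hB] at h1
  have c1 := int_sq_le he2'
  have c2 : ∫ s, ‖e.2 s‖ * ‖d.2 s‖ ∂muI ≤ R * ‖d‖ :=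
    (int_mul_le _ _).trans (mul_le_mul he2 hdn (norm_nonneg _) hR)
  have c3 : ∫ s, ‖e'.2 s‖ * ‖d.2 s‖ ∂muI ≤ R * ‖d‖ :=
    (int_mul_le _ _).trans (mul_le_mul he2' hdn (norm_nonneg _) hR)
  have c4 : ∫ s, ‖e'.2 s‖ * ‖η.2 s‖ ∂muI ≤ R * ‖η‖ :=
    (int_mul_le _ _).trans (mul_le_mul he2' (norm_snd_le η) (norm_nonneg _) hR)
  have c5 : ∫ s, ‖d.2 s‖ * ‖η.2 s‖ ∂muI ≤ ‖d‖ * ‖η‖ :=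
    (int_mul_le _ _).trans (mul_le_mul hdn (norm_snd_le η) (norm_nonneg _) (norm_nonneg _))
  have h2 : |∫ s, (dJint G e η s - dJint G e' η s) ∂muI| ≤
      L' * (2 * ‖η‖) * (2 * ‖d‖) * R ^ 2 + L' * (2 * ‖η‖) * (R * ‖d‖) +
      L' * (2 * ‖η‖) * (R * ‖d‖) + L * (2 * ‖d‖) * (R * ‖η‖) + L * (‖d‖ * ‖η‖) := by
    refine h1.trans ?_
    gcongr
  unfold dJE
  rw [← mul_sub, ← integral_sub (dJint_integrable hG e η) (dJint_integrable hG e' η), abs_mul,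
    abs_of_pos (by norm_num : (0:ℝ) < 1 / 2)]
  have p : 0 ≤ L * (‖d‖ * ‖η‖) := by positivity
  nlinarith

theorem dJE_mono (hG : IsFinslerEnergy n G ℓ α) (R : ℝ) : ∃ K : ℝ, 0 ≤ K ∧
    ∀ (e e' : HH (Evec n)) (σ : ℝ), ‖e‖ ≤ R → ‖e'‖ ≤ R →
      (∀ s, ‖ev e s - ev e' s‖ ≤ σ) →
      α * ‖e.2 - e'.2‖ ^ 2 ≤ 2 * (dJE G e (e - e') - dJE G e' (e - e')) + K * σ := by
  obtain ⟨L, hL, hdv⟩ := dv_lip hG (2 * R)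
  have hl := hG.one_le_ell
  refine ⟨4 * ℓ * R ^ 2 + 2 * L * R ^ 2, by positivity, fun e e' σ he he' hσ => ?_⟩
  have hσ0 : 0 ≤ σ := (norm_nonneg _).trans (hσ 0)
  have hR : 0 ≤ R := (norm_nonneg _).trans he
  have he2 : ‖e.2‖ ≤ R := (norm_snd_le e).trans he
  have he2' : ‖e'.2‖ ≤ R := (norm_snd_le e').trans he'
  set d := e - e' with hd
  have hdd : d.2 = e.2 - e'.2 := rfl
  have hdn : ‖d.2‖ ≤ 2 * R := by rw [hdd]; exact (norm_sub_le _ _).trans (by linarith)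
  have hev : ∀ s, ‖ev e s‖ ≤ 2 * R := fun s => (norm_ev_le e s).trans (by linarith)
  have hev' : ∀ s, ‖ev e' s‖ ≤ 2 * R := fun s => (norm_ev_le e' s).trans (by linarith)
  let B : ℝ → ℝ := fun s => α * ‖d.2 s‖ ^ 2 - (2 * ℓ * σ * ‖e.2 s‖ ^ 2 + 2 * ℓ * σ * ‖e'.2 s‖ ^ 2
    + L * σ * (‖e'.2 s‖ * ‖d.2 s‖))
  have hpt : ∀ᵐ s ∂muI, B s ≤ dJint G e d s - dJint G e' d s := by
    filter_upwards [Lp.coeFn_sub e.2 e'.2] with s hs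
    have hs' : d.2 s = e.2 s - e'.2 s := hs
    have hes : ‖ev d s‖ ≤ σ := by rw [hd, ev_sub]; exact hσ s
    have a1 : |dqCLM G (ev e s) (e.2 s) (ev d s)| ≤ 2 * ℓ * ‖e.2 s‖ ^ 2 * σ :=
      (clm_abs_le _ _).trans
        (mul_le_mul (dq_le hG _ _) hes (norm_nonneg _) (by positivity))
    have a2 : |dqCLM G (ev e' s) (e'.2 s) (ev d s)| ≤ 2 * ℓ * ‖e'.2 s‖ ^ 2 * σ :=
      (clm_abs_le _ _).trans
        (mul_le_mul (dq_le hG _ _) hes (norm_nonneg _) (by positivity))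
    have a3 := dv_mono hG (ev e s) (e.2 s) (e'.2 s)
    rw [← hs'] at a3
    have a4 : |(dvCLM G (ev e s) (e'.2 s) - dvCLM G (ev e' s) (e'.2 s)) (d.2 s)| ≤
        L * (‖e'.2 s‖ * σ) * ‖d.2 s‖ := by
      refine (clm_abs_le _ _).trans ?_
      refine mul_le_mul_of_nonneg_right ?_ (norm_nonneg _)
      refine (hdv (ev e s) (ev e' s) (e'.2 s) (e'.2 s) (hev s) (hev' s)).trans ?_
      rw [sub_self, norm_zero, add_zero]
      gcongr
      exact hσ s
    simp only [_root_.sub_apply] at a3 a4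
    simp only [dJint, B]
    have := abs_le.1 a1; have := abs_le.1 a2; have := abs_le.1 a4
    linarith
  have i1 := (sq_integrable d.2).const_mul α
  have i2 := (sq_integrable e.2).const_mul (2 * ℓ * σ)
  have i3 := (sq_integrable e'.2).const_mul (2 * ℓ * σ)
  have i4 := (int_mul_integrable e'.2 d.2).const_mul (L * σ)
  have hB : ∫ s, B s ∂muI = α * ‖d.2‖ ^ 2 - (2 * ℓ * σ * ∫ s, ‖e.2 s‖ ^ 2 ∂muI +
      2 * ℓ * σ * ∫ s, ‖e'.2 s‖ ^ 2 ∂muI + L * σ * ∫ s, ‖e'.2 s‖ * ‖d.2 s‖ ∂muI) := by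
    simp only [B]
    have i123 : Integrable (fun s => 2 * ℓ * σ * ‖e.2 s‖ ^ 2 + 2 * ℓ * σ * ‖e'.2 s‖ ^ 2
      + L * σ * (‖e'.2 s‖ * ‖d.2 s‖)) muI := (i2.add i3).add i4
    rw [integral_sub i1 i123, int_add3 i2 i3 i4, L2_norm_sq d.2]
    simp only [integral_const_mul]
  have h1 : ∫ s, B s ∂muI ≤ ∫ s, (dJint G e d s - dJint G e' d s) ∂muI :=
    integral_mono_ae (i1.sub ((i2.add i3).add i4))
      ((dJint_integrable hG e d).sub (dJint_integrable hG e' d)) hpt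
  rw [hB, integral_sub (dJint_integrable hG e d) (dJint_integrable hG e' d)] at h1
  have c1 := int_sq_le he2
  have c2 := int_sq_le he2'
  have c3 : ∫ s, ‖e'.2 s‖ * ‖d.2 s‖ ∂muI ≤ R * (2 * R) :=
    (int_mul_le _ _).trans (mul_le_mul he2' hdn (norm_nonneg _) hR)
  have k1 : 2 * ℓ * σ * ∫ s, ‖e.2 s‖ ^ 2 ∂muI ≤ 2 * ℓ * σ * R ^ 2 := by gcongr
  have k2 : 2 * ℓ * σ * ∫ s, ‖e'.2 s‖ ^ 2 ∂muI ≤ 2 * ℓ * σ * R ^ 2 := by gcongr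
  have k3 : L * σ * ∫ s, ‖e'.2 s‖ * ‖d.2 s‖ ∂muI ≤ L * σ * (R * (2 * R)) := by gcongr
  have e1 : 2 * (dJE G e d - dJE G e' d) =
      ∫ s, dJint G e d s ∂muI - ∫ s, dJint G e' d s ∂muI := by
    unfold dJE; ring
  rw [e1, ← hdd]
  linarith

end dJsec

section prodsec
variable {n : ℕ}

def Ncur (P : Fin n → Polynomial ℝ) (s : ℝ) : Evec n := WithLp.toLp 2 (fun i => (P i).eval s)

def Pder (P : Fin n → Polynomial ℝ) : Fin n → Polynomial ℝ := fun i => (P i).derivative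

theorem Ncur_apply (P : Fin n → Polynomial ℝ) (s : ℝ) (i : Fin n) :
    Ncur P s i = (P i).eval s := rfl

theorem Ncur_continuous (P : Fin n → Polynomial ℝ) : Continuous (Ncur P) := by
  unfold Ncur
  refine (PiLp.continuous_toLp 2 _).comp ?_
  exact continuous_pi fun i => (P i).continuous

theorem Ncur_bound (P : Fin n → Polynomial ℝ) : ∃ K : ℝ, 0 ≤ K ∧ ∀ s ∈ Icc (0:ℝ) 1,
    ‖Ncur P s‖ ≤ K := by
  obtain ⟨K, hK⟩ := (isCompact_Icc (a := (0:ℝ)) (b := 1)).exists_bound_of_continuousOn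
    (Ncur_continuous P).continuousOn
  exact ⟨K, (norm_nonneg _).trans (hK 0 zero_mem01), hK⟩

theorem Ncur_hasDerivAt (P : Fin n → Polynomial ℝ) (s : ℝ) :
    HasDerivAt (Ncur P) (Ncur (Pder P) s) s := by
  rw [hasDerivAt_iff_hasFDerivAt]
  rw [← hasFDerivWithinAt_univ, hasFDerivWithinAt_euclidean]
  intro i
  rw [hasFDerivWithinAt_univ]
  refine HasFDerivAt.congr_fderiv ((P i).hasDerivAt s).hasFDerivAt ?_
  ext
  simp [Ncur_apply, Pder]

theorem Ncur_lip (P : Fin n → Polynomial ℝ) : ∃ K : ℝ, 0 ≤ K ∧ ∀ s ∈ Icc (0:ℝ) 1,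
    ∀ t ∈ Icc (0:ℝ) 1, ‖Ncur P t - Ncur P s‖ ≤ K * |t - s| := by
  obtain ⟨K, hK, h⟩ := Ncur_bound (Pder P)
  refine ⟨K, hK, fun s hs t ht => ?_⟩
  have := (convex_Icc (0:ℝ) 1).norm_image_sub_le_of_norm_hasDerivWithin_le
    (f := Ncur P) (f' := Ncur (Pder P)) (C := K)
    (fun x _ => (Ncur_hasDerivAt P x).hasDerivWithinAt) h hs ht
  simpa using this

/-- derivative of the product -/
def prodD (P : Fin n → Polynomial ℝ) (a : HH ℝ) (s : ℝ) : Evec n :=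
  a.2 s • Ncur P (clamp s) + ev a s • Ncur (Pder P) (clamp s)

theorem clamp_continuous : Continuous clamp := by unfold clamp; fun_prop

theorem prodD_meas (P : Fin n → Polynomial ℝ) (a : HH ℝ) :
    AEStronglyMeasurable (prodD P a) muI :=
  ((Lp.memLp a.2).1.smul
    ((Ncur_continuous P).comp clamp_continuous).aestronglyMeasurable).add
    ((ev_continuous a).aestronglyMeasurable.smul
    ((Ncur_continuous (Pder P)).comp clamp_continuous).aestronglyMeasurable)

theorem prodD_le (P : Fin n → Polynomial ℝ) : ∃ K : ℝ, 0 ≤ K ∧ ∀ a : HH ℝ,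
    ∀ᵐ s ∂muI, ‖prodD P a s‖ ≤ ‖(K • nrm a.2 + (2 * K * ‖a‖) • oneL : L2 ℝ) s‖ := by
  obtain ⟨K, hK, h⟩ := Ncur_bound P
  obtain ⟨K', hK', h'⟩ := Ncur_bound (Pder P)
  refine ⟨K + K', by positivity, fun a => ?_⟩
  filter_upwards [Lp.coeFn_add ((K + K') • nrm a.2) ((2 * (K + K') * ‖a‖) • oneL),
    Lp.coeFn_smul (K + K') (nrm a.2), Lp.coeFn_smul (2 * (K + K') * ‖a‖) oneL, oneL_coe,
    nrm_coe a.2] with s h1 h2 h3 h4 h5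
  rw [h1]
  simp only [Pi.add_apply, h2, h3, Pi.smul_apply, h4, h5, smul_eq_mul, mul_one]
  rw [Real.norm_of_nonneg (by positivity)]
  unfold prodD
  refine (norm_add_le _ _).trans ?_
  rw [norm_smul, norm_smul]
  have e1 := h _ (clamp_mem s)
  have e2 := h' _ (clamp_mem s)
  have e3 := norm_ev_le a s
  have := norm_nonneg (a.2 s)
  have := norm_nonneg a
  have k1 : ‖a.2 s‖ * ‖Ncur P (clamp s)‖ ≤ ‖a.2 s‖ * K := by gcongr
  have k2 : ‖ev a s‖ * ‖Ncur (Pder P) (clamp s)‖ ≤ 2 * ‖a‖ * K' := by gcongr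
  nlinarith [mul_nonneg hK (norm_nonneg a), mul_nonneg hK' (norm_nonneg (a.2 s))]

theorem prodD_memLp (P : Fin n → Polynomial ℝ) (a : HH ℝ) : MemLp (prodD P a) 2 muI := by
  obtain ⟨K, hK, h⟩ := prodD_le P
  exact (Lp.memLp _).mono (prodD_meas P a) (h a)

/-- The product of a scalar curve with a polynomial curve. -/
def prodN (P : Fin n → Polynomial ℝ) (a : HH ℝ) : HH (Evec n) :=
  (a.1 • Ncur P 0, (prodD_memLp P a).toLp _)

theorem prodN_coe (P : Fin n → Polynomial ℝ) (a : HH ℝ) :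
    (prodN P a).2 =ᵐ[muI] prodD P a := (prodD_memLp P a).coeFn_toLp

theorem prodN_sub (P : Fin n → Polynomial ℝ) (a b : HH ℝ) :
    prodN P (a - b) = prodN P a - prodN P b := by
  refine Prod.ext (sub_smul _ _ _) ?_
  apply Lp.ext
  filter_upwards [prodN_coe P a, prodN_coe P b, prodN_coe P (a - b), Lp.coeFn_sub a.2 b.2,
    Lp.coeFn_sub (prodN P a).2 (prodN P b).2] with s h1 h2 h3 h4 h5
  rw [h3]
  have h5' : (prodN P a - prodN P b).2 s = (prodN P a).2 s - (prodN P b).2 s := h5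
  have h4' : (a - b).2 s = a.2 s - b.2 s := h4
  rw [h5', h1, h2]
  simp only [prodD, h4', ev_sub, sub_smul]
  abel

theorem prodN_norm (P : Fin n → Polynomial ℝ) : ∃ K : ℝ, 0 ≤ K ∧ ∀ a : HH ℝ,
    ‖prodN P a‖ ≤ K * ‖a‖ := by
  obtain ⟨K, hK, h⟩ := prodD_le P
  refine ⟨‖Ncur P 0‖ + 3 * K, by positivity, fun a => ?_⟩
  have h1 : ‖(prodN P a).2‖ ≤ 3 * K * ‖a‖ := by
    have : ‖(prodN P a).2‖ ≤ ‖(K • nrm a.2 + (2 * K * ‖a‖) • oneL : L2 ℝ)‖ := by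
      apply Lp.norm_le_norm_of_ae_le
      filter_upwards [h a, prodN_coe P a] with s h1 h2
      rw [h2]; exact h1
    refine this.trans ((norm_add_le _ _).trans ?_)
    rw [norm_smul, norm_smul, nrm_norm, oneL_norm, Real.norm_of_nonneg hK,
      Real.norm_of_nonneg (by positivity)]
    have := norm_snd_le a
    nlinarith [mul_le_mul_of_nonneg_left this hK]
  have h2 : ‖(prodN P a).1‖ ≤ ‖Ncur P 0‖ * ‖a‖ := by
    have : ‖(prodN P a).1‖ = ‖a.1‖ * ‖Ncur P 0‖ := norm_smul _ _
    rw [this, mul_comm]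
    exact mul_le_mul_of_nonneg_left (norm_fst_le a) (norm_nonneg _)
  have := norm_nonneg a
  have := norm_nonneg (Ncur P 0)
  rw [Prod.norm_def]
  refine max_le ?_ ?_
  · nlinarith [mul_nonneg hK (norm_nonneg a)]
  · nlinarith [mul_nonneg (norm_nonneg (Ncur P 0)) (norm_nonneg a)]

theorem scalar_prod (p : Polynomial ℝ) (a : HH ℝ) {s : ℝ} (hs : s ∈ Icc (0:ℝ) 1) :
    ∫ r in (0:ℝ)..s, (a.2 r * p.eval r + ev a r * p.derivative.eval r) =
      ev a s * p.eval s - ev a 0 * p.eval 0 := by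
  have hii : IntervalIntegrable a.2 volume 0 s := ii_of_muI (L2_integrable a.2) zero_mem01 hs
  have hac : AbsolutelyContinuousOnInterval (fun x => a.1 + ∫ r in (0:ℝ)..x, a.2 r) 0 s := by
    have := hii.absolutelyContinuousOnInterval_intervalIntegral (c := 0) (by simp)
    have hc : AbsolutelyContinuousOnInterval (fun _ : ℝ => a.1) 0 s :=
      (LipschitzWith.const a.1).lipschitzOnWith.absolutelyContinuousOnInterval
    exact hc.add this
  have hp : AbsolutelyContinuousOnInterval (fun x => p.eval x) 0 s := by
    have h1 : ContDiff ℝ 1 (fun x => p.eval x) := by simpa using p.contDiff_aeval (𝕜 := ℝ) 1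
    obtain ⟨K, hK⟩ := h1.locallyLipschitz.locallyLipschitzOn.exists_lipschitzOnWith_of_compact
      (isCompact_uIcc (a := (0:ℝ)) (b := s))
    exact hK.absolutelyContinuousOnInterval
  have key := hac.integral_deriv_mul_eq_sub hp
  rw [ev_of_mem a hs, ev_zero]
  simp only [intervalIntegral.integral_same, add_zero] at key
  rw [← key]
  apply intervalIntegral.integral_congr_ae
  filter_upwards [hii.ae_hasDerivAt_integral] with x hx hxs
  have hx' : x ∈ uIcc 0 s := uIoc_subset_uIcc hxs
  have h1 := (hx hx' 0 (by simp)).const_add a.1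
  rw [h1.deriv, Polynomial.deriv]
  rw [uIcc_of_le hs.1] at hx'
  rw [ev_of_mem a ⟨hx'.1, hx'.2.trans hs.2⟩]

theorem ev_prodN (P : Fin n → Polynomial ℝ) (a : HH ℝ) {s : ℝ} (hs : s ∈ Icc (0:ℝ) 1) :
    ev (prodN P a) s = ev a s • Ncur P s := by
  rw [ev_of_mem _ hs, ii_congr (prodN_coe P a) zero_mem01 hs]
  have hIntg : IntervalIntegrable (prodD P a) volume 0 s :=
    ii_of_muI ((prodD_memLp P a).integrable one_le_two) zero_mem01 hs
  ext i
  have h1 := (EuclideanSpace.proj i : Evec n →L[ℝ] ℝ).intervalIntegral_comp_comm hIntg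
  have h2 := scalar_prod (P i) a hs
  have h3 : ∫ r in (0:ℝ)..s, (EuclideanSpace.proj i : Evec n →L[ℝ] ℝ) (prodD P a r) =
      ∫ r in (0:ℝ)..s, (a.2 r * (P i).eval r + ev a r * (P i).derivative.eval r) := by
    apply intervalIntegral.integral_congr
    intro r hr
    rw [uIcc_of_le hs.1] at hr
    have hc : clamp r = r := clamp_of_mem ⟨hr.1, hr.2.trans hs.2⟩
    simp [prodD, hc, Ncur_apply, Pder]
  rw [h1] at h3
  rw [h2] at h3
  have h4 : (∫ r in (0:ℝ)..s, prodD P a r) i = ev a s * (P i).eval s - ev a 0 * (P i).eval 0 := h3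
  rw [PiLp.add_apply, h4, ev_zero]
  simp [prodN, Ncur_apply]

end prodsec

section rampsec

def kap (τ s : ℝ) : ℝ := (Ioc 0 τ).indicator (fun _ => (1:ℝ)) s - (Ioc (1 - τ) 1).indicator (fun _ => (1:ℝ)) s

theorem kap_abs (τ s : ℝ) : |kap τ s| ≤ 1 := by
  unfold kap
  by_cases h1 : s ∈ Ioc 0 τ <;> by_cases h2 : s ∈ Ioc (1 - τ) 1 <;> simp [h1, h2]

theorem kap_left {τ s : ℝ} (hτ : τ ≤ 1 / 2) (hs : s ∈ Ioc 0 τ) : kap τ s = 1 := by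
  have h2 : s ∉ Ioc (1 - τ) 1 := fun h => by have := h.1; have := hs.2; linarith
  unfold kap
  simp [hs, h2]

theorem kap_right {τ s : ℝ} (hτ : τ ≤ 1 / 2) (hs : s ∈ Ioc (1 - τ) 1) : kap τ s = -1 := by
  have h2 : s ∉ Ioc 0 τ := fun h => by have := h.2; have := hs.1; linarith
  unfold kap
  simp [hs, h2]

theorem kap_mid {τ s : ℝ} (h1 : τ < s) (h2 : s ≤ 1 - τ) : kap τ s = 0 := by
  have h3 : s ∉ Ioc 0 τ := fun h => by have := h.2; linarith
  have h4 : s ∉ Ioc (1 - τ) 1 := fun h => by have := h.1; linarith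
  unfold kap
  simp [h3, h4]

theorem kap_meas (τ : ℝ) : Measurable (kap τ) :=
  (measurable_const.indicator measurableSet_Ioc).sub (measurable_const.indicator measurableSet_Ioc)

theorem kap_mul_le (τ : ℝ) (h : L2 ℝ) (s : ℝ) : ‖kap τ s * h s‖ ≤ ‖h s‖ := by
  rw [norm_mul]
  have := kap_abs τ s
  rw [← Real.norm_eq_abs] at this
  nlinarith [norm_nonneg (h s)]

theorem kap_memLp (τ : ℝ) (h : L2 ℝ) : MemLp (fun s => kap τ s * h s) 2 muI :=
  (Lp.memLp h).mono ((kap_meas τ).aestronglyMeasurable.mul (Lp.memLp h).1)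
    (Eventually.of_forall fun s => kap_mul_le τ h s)

def kmul (τ : ℝ) (h : L2 ℝ) : L2 ℝ := (kap_memLp τ h).toLp _

theorem kmul_coe (τ : ℝ) (h : L2 ℝ) : kmul τ h =ᵐ[muI] fun s => kap τ s * h s :=
  (kap_memLp τ h).coeFn_toLp

theorem kmul_norm (τ : ℝ) (h : L2 ℝ) : ‖kmul τ h‖ ≤ ‖h‖ := by
  apply Lp.norm_le_norm_of_ae_le
  filter_upwards [kmul_coe τ h] with s hs
  rw [hs]; exact kap_mul_le τ h s

theorem kmul_sub (τ : ℝ) (h k : L2 ℝ) : kmul τ (h - k) = kmul τ h - kmul τ k := by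
  apply Lp.ext
  filter_upwards [kmul_coe τ h, kmul_coe τ k, kmul_coe τ (h - k), Lp.coeFn_sub h k,
    Lp.coeFn_sub (kmul τ h) (kmul τ k)] with s h1 h2 h3 h4 h5
  rw [h3, h5, Pi.sub_apply, h1, h2, h4, Pi.sub_apply]
  ring

theorem kmul_add (τ : ℝ) (h k : L2 ℝ) : kmul τ (h + k) = kmul τ h + kmul τ k := by
  apply Lp.ext
  filter_upwards [kmul_coe τ h, kmul_coe τ k, kmul_coe τ (h + k), Lp.coeFn_add h k,
    Lp.coeFn_add (kmul τ h) (kmul τ k)] with s h1 h2 h3 h4 h5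
  rw [h3, h5, Pi.add_apply, h1, h2, h4, Pi.add_apply]
  ring

theorem kmul_smul (τ c : ℝ) (h : L2 ℝ) : kmul τ (c • h) = c • kmul τ h := by
  apply Lp.ext
  filter_upwards [kmul_coe τ h, kmul_coe τ (c • h), Lp.coeFn_smul c h,
    Lp.coeFn_smul c (kmul τ h)] with s h1 h2 h3 h4
  rw [h2, h4, Pi.smul_apply, h1, h3, Pi.smul_apply]
  simp only [smul_eq_mul]; ring

theorem abs_int_le (h : L2 ℝ) : |∫ s, h s ∂muI| ≤ ‖h‖ := by
  have h1 : ‖∫ s, h s ∂muI‖ ≤ ∫ s, ‖h s‖ ∂muI := norm_integral_le_integral_norm _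
  exact h1.trans (int_norm_le h)

theorem kmul_one {τ : ℝ} (h0 : 0 ≤ τ) (h1 : τ ≤ 1) : ∫ s, kmul τ oneL s ∂muI = 0 := by
  have e : ∫ s, kmul τ oneL s ∂muI = ∫ s, kap τ s ∂muI := by
    apply integral_congr_ae
    filter_upwards [kmul_coe τ oneL, oneL_coe] with s h1 h2
    rw [h1, h2, mul_one]
  rw [e]
  unfold kap
  rw [integral_sub, integral_indicator measurableSet_Ioc, integral_indicator measurableSet_Ioc]
  · unfold muI
    rw [Measure.restrict_restrict measurableSet_Ioc, Measure.restrict_restrict measurableSet_Ioc,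
      Ioc_inter_Ioc, Ioc_inter_Ioc]
    simp [h1, h0]
  · exact (integrable_const _).indicator measurableSet_Ioc
  · exact (integrable_const _).indicator measurableSet_Ioc

theorem kmul_small (h : L2 ℝ) {ε : ℝ} (hε : 0 < ε) :
    ∃ τ, 0 < τ ∧ τ ≤ 1 / 2 ∧ ‖kmul τ h‖ < ε := by
  have key : Tendsto (fun k : ℕ => ∫ s, ‖kap (1 / ((k:ℝ) + 2)) s * h s‖ ^ 2 ∂muI) atTop
      (nhds (∫ s, (0:ℝ) ∂muI)) := by
    apply tendsto_integral_of_dominated_convergence (fun s => ‖h s‖ ^ 2)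
    · intro k
      exact (((kap_meas _).aestronglyMeasurable.mul (Lp.memLp h).1).norm.pow 2)
    · exact sq_integrable h
    · intro k
      refine Eventually.of_forall fun s => ?_
      rw [norm_pow, norm_norm]
      exact pow_le_pow_left₀ (norm_nonneg _) (kap_mul_le _ h s) 2
    · have hne : ∀ᵐ s ∂muI, s ≠ 1 := by
        unfold muI
        exact ae_restrict_of_ae (by simp [ae_iff])
      have hmem : ∀ᵐ s ∂muI, s ∈ Ioc (0:ℝ) 1 := ae_restrict_mem measurableSet_Ioc
      filter_upwards [hne, hmem] with s h1 h2
      apply tendsto_const_nhds.congr'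
      have h3 : s < 1 := lt_of_le_of_ne h2.2 h1
      have ht : Tendsto (fun k : ℕ => 1 / ((k:ℝ) + 2)) atTop (nhds 0) := by
        have := (tendsto_add_atTop_iff_nat 1).2 (tendsto_one_div_add_atTop_nhds_zero_nat (𝕜 := ℝ))
        refine this.congr fun k => ?_
        push_cast; ring
      filter_upwards [ht.eventually_lt_const h2.1,
        ht.eventually_lt_const (sub_pos.2 h3)] with k hk hk'
      rw [kap_mid hk (by linarith)]
      simp
  simp only [integral_zero] at key
  obtain ⟨k, hk⟩ := (key.eventually_lt_const (by positivity : 0 < ε ^ 2)).exists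
  refine ⟨1 / ((k:ℝ) + 2), by positivity, ?_, ?_⟩
  · apply one_div_le_one_div_of_le (by norm_num)
    have : (0:ℝ) ≤ k := Nat.cast_nonneg k
    linarith
  · refine lt_of_pow_lt_pow_left₀ 2 hε.le ?_
    rw [L2_norm_sq]
    refine lt_of_eq_of_lt ?_ hk
    apply integral_congr_ae
    filter_upwards [kmul_coe (1 / ((k:ℝ) + 2)) h] with s hs
    rw [hs]

/-- slope constant in the ramp -/
def rampc (τ l0 l1 : ℝ) (h : L2 ℝ) : ℝ := l1 - l0 - ∫ s, kmul τ h s ∂muI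

def ramp (τ l0 l1 : ℝ) (h : L2 ℝ) : HH ℝ := (l0, kmul τ h + rampc τ l0 l1 h • oneL)

theorem ramp_coe (τ l0 l1 : ℝ) (h : L2 ℝ) :
    (ramp τ l0 l1 h).2 =ᵐ[muI] fun s => kap τ s * h s + rampc τ l0 l1 h := by
  filter_upwards [kmul_coe τ h, Lp.coeFn_add (kmul τ h) (rampc τ l0 l1 h • oneL),
    Lp.coeFn_smul (rampc τ l0 l1 h) oneL, oneL_coe] with s h1 h2 h3 h4
  have : (ramp τ l0 l1 h).2 s = (kmul τ h + rampc τ l0 l1 h • oneL : L2 ℝ) s := rfl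
  rw [this, h2, Pi.add_apply, h1, h3, Pi.smul_apply, h4]
  simp

theorem rampc_sub (τ l0 l1 m0 m1 : ℝ) (h k : L2 ℝ) :
    rampc τ (l0 - m0) (l1 - m1) (h - k) = rampc τ l0 l1 h - rampc τ m0 m1 k := by
  unfold rampc
  rw [kmul_sub, integral_congr_ae (Lp.coeFn_sub (kmul τ h) (kmul τ k))]
  simp only [Pi.sub_apply]
  rw [integral_sub (L2_integrable _) (L2_integrable _)]
  ring

theorem ramp_sub (τ l0 l1 m0 m1 : ℝ) (h k : L2 ℝ) :
    ramp τ (l0 - m0) (l1 - m1) (h - k) = ramp τ l0 l1 h - ramp τ m0 m1 k := by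
  refine Prod.ext rfl ?_
  have e : (ramp τ l0 l1 h - ramp τ m0 m1 k).2 = (kmul τ h + rampc τ l0 l1 h • oneL) -
    (kmul τ k + rampc τ m0 m1 k • oneL) := rfl
  rw [e]
  show kmul τ (h - k) + rampc τ (l0 - m0) (l1 - m1) (h - k) • oneL = _
  rw [rampc_sub, kmul_sub, sub_smul]
  abel

theorem rampc_abs (τ l0 l1 : ℝ) (h : L2 ℝ) :
    |rampc τ l0 l1 h| ≤ |l0| + |l1| + ‖kmul τ h‖ := by
  unfold rampc
  have h1 := abs_int_le (kmul τ h)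
  have h2 := abs_sub (l1 - l0) (∫ s, kmul τ h s ∂muI)
  have h3 := abs_sub l1 l0
  linarith

theorem ramp_norm (τ l0 l1 : ℝ) (h : L2 ℝ) :
    ‖ramp τ l0 l1 h‖ ≤ |l0| + |l1| + 2 * ‖kmul τ h‖ := by
  have h1 := rampc_abs τ l0 l1 h
  have h0 := norm_nonneg (kmul τ h)
  have := abs_nonneg l0
  have := abs_nonneg l1
  rw [Prod.norm_def]
  refine max_le ?_ ?_
  · show |l0| ≤ _
    linarith
  · show ‖kmul τ h + rampc τ l0 l1 h • oneL‖ ≤ _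
    refine (norm_add_le _ _).trans ?_
    rw [norm_smul, oneL_norm, Real.norm_eq_abs]
    linarith

theorem ramp_ev_zero (τ l0 l1 : ℝ) (h : L2 ℝ) : ev (ramp τ l0 l1 h) 0 = l0 := ev_zero _

theorem ramp_ev_one (τ l0 l1 : ℝ) (h : L2 ℝ) : ev (ramp τ l0 l1 h) 1 = l1 := by
  have h1 := ev_sub_ev (ramp τ l0 l1 h) zero_mem01 one_mem01
  rw [ramp_ev_zero, ← integral_muI] at h1
  have h2 : ∫ s, (ramp τ l0 l1 h).2 s ∂muI = ∫ s, (kmul τ h s + rampc τ l0 l1 h) ∂muI := by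
    apply integral_congr_ae
    filter_upwards [ramp_coe τ l0 l1 h, kmul_coe τ h] with s h1 h2
    rw [h1, h2]
  rw [h2, integral_add (L2_integrable _) (integrable_const _)] at h1
  simp [rampc] at h1
  linarith

theorem muI_ae_Ioc {p : ℝ → Prop} (h : ∀ᵐ s ∂muI, p s) {a b : ℝ} (ha : 0 ≤ a) (hb : b ≤ 1) :
    ∀ᵐ s ∂(volume.restrict (Ioc a b)), p s := by
  unfold muI at h
  exact ae_restrict_of_ae_restrict_of_subset (Ioc_subset_Ioc ha hb) h

theorem ii_mono_muI {f g : ℝ → ℝ} (hf : Integrable f muI) (hg : Integrable g muI) {a b : ℝ}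
    (ha : 0 ≤ a) (hab : a ≤ b) (hb : b ≤ 1) (h : ∀ᵐ s ∂muI, s ∈ Ioc a b → f s ≤ g s) :
    ∫ s in a..b, f s ≤ ∫ s in a..b, g s := by
  have ha' : a ∈ Icc (0:ℝ) 1 := ⟨ha, hab.trans hb⟩
  have hb' : b ∈ Icc (0:ℝ) 1 := ⟨ha.trans hab, hb⟩
  rw [intervalIntegral.integral_of_le hab, intervalIntegral.integral_of_le hab]
  apply integral_mono_ae
  · exact (intervalIntegrable_iff_integrableOn_Ioc_of_le hab).1 (ii_of_muI hf ha' hb')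
  · exact (intervalIntegrable_iff_integrableOn_Ioc_of_le hab).1 (ii_of_muI hg ha' hb')
  · filter_upwards [muI_ae_Ioc h ha hb, ae_restrict_mem measurableSet_Ioc] with s h1 h2
    exact h1 h2

section
variable {τ l0 l1 γ : ℝ} {h : L2 ℝ} {g : ℝ → ℝ}

theorem ramp_left (hτ : τ ≤ 1 / 2) (hg : Integrable g muI)
    (hh : ∀ᵐ s ∂muI, g s + γ ≤ h s) (hc : |rampc τ l0 l1 h| ≤ γ) {s : ℝ} (h0 : 0 ≤ s)
    (hs : s ≤ τ) : l0 + ∫ r in (0:ℝ)..s, g r ≤ ev (ramp τ l0 l1 h) s := by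
  have hs' : s ∈ Icc (0:ℝ) 1 := ⟨h0, by linarith⟩
  rw [ev_of_mem _ hs']
  show l0 + _ ≤ l0 + _
  gcongr
  apply ii_mono_muI hg (L2_integrable _) le_rfl h0 hs'.2
  filter_upwards [hh, ramp_coe τ l0 l1 h] with r h1 h2 h3
  rw [h2, kap_left hτ ⟨h3.1, h3.2.trans hs⟩]
  have := (abs_le.1 hc).1
  linarith

theorem ramp_right (hτ : τ ≤ 1 / 2) (hg : Integrable g muI)
    (hh : ∀ᵐ s ∂muI, g s + γ ≤ h s) (hc : |rampc τ l0 l1 h| ≤ γ) {s : ℝ} (h0 : s ≤ 1)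
    (hs : 1 - τ ≤ s) : l1 + ∫ r in s..1, g r ≤ ev (ramp τ l0 l1 h) s := by
  have hs' : s ∈ Icc (0:ℝ) 1 := ⟨by linarith, h0⟩
  have h1 := ev_sub_ev (ramp τ l0 l1 h) hs' one_mem01
  rw [ramp_ev_one] at h1
  have h2 : ∫ r in s..1, (ramp τ l0 l1 h).2 r ≤ ∫ r in s..1, -g r := by
    apply ii_mono_muI (L2_integrable _) hg.neg hs'.1 h0 le_rfl
    filter_upwards [hh, ramp_coe τ l0 l1 h] with r h1 h2 h3
    rw [h2, kap_right hτ ⟨hs.trans_lt h3.1, h3.2⟩]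
    have := (abs_le.1 hc).2
    rw [Pi.neg_apply]
    linarith
  rw [intervalIntegral.integral_neg] at h2
  linarith

theorem ramp_mid (h0 : 0 < τ) {s : ℝ} (h1 : τ ≤ s) (h2 : s ≤ 1 - τ) :
    min (ev (ramp τ l0 l1 h) τ) (ev (ramp τ l0 l1 h) (1 - τ)) ≤ ev (ramp τ l0 l1 h) s := by
  have key : ∀ a b, τ ≤ a → a ≤ b → b ≤ 1 - τ → ev (ramp τ l0 l1 h) b - ev (ramp τ l0 l1 h) a =
      rampc τ l0 l1 h * (b - a) := by
    intro a b ha hab hb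
    have ha' : a ∈ Icc (0:ℝ) 1 := ⟨by linarith, by linarith⟩
    have hb' : b ∈ Icc (0:ℝ) 1 := ⟨by linarith, by linarith⟩
    rw [ev_sub_ev _ ha' hb']
    have : ∫ r in a..b, (ramp τ l0 l1 h).2 r = ∫ r in a..b, rampc τ l0 l1 h := by
      rw [intervalIntegral.integral_of_le hab, intervalIntegral.integral_of_le hab]
      apply integral_congr_ae
      filter_upwards [muI_ae_Ioc (ramp_coe τ l0 l1 h) ha'.1 hb'.2,
        ae_restrict_mem measurableSet_Ioc] with r h1 h2
      rw [h1, kap_mid (ha.trans_lt h2.1) (h2.2.trans hb)]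
      ring
    rw [this]
    simp [mul_comm]
  have k1 := key τ s le_rfl h1 h2
  have k2 := key s (1 - τ) h1 h2 le_rfl
  rcases le_total 0 (rampc τ l0 l1 h) with hc | hc
  · refine (min_le_left _ _).trans ?_
    have := mul_nonneg hc (sub_nonneg.2 h1)
    linarith
  · refine (min_le_right _ _).trans ?_
    have := mul_nonpos_of_nonpos_of_nonneg hc (sub_nonneg.2 h2)
    linarith

end
end rampsec

section phisec
variable {n : ℕ} {Φ : Evec n → ℝ} {δ₀ : ℝ}

theorem grad_contDiff (hΦ : IsRegularDomain n Φ δ₀) : ContDiff ℝ 1 (gradient Φ) := by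
  have h1 : ContDiff ℝ 1 (fderiv ℝ Φ) := hΦ.smooth.fderiv_right (by norm_num)
  unfold gradient
  exact (InnerProductSpace.toDual ℝ (Evec n)).symm.toContinuousLinearEquiv.contDiff.comp h1

theorem grad_lip (hΦ : IsRegularDomain n Φ δ₀) (R : ℝ) : ∃ L : ℝ, 0 ≤ L ∧
    ∀ q q' : Evec n, ‖q‖ ≤ R → ‖q'‖ ≤ R → ‖gradient Φ q - gradient Φ q'‖ ≤ L * ‖q - q'‖ := by
  obtain ⟨K, hK⟩ := (grad_contDiff hΦ).locallyLipschitz.locallyLipschitzOn.exists_lipschitzOnWith_of_compact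
    (isCompact_closedBall (0 : Evec n) R)
  refine ⟨K, K.2, fun q q' h h' => ?_⟩
  have := hK.dist_le_mul q (by simpa using h) q' (by simpa using h')
  simpa [dist_eq_norm] using this

theorem grad_bound (hΦ : IsRegularDomain n Φ δ₀) (R : ℝ) : ∃ L : ℝ, 0 ≤ L ∧
    ∀ q : Evec n, ‖q‖ ≤ R → ‖gradient Φ q‖ ≤ L := by
  obtain ⟨K, hK⟩ := (isCompact_closedBall (0 : Evec n) R).exists_bound_of_continuousOn
    (grad_contDiff hΦ).continuous.continuousOn
  exact ⟨|K|, abs_nonneg _, fun q hq => (hK q (by simpa using hq)).trans (le_abs_self _)⟩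

theorem sub_bound (hΦ : IsRegularDomain n Φ δ₀) : ∃ R : ℝ, 0 ≤ R ∧
    ∀ q : Evec n, Φ q ≤ 0 → ‖q‖ ≤ R := by
  obtain ⟨K, hK⟩ := (hΦ.sublevel_compact 0 ⟨le_rfl, hΦ.delta0_pos.le⟩).exists_bound_of_continuousOn
    (f := id) continuousOn_id
  exact ⟨|K|, abs_nonneg _, fun q hq => (hK q hq).trans (le_abs_self _)⟩

theorem grad_lower (hΦ : IsRegularDomain n Φ δ₀) : ∃ c : ℝ, 0 < c ∧
    ∀ q : Evec n, Φ q = 0 → c ≤ ‖gradient Φ q‖ := by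
  have hcomp : IsCompact (Φ ⁻¹' {0}) := by
    apply (hΦ.sublevel_compact 0 ⟨le_rfl, hΦ.delta0_pos.le⟩).of_isClosed_subset
    · exact isClosed_singleton.preimage hΦ.smooth.continuous
    · intro q hq
      exact le_of_eq hq
  rcases (Φ ⁻¹' {0}).eq_empty_or_nonempty with h | h
  · refine ⟨1, one_pos, fun q hq => ?_⟩
    have : q ∈ Φ ⁻¹' {0} := hq
    rw [h] at this
    exact this.elim
  · obtain ⟨q0, hq0, hmin⟩ := hcomp.exists_isMinOn h
      (grad_contDiff hΦ).continuous.norm.continuousOn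
    refine ⟨‖gradient Φ q0‖, ?_, fun q hq => hmin hq⟩
    apply norm_pos_iff.2
    apply hΦ.grad_ne_zero
    have : Φ q0 = 0 := hq0
    rw [this, abs_zero]
    exact hΦ.delta0_pos.le

theorem norm_le_sum_coord (v : Evec n) : ‖v‖ ≤ ∑ i, |v i| := by
  have h : v = ∑ i, v i • (EuclideanSpace.single i (1:ℝ) : Evec n) := by
    ext j
    simp [Pi.single_apply]
  calc ‖v‖ = ‖∑ i, v i • (EuclideanSpace.single i (1:ℝ) : Evec n)‖ := by rw [← h]
    _ ≤ ∑ i, ‖v i • (EuclideanSpace.single i (1:ℝ) : Evec n)‖ := norm_sum_le _ _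
    _ = ∑ i, |v i| := by simp [norm_smul]

theorem exists_poly {f : ℝ → Evec n} (hf : Continuous f) {ε : ℝ} (hε : 0 < ε) :
    ∃ P : Fin n → Polynomial ℝ, ∀ s ∈ Icc (0:ℝ) 1, ‖Ncur P s - f s‖ ≤ ε := by
  have hi : ∀ i, ∃ p : Polynomial ℝ, ∀ s ∈ Icc (0:ℝ) 1, |p.eval s - f s i| < ε / (n + 1) := by
    intro i
    apply exists_polynomial_near_of_continuousOn
    · exact ((PiLp.continuous_apply 2 _ i).comp hf).continuousOn
    · positivity
  choose P hP using hi
  refine ⟨P, fun s hs => (norm_le_sum_coord _).trans ?_⟩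
  have : ∑ i, |(Ncur P s - f s) i| ≤ ∑ i : Fin n, ε / (n + 1) :=
    Finset.sum_le_sum fun i _ => (hP i s hs).le
  refine this.trans ?_
  simp only [Finset.sum_const, Finset.card_univ, Fintype.card_fin, nsmul_eq_mul]
  rw [← mul_div_assoc, div_le_iff₀ (by positivity)]
  nlinarith

theorem exists_N (hΦ : IsRegularDomain n Φ δ₀) {c : ℝ → Evec n} (hc : Continuous c) :
    ∃ (P : Fin n → Polynomial ℝ) (ε cN : ℝ), 0 < ε ∧ 0 < cN ∧ ∀ s ∈ Icc (0:ℝ) 1,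
      ∀ q, ‖q - c s‖ ≤ ε → Φ q = 0 → cN ≤ ⟪gradient Φ q, Ncur P s⟫ := by
  obtain ⟨R, hR⟩ := (isCompact_Icc (a := (0:ℝ)) (b := 1)).exists_bound_of_continuousOn hc.continuousOn
  obtain ⟨L, hL, hlip⟩ := grad_lip hΦ (R + 1)
  obtain ⟨c0, hc0, hlow⟩ := grad_lower hΦ
  obtain ⟨P, hP⟩ := exists_poly ((grad_contDiff hΦ).continuous.comp hc) (by positivity : 0 < c0 / 4)
  refine ⟨P, min 1 (c0 / (4 * (L + 1))), c0 * (c0 / 2), by positivity, by positivity, ?_⟩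
  intro s hs q hq hq0
  have h1 : ‖q - c s‖ ≤ 1 := hq.trans (min_le_left _ _)
  have h2 : ‖q - c s‖ ≤ c0 / (4 * (L + 1)) := hq.trans (min_le_right _ _)
  have h3 := hR s hs
  have hqn : ‖q‖ ≤ R + 1 := by
    have := norm_add_le (q - c s) (c s)
    rw [sub_add_cancel] at this
    linarith
  have h4 := hlip q (c s) hqn (by linarith)
  have h5 := hP s hs
  have h6 : L * ‖q - c s‖ ≤ c0 / 4 := by
    rw [le_div_iff₀ (by positivity)] at h2
    nlinarith [norm_nonneg (q - c s)]
  have h7 : ‖gradient Φ q - Ncur P s‖ ≤ c0 / 2 := by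
    have e : gradient Φ q - Ncur P s = (gradient Φ q - gradient Φ (c s)) -
      (Ncur P s - gradient Φ (c s)) := by abel
    rw [e]
    refine (norm_sub_le _ _).trans ?_
    simp only [Function.comp] at h5
    linarith
  have h8 := real_inner_le_norm (gradient Φ q) (gradient Φ q - Ncur P s)
  rw [inner_sub_right, real_inner_self_eq_norm_sq] at h8
  have h9 := hlow q hq0
  have h10 : ‖gradient Φ q‖ * ‖gradient Φ q - Ncur P s‖ ≤ ‖gradient Φ q‖ * (c0 / 2) := by gcongr
  nlinarith

theorem phi_hasDerivAt (hΦ : IsRegularDomain n Φ δ₀) (q d : Evec n) (t : ℝ) :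
    HasDerivAt (fun t : ℝ => Φ (q + t • d)) ⟪gradient Φ (q + t • d), d⟫ t := by
  have h1 : DifferentiableAt ℝ Φ (q + t • d) :=
    (hΦ.smooth.differentiable (by norm_num)).differentiableAt
  have h2 : HasDerivAt (fun t : ℝ => q + t • d) d t := by
    simpa using ((hasDerivAt_id t).smul_const d).const_add q
  have h3 := h1.hasGradientAt.hasFDerivAt.comp_hasDerivAt t h2
  exact h3

/-- Taylor remainder -/
def Rem (Φ : Evec n → ℝ) (q q' : Evec n) : ℝ := Φ q' - Φ q - ⟪gradient Φ q, q' - q⟫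

theorem Rem_lip (hΦ : IsRegularDomain n Φ δ₀) (R : ℝ) : ∃ K : ℝ, 0 ≤ K ∧
    ∀ (q q' p p' : Evec n) (σ : ℝ), ‖q‖ ≤ R → ‖q'‖ ≤ R → ‖p‖ ≤ R → ‖p'‖ ≤ R →
      ‖q' - q‖ ≤ σ → ‖p' - p‖ ≤ σ →
      |Rem Φ q q' - Rem Φ p p'| ≤ K * σ * (‖q - p‖ + ‖q' - p'‖) := by
  obtain ⟨L, hL, hlip⟩ := grad_lip hΦ R
  refine ⟨4 * L, by positivity, fun q q' p p' σ hq hq' hp hp' h1 h2 => ?_⟩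
  have hσ : 0 ≤ σ := (norm_nonneg _).trans h1
  set d := q' - q with hd
  set d' := p' - p with hd'
  have hball : ∀ (a b : Evec n), ‖a‖ ≤ R → ‖b‖ ≤ R → ∀ t ∈ Icc (0:ℝ) 1,
      ‖a + t • (b - a)‖ ≤ R := by
    intro a b ha hb t ht
    have e : a + t • (b - a) = (1 - t) • a + t • b := by
      rw [smul_sub, sub_smul, one_smul]; abel
    rw [e]
    refine (norm_add_le _ _).trans ?_
    rw [norm_smul, norm_smul, Real.norm_of_nonneg (by linarith [ht.2]), Real.norm_of_nonneg ht.1]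
    nlinarith [ht.1, ht.2]
  let f : ℝ → ℝ := fun t => Φ (q + t • d) - Φ (p + t • d') -
    t * (⟪gradient Φ q, d⟫ - ⟪gradient Φ p, d'⟫)
  have hder : ∀ t, HasDerivAt f (⟪gradient Φ (q + t • d), d⟫ - ⟪gradient Φ (p + t • d'), d'⟫ -
      (⟪gradient Φ q, d⟫ - ⟪gradient Φ p, d'⟫)) t := by
    intro t
    have := ((phi_hasDerivAt hΦ q d t).sub (phi_hasDerivAt hΦ p d' t)).sub
      ((hasDerivAt_id t).mul_const (⟪gradient Φ q, d⟫ - ⟪gradient Φ p, d'⟫))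
    rw [one_mul] at this
    exact this
  have hdd : ‖d - d'‖ ≤ ‖q - p‖ + ‖q' - p'‖ := by
    have e : d - d' = (q' - p') - (q - p) := by rw [hd, hd']; abel
    rw [e]
    refine (norm_sub_le _ _).trans ?_
    linarith
  have hbd : ∀ t ∈ Icc (0:ℝ) 1, ‖⟪gradient Φ (q + t • d), d⟫ - ⟪gradient Φ (p + t • d'), d'⟫ -
      (⟪gradient Φ q, d⟫ - ⟪gradient Φ p, d'⟫)‖ ≤ 4 * L * σ * (‖q - p‖ + ‖q' - p'‖) := by
    intro t ht
    have b1 := hball q q' hq hq' t ht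
    have b2 := hball p p' hp hp' t ht
    have e : ⟪gradient Φ (q + t • d), d⟫ - ⟪gradient Φ (p + t • d'), d'⟫ -
      (⟪gradient Φ q, d⟫ - ⟪gradient Φ p, d'⟫) =
      ⟪gradient Φ (q + t • d) - gradient Φ q, d - d'⟫ +
      ⟪gradient Φ (q + t • d) - gradient Φ (p + t • d'), d'⟫ - ⟪gradient Φ q - gradient Φ p, d'⟫ := by
      simp only [inner_sub_left, inner_sub_right]; ring
    rw [e]
    have c1 : ‖gradient Φ (q + t • d) - gradient Φ q‖ ≤ L * σ := by
      refine (hlip _ _ b1 hq).trans ?_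
      rw [add_sub_cancel_left, norm_smul, Real.norm_of_nonneg ht.1]
      have : t * ‖d‖ ≤ σ := by nlinarith [ht.1, ht.2, norm_nonneg d]
      gcongr
    have c2 : ‖gradient Φ (q + t • d) - gradient Φ (p + t • d')‖ ≤
        L * (‖q - p‖ + (‖q - p‖ + ‖q' - p'‖)) := by
      refine (hlip _ _ b1 b2).trans ?_
      have e : q + t • d - (p + t • d') = (q - p) + t • (d - d') := by
        rw [add_sub_add_comm, ← smul_sub]
      rw [e]
      gcongr
      refine (norm_add_le _ _).trans ?_
      rw [norm_smul, Real.norm_of_nonneg ht.1]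
      have : t * ‖d - d'‖ ≤ ‖q - p‖ + ‖q' - p'‖ := by nlinarith [ht.1, ht.2, norm_nonneg (d - d')]
      linarith
    have c3 := hlip q p hq hp
    have i1 := abs_real_inner_le_norm (gradient Φ (q + t • d) - gradient Φ q) (d - d')
    have i2 := abs_real_inner_le_norm (gradient Φ (q + t • d) - gradient Φ (p + t • d')) d'
    have i3 := abs_real_inner_le_norm (gradient Φ q - gradient Φ p) d'
    have j1 : ‖gradient Φ (q + t • d) - gradient Φ q‖ * ‖d - d'‖ ≤
      (L * σ) * (‖q - p‖ + ‖q' - p'‖) := by gcongr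
    have j2 : ‖gradient Φ (q + t • d) - gradient Φ (p + t • d')‖ * ‖d'‖ ≤
      L * (‖q - p‖ + (‖q - p‖ + ‖q' - p'‖)) * σ := by gcongr
    have j3 : ‖gradient Φ q - gradient Φ p‖ * ‖d'‖ ≤ L * ‖q - p‖ * σ := by gcongr
    rw [Real.norm_eq_abs]
    have k1 := abs_sub (⟪gradient Φ (q + t • d) - gradient Φ q, d - d'⟫ +
      ⟪gradient Φ (q + t • d) - gradient Φ (p + t • d'), d'⟫) ⟪gradient Φ q - gradient Φ p, d'⟫
    have k2 := abs_add_le ⟪gradient Φ (q + t • d) - gradient Φ q, d - d'⟫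
      ⟪gradient Φ (q + t • d) - gradient Φ (p + t • d'), d'⟫
    have : 0 ≤ L * σ * ‖q' - p'‖ := by positivity
    nlinarith
  have key := norm_image_sub_le_of_norm_deriv_le_segment_01' (f := f)
    (fun t ht => (hder t).hasDerivWithinAt) (fun t ht => hbd t ⟨ht.1, ht.2.le⟩)
  have e1 : f 1 - f 0 = Rem Φ q q' - Rem Φ p p' := by
    have a1 : q + (1:ℝ) • d = q' := by rw [one_smul, hd]; abel
    have a2 : p + (1:ℝ) • d' = p' := by rw [one_smul, hd']; abel
    simp only [f, a1, a2, zero_smul, add_zero, Rem, ← hd, ← hd']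
    ring
  rw [e1] at key
  exact key

theorem Rem_self (q : Evec n) : Rem Φ q q = 0 := by simp [Rem]

end phisec

section locsec
variable {n : ℕ} {Φ : Evec n → ℝ} {δ₀ : ℝ}

def MfE (Φ : Evec n → ℝ) (x : HH (Evec n)) : Prop :=
  (∀ s ∈ Icc (0:ℝ) 1, Φ (ev x s) ≤ 0) ∧ Φ (ev x 0) = 0 ∧ Φ (ev x 1) = 0

def VmE (Φ : Evec n → ℝ) (x ξ : HH (Evec n)) : Prop :=
  ⟪gradient Φ (ev x 0), ev ξ 0⟫ = 0 ∧ ⟪gradient Φ (ev x 1), ev ξ 1⟫ = 0 ∧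
  ∀ s ∈ Ioo (0:ℝ) 1, Φ (ev x s) = 0 → ⟪gradient Φ (ev x s), ev ξ s⟫ ≤ 0

def WmE (Φ : Evec n → ℝ) (x ξ : HH (Evec n)) : Prop :=
  ⟪gradient Φ (ev x 0), ev ξ 0⟫ = 0 ∧ ⟪gradient Φ (ev x 1), ev ξ 1⟫ = 0 ∧
  ∀ s ∈ Ioo (0:ℝ) 1, Φ (ev x s) = 0 → ⟪gradient Φ (ev x s), ev ξ s⟫ < 0

def qq (y z : HH (Evec n)) : L2 ℝ := nrm y.2 + nrm z.2 + oneL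

theorem qq_coe (y z : HH (Evec n)) : qq y z =ᵐ[muI] fun s => ‖y.2 s‖ + ‖z.2 s‖ + 1 := by
  filter_upwards [nrm_coe y.2, nrm_coe z.2, oneL_coe, Lp.coeFn_add (nrm y.2 + nrm z.2) oneL,
    Lp.coeFn_add (nrm y.2) (nrm z.2)] with s h1 h2 h3 h4 h5
  have : qq y z s = (nrm y.2 + nrm z.2 + oneL : L2 ℝ) s := rfl
  rw [this, h4, Pi.add_apply, h5, Pi.add_apply, h1, h2, h3]

theorem qq_int (y z : HH (Evec n)) {s t : ℝ} (hs : 0 ≤ s) (hst : s ≤ t) (ht : t ≤ 1) :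
    ‖ev y t - ev y s‖ + ‖ev z t - ev z s‖ + (t - s) ≤ ∫ r in s..t, qq y z r := by
  have hs' : s ∈ Icc (0:ℝ) 1 := ⟨hs, hst.trans ht⟩
  have ht' : t ∈ Icc (0:ℝ) 1 := ⟨hs.trans hst, ht⟩
  rw [ii_congr (qq_coe y z) hs' ht']
  have i1 : IntervalIntegrable (fun s => ‖y.2 s‖) volume s t :=
    ii_of_muI (L2_integrable y.2).norm hs' ht'
  have i2 : IntervalIntegrable (fun s => ‖z.2 s‖) volume s t :=
    ii_of_muI (L2_integrable z.2).norm hs' ht'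
  rw [intervalIntegral.integral_add (i1.add i2) (by simp), intervalIntegral.integral_add i1 i2]
  have h1 := norm_ev_sub_le y hs' ht' hst
  have h2 := norm_ev_sub_le z hs' ht' hst
  simp only [intervalIntegral.integral_const, smul_eq_mul, mul_one]
  linarith

theorem qq_norm (y z : HH (Evec n)) : ‖qq y z‖ ≤ ‖y‖ + ‖z‖ + 1 := by
  unfold qq
  refine (norm_add_le _ _).trans ?_
  have := norm_add_le (nrm y.2) (nrm z.2)
  rw [nrm_norm, nrm_norm] at this
  rw [oneL_norm]
  have := norm_snd_le y
  have := norm_snd_le z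
  linarith

theorem qq_sub (y y' z : HH (Evec n)) : ‖qq y z - qq y' z‖ ≤ ‖y - y'‖ := by
  have e : qq y z - qq y' z = nrm y.2 - nrm y'.2 := by unfold qq; abel
  rw [e]
  exact (nrm_sub_le _ _).trans (norm_snd_le (y - y'))

theorem inner_diff_le (a b a' b' : Evec n) :
    |⟪a, b⟫ - ⟪a', b'⟫| ≤ ‖a - a'‖ * ‖b‖ + ‖a'‖ * ‖b - b'‖ := by
  have e : ⟪a, b⟫ - ⟪a', b'⟫ = ⟪a - a', b⟫ + ⟪a', b - b'⟫ := by
    simp only [inner_sub_left, inner_sub_right]; ring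
  rw [e]
  exact (abs_add_le _ _).trans (add_le_add (abs_real_inner_le_norm _ _) (abs_real_inner_le_norm _ _))

theorem barrier {us u0 Ds D0 l0 lam I A B cN : ℝ} (hu : us - u0 ≤ A) (hD : |Ds - D0| ≤ B)
    (h0 : l0 * D0 = u0) (hl : l0 + I ≤ lam) (hI : 0 ≤ I) (hc : cN ≤ Ds) (hc0 : 0 ≤ cN) :
    us - lam * Ds ≤ A + |l0| * B - cN * I := by
  have h1 : (l0 + I) * Ds ≤ lam * Ds := mul_le_mul_of_nonneg_right hl (hc0.trans hc)
  have h2 : I * cN ≤ I * Ds := mul_le_mul_of_nonneg_left hc hI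
  have h3 : |l0 * (D0 - Ds)| ≤ |l0| * B := by
    rw [abs_mul, abs_sub_comm]
    exact mul_le_mul_of_nonneg_left hD (abs_nonneg _)
  have h4 := (abs_le.1 h3).2
  nlinarith

/-- the pairing with `N` -/
def Dd (Φ : Evec n → ℝ) (P : Fin n → Polynomial ℝ) (y : HH (Evec n)) (s : ℝ) : ℝ :=
  ⟪gradient Φ (ev y s), Ncur P s⟫

theorem Dd_var (hΦ : IsRegularDomain n Φ δ₀) (P : Fin n → Polynomial ℝ) (R : ℝ) :
    ∃ K : ℝ, 0 ≤ K ∧ ∀ y : HH (Evec n), (∀ s ∈ Icc (0:ℝ) 1, ‖ev y s‖ ≤ R) →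
      ∀ s ∈ Icc (0:ℝ) 1, ∀ t ∈ Icc (0:ℝ) 1,
      |Dd Φ P y t - Dd Φ P y s| ≤ K * (‖ev y t - ev y s‖ + |t - s|) := by
  obtain ⟨L, hL, hlip⟩ := grad_lip hΦ R
  obtain ⟨B, hB, hb⟩ := grad_bound hΦ R
  obtain ⟨KN, hKN, hN⟩ := Ncur_bound P
  obtain ⟨LN, hLN, hNl⟩ := Ncur_lip P
  refine ⟨L * KN + B * LN, by positivity, fun y hy s hs t ht => ?_⟩
  refine (inner_diff_le _ _ _ _).trans ?_
  have h1 : ‖gradient Φ (ev y t) - gradient Φ (ev y s)‖ * ‖Ncur P t‖ ≤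
      L * ‖ev y t - ev y s‖ * KN := by
    gcongr
    · exact hlip _ _ (hy t ht) (hy s hs)
    · exact hN t ht
  have h2 : ‖gradient Φ (ev y s)‖ * ‖Ncur P t - Ncur P s‖ ≤ B * (LN * |t - s|) := by
    gcongr
    · exact hb _ (hy s hs)
    · exact hNl s hs t ht
  have h3 : 0 ≤ L * KN * |t - s| := by positivity
  have h4 : 0 ≤ B * LN * ‖ev y t - ev y s‖ := by positivity
  nlinarith

theorem inner_sub_prodN (P : Fin n → Polynomial ℝ) (y ζ : HH (Evec n)) (a : HH ℝ) {s : ℝ}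
    (hs : s ∈ Icc (0:ℝ) 1) : ⟪gradient Φ (ev y s), ev (ζ - prodN P a) s⟫ =
    ⟪gradient Φ (ev y s), ev ζ s⟫ - ev a s * Dd Φ P y s := by
  rw [ev_sub, ev_prodN P a hs, inner_sub_right, inner_smul_right]
  rfl

theorem mid_compact (hΦ : IsRegularDomain n Φ δ₀) {x ξ : HH (Evec n)} (hξ : VmE Φ x ξ)
    {τ θ : ℝ} (hτ : 0 < τ) (hθ : 0 < θ) : ∃ r > 0, ∀ s ∈ Icc τ (1 - τ), ∀ q,
      ‖q - ev x s‖ ≤ r → Φ q = 0 → ⟪gradient Φ q, ev ξ s⟫ < θ := by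
  have cx := ev_continuous x
  have cξ := ev_continuous ξ
  have cg := (grad_contDiff hΦ).continuous
  have cΦ := hΦ.smooth.continuous
  let S : Set (ℝ × Evec n) := {p | p.1 ∈ Icc τ (1 - τ) ∧ Φ p.2 = 0 ∧
    θ ≤ ⟪gradient Φ p.2, ev ξ p.1⟫}
  have hScomp : IsCompact S := by
    apply (isCompact_Icc.prod (hΦ.sublevel_compact 0 ⟨le_rfl, hΦ.delta0_pos.le⟩)).of_isClosed_subset
    · refine (isClosed_Icc.preimage continuous_fst).inter (IsClosed.inter ?_ ?_)
      · exact isClosed_eq (cΦ.comp continuous_snd) continuous_const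
      · have c1 : Continuous fun p : ℝ × Evec n => ⟪gradient Φ p.2, ev ξ p.1⟫ :=
          (cg.comp continuous_snd).inner (cξ.comp continuous_fst)
        exact isClosed_le (continuous_const (y := θ)) c1
    · rintro ⟨s, q⟩ ⟨h1, h2, h3⟩
      exact ⟨h1, le_of_eq h2⟩
  rcases S.eq_empty_or_nonempty with h | h
  · refine ⟨1, one_pos, fun s hs q _ hq0 => ?_⟩
    by_contra hcon
    have : (s, q) ∈ S := ⟨hs, hq0, not_lt.1 hcon⟩
    rw [h] at this
    exact this
  · have cn : Continuous fun p : ℝ × Evec n => ‖p.2 - ev x p.1‖ :=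
      (continuous_snd.sub (cx.comp continuous_fst)).norm
    obtain ⟨⟨s0, q0⟩, hp0, hmin⟩ := hScomp.exists_isMinOn h
      cn.continuousOn
    rw [isMinOn_iff] at hmin
    have hpos : 0 < ‖q0 - ev x s0‖ := by
      apply norm_pos_iff.2
      intro h0
      have e := sub_eq_zero.1 h0
      obtain ⟨h1, h2, h3⟩ := hp0
      simp only at h1 h2 h3
      rw [e] at h2 h3
      have := hξ.2.2 s0 ⟨hτ.trans_le h1.1, by linarith [h1.2]⟩ h2
      linarith
    refine ⟨‖q0 - ev x s0‖ / 2, by positivity, fun s hs q hq hq0 => ?_⟩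
    by_contra hcon
    have hm : (s, q) ∈ S := ⟨hs, hq0, not_lt.1 hcon⟩
    have : ‖q0 - ev x s0‖ ≤ ‖q - ev x s‖ := hmin (s, q) hm
    linarith

theorem ev_near (y x : HH (Evec n)) (s : ℝ) : ‖ev y s - ev x s‖ ≤ 2 * ‖y - x‖ := by
  rw [← ev_sub]; exact norm_ev_le _ _

theorem quot_lip {a a' d d' c A X Y : ℝ} (hc : 0 < c) (hd : c ≤ d) (hd' : c ≤ d') (hA : |a'| ≤ A)
    (hX : |a - a'| ≤ X) (hY : |d - d'| ≤ Y) : |a / d - a' / d'| ≤ X / c + A * Y / (c * c) := by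
  have hd0 : 0 < d := hc.trans_le hd
  have hd0' : 0 < d' := hc.trans_le hd'
  have e : a / d - a' / d' = (a - a') / d + a' * (d' - d) / (d * d') := by field_simp; ring
  rw [e]
  refine (abs_add_le _ _).trans (add_le_add ?_ ?_)
  · rw [abs_div, abs_of_pos hd0]
    have := (abs_nonneg _).trans hX
    gcongr
  · rw [abs_div, abs_mul, abs_of_pos (mul_pos hd0 hd0'), abs_sub_comm d' d]
    have := (abs_nonneg _).trans hA
    have := (abs_nonneg _).trans hY
    gcongr

/-- the boundary coefficient -/
def bb (Φ : Evec n → ℝ) (P : Fin n → Polynomial ℝ) (ξ y : HH (Evec n)) (s : ℝ) : ℝ :=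
  ⟪gradient Φ (ev y s), ev ξ s⟫ / Dd Φ P y s

theorem bb_est (hΦ : IsRegularDomain n Φ δ₀) (P : Fin n → Polynomial ℝ) (ξ : HH (Evec n))
    (R : ℝ) {cN : ℝ} (hcN : 0 < cN) : ∃ K : ℝ, 0 ≤ K ∧ ∀ y z : HH (Evec n), ∀ s ∈ Icc (0:ℝ) 1,
      ‖ev y s‖ ≤ R → ‖ev z s‖ ≤ R → cN ≤ Dd Φ P y s → cN ≤ Dd Φ P z s →
      |bb Φ P ξ y s - bb Φ P ξ z s| ≤ K * ‖y - z‖ := by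
  obtain ⟨L, hL, hlip⟩ := grad_lip hΦ R
  obtain ⟨B, hB, hb⟩ := grad_bound hΦ R
  obtain ⟨KN, hKN, hN⟩ := Ncur_bound P
  refine ⟨L * 2 * (2 * ‖ξ‖) / cN + B * (2 * ‖ξ‖) * (L * 2 * KN) / (cN * cN), by positivity,
    fun y z s hs hy hz hcy hcz => ?_⟩
  have hg : ‖gradient Φ (ev y s) - gradient Φ (ev z s)‖ ≤ L * (2 * ‖y - z‖) := by
    refine (hlip _ _ hy hz).trans ?_
    gcongr
    exact ev_near y z s
  have h1 : |⟪gradient Φ (ev y s), ev ξ s⟫ - ⟪gradient Φ (ev z s), ev ξ s⟫| ≤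
      L * (2 * ‖y - z‖) * (2 * ‖ξ‖) := by
    refine (inner_diff_le _ _ _ _).trans ?_
    rw [sub_self, norm_zero, mul_zero, add_zero]
    gcongr
    exact norm_ev_le ξ s
  have h2 : |Dd Φ P y s - Dd Φ P z s| ≤ L * (2 * ‖y - z‖) * KN := by
    refine (inner_diff_le _ _ _ _).trans ?_
    rw [sub_self, norm_zero, mul_zero, add_zero]
    gcongr
    exact hN s hs
  have h3 : |⟪gradient Φ (ev z s), ev ξ s⟫| ≤ B * (2 * ‖ξ‖) := by
    refine (abs_real_inner_le_norm _ _).trans ?_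
    gcongr
    · exact hb _ hz
    · exact norm_ev_le ξ s
  refine (quot_lip hcN hcy hcz h3 h1 h2).trans (le_of_eq ?_)
  field_simp

end locsec

section locB
variable {n : ℕ} {Φ : Evec n → ℝ} {δ₀ : ℝ}

theorem u_var (hΦ : IsRegularDomain n Φ δ₀) (ξ : HH (Evec n)) (R : ℝ) :
    ∃ K : ℝ, 0 ≤ K ∧ ∀ y : HH (Evec n), (∀ s ∈ Icc (0:ℝ) 1, ‖ev y s‖ ≤ R) →
      ∀ s ∈ Icc (0:ℝ) 1, ∀ t ∈ Icc (0:ℝ) 1,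
      |⟪gradient Φ (ev y t), ev ξ t⟫ - ⟪gradient Φ (ev y s), ev ξ s⟫| ≤
        K * (‖ev y t - ev y s‖ + ‖ev ξ t - ev ξ s‖) := by
  obtain ⟨L, hL, hlip⟩ := grad_lip hΦ R
  obtain ⟨B, hB, hb⟩ := grad_bound hΦ R
  refine ⟨L * (2 * ‖ξ‖) + B, by positivity, fun y hy s hs t ht => ?_⟩
  refine (inner_diff_le _ _ _ _).trans ?_
  have h1 : ‖gradient Φ (ev y t) - gradient Φ (ev y s)‖ * ‖ev ξ t‖ ≤
      L * ‖ev y t - ev y s‖ * (2 * ‖ξ‖) := by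
    gcongr
    · exact hlip _ _ (hy t ht) (hy s hs)
    · exact norm_ev_le ξ t
  have h2 : ‖gradient Φ (ev y s)‖ * ‖ev ξ t - ev ξ s‖ ≤ B * ‖ev ξ t - ev ξ s‖ := by
    gcongr
    exact hb _ (hy s hs)
  have h3 : 0 ≤ L * (2 * ‖ξ‖) * ‖ev ξ t - ev ξ s‖ := by positivity
  have h4 : 0 ≤ B * ‖ev y t - ev y s‖ := by positivity
  nlinarith

theorem MfE_bound {R : ℝ} (hR : ∀ q : Evec n, Φ q ≤ 0 → ‖q‖ ≤ R) {y : HH (Evec n)}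
    (hy : MfE Φ y) : ∀ s ∈ Icc (0:ℝ) 1, ‖ev y s‖ ≤ R := fun s hs => hR _ (hy.1 s hs)

theorem local_B (hΦ : IsRegularDomain n Φ δ₀) {x ξ : HH (Evec n)} (hx : MfE Φ x)
    (hξ : VmE Φ x ξ) {ε : ℝ} (hε : 0 < ε) :
    ∃ r > 0, ∃ (L : ℝ) (w : HH (Evec n) → HH (Evec n)),
      (∀ y, MfE Φ y → ‖y - x‖ < r → WmE Φ y (w y) ∧ ‖w y - ξ‖ ≤ ε) ∧
      ∀ y z, MfE Φ y → MfE Φ z → ‖y - x‖ < r → ‖z - x‖ < r → ‖w y - w z‖ ≤ L * ‖y - z‖ := by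
  obtain ⟨P, ε0, cN, hε0, hcN, hN⟩ := exists_N hΦ (ev_continuous x)
  obtain ⟨R, hR0, hR⟩ := sub_bound hΦ
  obtain ⟨K, hK, hu⟩ := u_var hΦ ξ R
  obtain ⟨K', hK', hD⟩ := Dd_var hΦ P R
  obtain ⟨Kb, hKb, hbb⟩ := bb_est hΦ P ξ R hcN
  obtain ⟨KP, hKP, hprod⟩ := prodN_norm P
  obtain ⟨M, hM⟩ : ∃ M : ℝ, M = (K + K' + 1) / cN := ⟨_, rfl⟩
  have hM0 : 0 < M := by rw [hM]; positivity
  have hcM : cN * M = K + K' + 1 := by rw [hM]; field_simp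
  obtain ⟨ε1, hε1⟩ : ∃ e : ℝ, e = min 1 (ε / (KP + 1)) / 8 := ⟨_, rfl⟩
  have hε1p : 0 < ε1 := by rw [hε1]; positivity
  have hε1a : 8 * ε1 ≤ 1 := by
    rw [hε1]; linarith [min_le_left (1:ℝ) (ε / (KP + 1))]
  have hε1b : (KP + 1) * (8 * ε1) ≤ ε := by
    have : 8 * ε1 ≤ ε / (KP + 1) := by rw [hε1]; linarith [min_le_right (1:ℝ) (ε / (KP + 1))]
    rw [le_div_iff₀ (by positivity)] at this
    linarith
  let hh : HH (Evec n) → L2 ℝ := fun y => M • qq y ξ + oneL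
  obtain ⟨τ, hτ0, hτ, hτs⟩ := kmul_small (hh x) hε1p
  obtain ⟨r1, hr1, hmid⟩ := mid_compact hΦ hξ hτ0 (by positivity : 0 < cN * (M * τ / 2))
  obtain ⟨r, hr⟩ : ∃ r : ℝ, r = min (min (ε0 / 2) (r1 / 2))
    (min (ε1 / M) (min (ε1 / (Kb + 1)) (M * τ / 2 / (Kb + 1)))) := ⟨_, rfl⟩
  have hrp : 0 < r := by rw [hr]; positivity
  have hra : r ≤ ε0 / 2 := by rw [hr]; exact (min_le_left _ _).trans (min_le_left _ _)
  have hrb : r ≤ r1 / 2 := by rw [hr]; exact (min_le_left _ _).trans (min_le_right _ _)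
  have hrc : M * r ≤ ε1 := by
    have : r ≤ ε1 / M := by rw [hr]; exact (min_le_right _ _).trans (min_le_left _ _)
    rw [le_div_iff₀ hM0] at this
    linarith
  have hrd : Kb * r ≤ ε1 := by
    have : r ≤ ε1 / (Kb + 1) := by
      rw [hr]; exact (min_le_right _ _).trans ((min_le_right _ _).trans (min_le_left _ _))
    rw [le_div_iff₀ (by positivity)] at this
    linarith
  have hre : Kb * r ≤ M * τ / 2 := by
    have : r ≤ M * τ / 2 / (Kb + 1) := by
      rw [hr]; exact (min_le_right _ _).trans ((min_le_right _ _).trans (min_le_right _ _))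
    rw [le_div_iff₀ (by positivity)] at this
    linarith
  let rho : HH (Evec n) → HH ℝ := fun y => ramp τ (bb Φ P ξ y 0) (bb Φ P ξ y 1) (hh y)
  -- lower bound on the pairing
  have hDc : ∀ y, MfE Φ y → ‖y - x‖ < r → ∀ s ∈ Icc (0:ℝ) 1, Φ (ev y s) = 0 →
      cN ≤ Dd Φ P y s := by
    intro y hy hyr s hs h0
    exact hN s hs _ ((ev_near y x s).trans (by linarith)) h0
  have hxr : ‖x - x‖ < r := by simpa using hrp
  have hbx0 : bb Φ P ξ x 0 = 0 := by unfold bb; rw [hξ.1, zero_div]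
  have hbx1 : bb Φ P ξ x 1 = 0 := by unfold bb; rw [hξ.2.1, zero_div]
  have hbl0 : ∀ y z, MfE Φ y → MfE Φ z → ‖y - x‖ < r → ‖z - x‖ < r →
      |bb Φ P ξ y 0 - bb Φ P ξ z 0| ≤ Kb * ‖y - z‖ := fun y z hy hz hyr hzr =>
    hbb y z 0 zero_mem01 (MfE_bound hR hy 0 zero_mem01) (MfE_bound hR hz 0 zero_mem01)
      (hDc y hy hyr 0 zero_mem01 hy.2.1) (hDc z hz hzr 0 zero_mem01 hz.2.1)
  have hbl1 : ∀ y z, MfE Φ y → MfE Φ z → ‖y - x‖ < r → ‖z - x‖ < r →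
      |bb Φ P ξ y 1 - bb Φ P ξ z 1| ≤ Kb * ‖y - z‖ := fun y z hy hz hyr hzr =>
    hbb y z 1 one_mem01 (MfE_bound hR hy 1 one_mem01) (MfE_bound hR hz 1 one_mem01)
      (hDc y hy hyr 1 one_mem01 hy.2.2) (hDc z hz hzr 1 one_mem01 hz.2.2)
  have hb0 : ∀ y, MfE Φ y → ‖y - x‖ < r → |bb Φ P ξ y 0| ≤ Kb * r := by
    intro y hy hyr
    have := hbl0 y x hy hx hyr hxr
    rw [hbx0, sub_zero] at this
    exact this.trans (by gcongr)
  have hb1 : ∀ y, MfE Φ y → ‖y - x‖ < r → |bb Φ P ξ y 1| ≤ Kb * r := by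
    intro y hy hyr
    have := hbl1 y x hy hx hyr hxr
    rw [hbx1, sub_zero] at this
    exact this.trans (by gcongr)
  have hhl : ∀ y z, ‖hh y - hh z‖ ≤ M * ‖y - z‖ := by
    intro y z
    have e : hh y - hh z = M • (qq y ξ - qq z ξ) := by simp only [hh, smul_sub]; abel
    rw [e, norm_smul, Real.norm_of_nonneg hM0.le]
    gcongr
    exact qq_sub y z ξ
  have hkm : ∀ y, ‖y - x‖ < r → ‖kmul τ (hh y)‖ ≤ 2 * ε1 := by
    intro y hyr
    have e : hh y = hh x + (hh y - hh x) := by abel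
    rw [e, kmul_add]
    refine (norm_add_le _ _).trans ?_
    have h1 := kmul_norm τ (hh y - hh x)
    have h2 := hhl y x
    have h3 : M * ‖y - x‖ ≤ M * r := by gcongr
    linarith
  have hQint : ∀ y, Integrable (fun s => M * qq y ξ s) muI := fun y =>
    (L2_integrable (qq y ξ)).const_mul M
  have hQh : ∀ y, ∀ᵐ s ∂muI, M * qq y ξ s + 1 ≤ hh y s := by
    intro y
    filter_upwards [Lp.coeFn_add (M • qq y ξ) oneL, Lp.coeFn_smul M (qq y ξ), oneL_coe]
      with s h1 h2 h3
    have : hh y s = (M • qq y ξ + oneL : L2 ℝ) s := rfl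
    rw [this, h1, Pi.add_apply, h2, h3]
    exact le_rfl
  refine ⟨r, hrp, KP * (2 * Kb + 2 * M), fun y => ξ - prodN P (rho y), fun y hy hyr => ?_,
    fun y z hy hz hyr hzr => ?_⟩
  · have hyR := MfE_bound hR hy
    have hb0' := hb0 y hy hyr
    have hb1' := hb1 y hy hyr
    have hkm' := hkm y hyr
    have hrc' : |rampc τ (bb Φ P ξ y 0) (bb Φ P ξ y 1) (hh y)| ≤ 1 := by
      refine (rampc_abs _ _ _ _).trans ?_
      linarith
    have hD0 := hDc y hy hyr 0 zero_mem01 hy.2.1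
    have hD1 := hDc y hy hyr 1 one_mem01 hy.2.2
    have e0 : bb Φ P ξ y 0 * Dd Φ P y 0 = ⟪gradient Φ (ev y 0), ev ξ 0⟫ :=
      div_mul_cancel₀ _ (by linarith)
    have e1 : bb Φ P ξ y 1 * Dd Φ P y 1 = ⟪gradient Φ (ev y 1), ev ξ 1⟫ :=
      div_mul_cancel₀ _ (by linarith)
    have hmulint : ∀ a b : ℝ, ∫ r in a..b, M * qq y ξ r = M * ∫ r in a..b, qq y ξ r :=
      fun a b => intervalIntegral.integral_const_mul _ _
    refine ⟨⟨?_, ?_, ?_⟩, ?_⟩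
    · rw [inner_sub_prodN P y ξ _ zero_mem01, ramp_ev_zero, e0, sub_self]
    · rw [inner_sub_prodN P y ξ _ one_mem01, ramp_ev_one, e1, sub_self]
    · intro s hs hs0
      have hs' : s ∈ Icc (0:ℝ) 1 := ⟨hs.1.le, hs.2.le⟩
      have hDs := hDc y hy hyr s hs' hs0
      rw [inner_sub_prodN P y ξ _ hs']
      rcases le_total s τ with hsτ | hsτ
      · have hl := ramp_left hτ (hQint y) (hQh y) hrc' hs.1.le hsτ
        have hq := qq_int y ξ le_rfl hs.1.le hs.2.le
        set I := ∫ r in (0:ℝ)..s, qq y ξ r with hI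
        rw [hmulint, ← hI] at hl
        have hn1 := norm_nonneg (ev y s - ev y 0)
        have hn2 := norm_nonneg (ev ξ s - ev ξ 0)
        have hIp : 0 < I := by linarith [hs.1]
        have a1 := (abs_le.1 (hu y hyR 0 zero_mem01 s hs')).2
        have a2 := hD y hyR 0 zero_mem01 s hs'
        rw [sub_zero, abs_of_pos hs.1] at a2
        have a1' : ⟪gradient Φ (ev y s), ev ξ s⟫ - ⟪gradient Φ (ev y 0), ev ξ 0⟫ ≤ K * I :=
          a1.trans (mul_le_mul_of_nonneg_left (by linarith [hs.1]) hK)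
        have a2' : |Dd Φ P y s - Dd Φ P y 0| ≤ K' * I :=
          a2.trans (mul_le_mul_of_nonneg_left (by linarith [hs.1]) hK')
        have := barrier a1' a2' e0 hl (by positivity) hDs hcN.le
        refine this.trans_lt ?_
        have hb : |bb Φ P ξ y 0| * (K' * I) ≤ 1 * (K' * I) := by
          gcongr; linarith
        have : cN * (M * I) = (K + K' + 1) * I := by rw [← hcM]; ring
        linarith
      · rcases le_total (1 - τ) s with hsr | hsr
        · have hl := ramp_right hτ (hQint y) (hQh y) hrc' hs.2.le hsr
          have hq := qq_int y ξ hs.1.le hs.2.le le_rfl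
          set I := ∫ r in s..(1:ℝ), qq y ξ r with hI
          rw [hmulint, ← hI] at hl
          have hn1 := norm_nonneg (ev y 1 - ev y s)
          have hn2 := norm_nonneg (ev ξ 1 - ev ξ s)
          have hIp : 0 < I := by linarith [hs.2]
          have a1 := (abs_le.1 (hu y hyR s hs' 1 one_mem01)).1
          have a2 := hD y hyR s hs' 1 one_mem01
          rw [abs_of_pos (by linarith [hs.2] : 0 < 1 - s), abs_sub_comm] at a2
          have a1' : ⟪gradient Φ (ev y s), ev ξ s⟫ - ⟪gradient Φ (ev y 1), ev ξ 1⟫ ≤ K * I := by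
            have : K * (‖ev y 1 - ev y s‖ + ‖ev ξ 1 - ev ξ s‖) ≤ K * I :=
              mul_le_mul_of_nonneg_left (by linarith [hs.2]) hK
            linarith
          have a2' : |Dd Φ P y s - Dd Φ P y 1| ≤ K' * I :=
            a2.trans (mul_le_mul_of_nonneg_left (by linarith [hs.2]) hK')
          have := barrier a1' a2' e1 hl (by positivity) hDs hcN.le
          refine this.trans_lt ?_
          have hb : |bb Φ P ξ y 1| * (K' * I) ≤ 1 * (K' * I) := by
            gcongr; linarith
          have : cN * (M * I) = (K + K' + 1) * I := by rw [← hcM]; ring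
          linarith
        · have hlow := ramp_mid (l0 := bb Φ P ξ y 0) (l1 := bb Φ P ξ y 1) (h := hh y) hτ0 hsτ hsr
          have hl := ramp_left hτ (hQint y) (hQh y) hrc' hτ0.le le_rfl
          have hl' := ramp_right hτ (hQint y) (hQh y) hrc' (by linarith : 1 - τ ≤ 1) le_rfl
          have hq := qq_int y ξ le_rfl hτ0.le (by linarith : τ ≤ 1)
          have hq' := qq_int y ξ (by linarith : 0 ≤ 1 - τ) (by linarith : 1 - τ ≤ 1) le_rfl
          rw [hmulint] at hl hl'
          have hn1 := norm_nonneg (ev y τ - ev y 0)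
          have hn2 := norm_nonneg (ev ξ τ - ev ξ 0)
          have hn3 := norm_nonneg (ev y 1 - ev y (1 - τ))
          have hn4 := norm_nonneg (ev ξ 1 - ev ξ (1 - τ))
          have m1 : M * τ ≤ M * ∫ r in (0:ℝ)..τ, qq y ξ r :=
            mul_le_mul_of_nonneg_left (by linarith) hM0.le
          have m2 : M * τ ≤ M * ∫ r in (1 - τ)..1, qq y ξ r :=
            mul_le_mul_of_nonneg_left (by linarith) hM0.le
          have p0 := (abs_le.1 hb0').1
          have p1 := (abs_le.1 hb1').1
          have hlam : M * τ / 2 ≤ ev (rho y) s := by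
            refine le_trans (le_min ?_ ?_) hlow <;> linarith
          have hm := hmid s ⟨hsτ, hsr⟩ (ev y s) ((ev_near y x s).trans (by linarith)) hs0
          have : M * τ / 2 * cN ≤ ev (rho y) s * Dd Φ P y s :=
            mul_le_mul hlam hDs hcN.le (le_trans (by positivity) hlam)
          show ⟪gradient Φ (ev y s), ev ξ s⟫ - ev (rho y) s * Dd Φ P y s < 0
          linarith
    · have e : ξ - prodN P (rho y) - ξ = -prodN P (rho y) := by abel
      rw [e, norm_neg]
      have h1 : ‖rho y‖ ≤ 8 * ε1 := by
        refine (ramp_norm _ _ _ _).trans ?_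
        linarith
      calc _ ≤ KP * ‖rho y‖ := hprod _
        _ ≤ KP * (8 * ε1) := by gcongr
        _ ≤ ε := by linarith
  · have e : ξ - prodN P (rho y) - (ξ - prodN P (rho z)) = -(prodN P (rho y - rho z)) := by
      rw [prodN_sub]; abel
    rw [e, norm_neg]
    refine (hprod _).trans ?_
    rw [mul_assoc]
    gcongr
    have e2 : rho y - rho z = ramp τ (bb Φ P ξ y 0 - bb Φ P ξ z 0) (bb Φ P ξ y 1 - bb Φ P ξ z 1)
      (hh y - hh z) := (ramp_sub _ _ _ _ _ _ _).symm
    rw [e2]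
    refine (ramp_norm _ _ _ _).trans ?_
    have h1 := hbl0 y z hy hz hyr hzr
    have h2 := hbl1 y z hy hz hyr hzr
    have h3 := (kmul_norm τ (hh y - hh z)).trans (hhl y z)
    linarith

end locB

section compA
variable {n : ℕ} {Φ : Evec n → ℝ} {δ₀ : ℝ}

theorem pair_lemma (hΦ : IsRegularDomain n Φ δ₀) {c : ℝ → Evec n} (P : Fin n → Polynomial ℝ)
    {ε0 cN : ℝ} (hcN : 0 < cN)
    (hN : ∀ s ∈ Icc (0:ℝ) 1, ∀ q, ‖q - c s‖ ≤ ε0 → Φ q = 0 → cN ≤ ⟪gradient Φ q, Ncur P s⟫)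
    (B : ℝ) (hB : 0 ≤ B) : ∃ Q : ℝ, 0 ≤ Q ∧ ∀ (x y : HH (Evec n)) (σ : ℝ), MfE Φ x → MfE Φ y →
      ‖x‖ ≤ B → ‖y‖ ≤ B → (∀ s ∈ Icc (0:ℝ) 1, ‖ev x s - c s‖ ≤ ε0) → σ ≤ 1 →
      (∀ s, ‖ev y s - ev x s‖ ≤ σ) → ∃ η, VmE Φ x η ∧ ‖η - (y - x)‖ ≤ Q * σ := by
  obtain ⟨R, hR0, hR⟩ := sub_bound hΦ
  obtain ⟨K, hK, hrem⟩ := Rem_lip hΦ R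
  obtain ⟨K', hK', hD⟩ := Dd_var hΦ P R
  obtain ⟨KP, hKP, hprod⟩ := prodN_norm P
  obtain ⟨M, hM⟩ : ∃ M : ℝ, M = (K + K / cN * K') / cN := ⟨_, rfl⟩
  have hM0 : 0 ≤ M := by rw [hM]; positivity
  have hcM : cN * M = K + K / cN * K' := by rw [hM]; field_simp
  refine ⟨KP * (6 * (K / cN) + 4 * (M * (2 * B + 1))), by positivity, fun x y σ hx hy hxB hyB hxc hσ1 hσ => ?_⟩
  have hσ0 : 0 ≤ σ := (norm_nonneg _).trans (hσ 0)
  have hDc : ∀ s ∈ Icc (0:ℝ) 1, Φ (ev x s) = 0 → cN ≤ Dd Φ P x s := fun s hs h0 =>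
    hN s hs _ (hxc s hs) h0
  have hxR := MfE_bound hR hx
  have hyR := MfE_bound hR hy
  let u : ℝ → ℝ := fun s => - Rem Φ (ev x s) (ev y s)
  have hu0 : ∀ s ∈ Icc (0:ℝ) 1, |u s| ≤ K * σ := by
    intro s hs
    have := hrem (ev x s) (ev y s) (ev x s) (ev x s) σ (hxR s hs) (hyR s hs) (hxR s hs) (hxR s hs)
      (hσ s) (by simpa using hσ0)
    rw [Rem_self, sub_zero, sub_self, norm_zero, zero_add] at this
    simp only [u, abs_neg]
    refine this.trans ?_
    calc K * σ * ‖ev y s - ev x s‖ ≤ K * σ * 1 := by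
          gcongr; exact (hσ s).trans hσ1
      _ = _ := mul_one _
  have huv : ∀ s ∈ Icc (0:ℝ) 1, ∀ t ∈ Icc (0:ℝ) 1,
      |u t - u s| ≤ K * σ * (‖ev x t - ev x s‖ + ‖ev y t - ev y s‖) := by
    intro s hs t ht
    have := hrem (ev x t) (ev y t) (ev x s) (ev y s) σ (hxR t ht) (hyR t ht) (hxR s hs) (hyR s hs)
      (hσ t) (hσ s)
    simp only [u]
    rw [← abs_neg]
    refine le_trans (le_of_eq ?_) this
    congr 1; ring
  have hpair : ∀ s, ⟪gradient Φ (ev x s), ev (y - x) s⟫ = Φ (ev y s) - Φ (ev x s) + u s := by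
    intro s
    simp only [u, Rem, ev_sub]; ring
  obtain ⟨l, hl⟩ : ∃ l : ℝ → ℝ, ∀ s, l s = u s / Dd Φ P x s := ⟨_, fun s => rfl⟩
  have hlD : ∀ s ∈ Icc (0:ℝ) 1, Φ (ev x s) = 0 → l s * Dd Φ P x s = u s := by
    intro s hs h0
    rw [hl]
    exact div_mul_cancel₀ _ (by linarith [hDc s hs h0])
  have hlb : ∀ s ∈ Icc (0:ℝ) 1, Φ (ev x s) = 0 → |l s| ≤ K / cN * σ := by
    intro s hs h0
    have hd := hDc s hs h0
    rw [hl, abs_div, abs_of_pos (by linarith : 0 < Dd Φ P x s), div_le_iff₀ (by linarith)]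
    refine (hu0 s hs).trans ?_
    have : K / cN * σ * cN = K * σ := by field_simp
    rw [← this]
    gcongr
  have hl0 := hlb 0 zero_mem01 hx.2.1
  have hl1 := hlb 1 one_mem01 hx.2.2
  obtain ⟨γ, hγ⟩ : ∃ γ : ℝ, γ = |l 0| + |l 1| + ‖(M * σ) • qq x y‖ := ⟨_, rfl⟩
  have hγ0 : 0 ≤ γ := by rw [hγ]; positivity
  let h : L2 ℝ := (M * σ) • qq x y + γ • oneL
  have hMσ : 0 ≤ M * σ := by positivity
  have hrc : |rampc (1/2) (l 0) (l 1) h| ≤ γ := by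
    have e : rampc (1/2) (l 0) (l 1) h = rampc (1/2) (l 0) (l 1) ((M * σ) • qq x y) := by
      simp only [rampc, h]
      rw [kmul_add, kmul_smul _ γ]
      have : ∫ s, (kmul (1/2) ((M * σ) • qq x y) + γ • kmul (1/2) oneL : L2 ℝ) s ∂muI =
          ∫ s, (kmul (1/2) ((M * σ) • qq x y) s + γ * kmul (1/2) oneL s) ∂muI := by
        apply integral_congr_ae
        filter_upwards [Lp.coeFn_add (kmul (1/2) ((M * σ) • qq x y)) (γ • kmul (1/2) oneL),
          Lp.coeFn_smul γ (kmul (1/2) oneL)] with s h1 h2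
        rw [h1, Pi.add_apply, h2]; rfl
      rw [this, integral_add (L2_integrable _) ((L2_integrable _).const_mul _),
        integral_const_mul, kmul_one (by norm_num) (by norm_num)]
      ring
    rw [e, hγ]
    refine (rampc_abs _ _ _ _).trans ?_
    have := kmul_norm (1/2) ((M * σ) • qq x y)
    linarith
  have hQint : Integrable (fun s => (M * σ) * qq x y s) muI := (L2_integrable (qq x y)).const_mul _
  have hQh : ∀ᵐ s ∂muI, (M * σ) * qq x y s + γ ≤ h s := by
    filter_upwards [Lp.coeFn_add ((M * σ) • qq x y) (γ • oneL), Lp.coeFn_smul (M * σ) (qq x y),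
      Lp.coeFn_smul γ oneL, oneL_coe] with s h1 h2 h3 h4
    have : h s = ((M * σ) • qq x y + γ • oneL : L2 ℝ) s := rfl
    rw [this, h1, Pi.add_apply, h2, h3, Pi.smul_apply, Pi.smul_apply, h4, smul_eq_mul, smul_eq_mul,
      mul_one]
  have hmulint : ∀ a b : ℝ, ∫ r in a..b, (M * σ) * qq x y r = (M * σ) * ∫ r in a..b, qq x y r :=
    fun a b => intervalIntegral.integral_const_mul _ _
  refine ⟨(y - x) - prodN P (ramp (1/2) (l 0) (l 1) h), ⟨?_, ?_, ?_⟩, ?_⟩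
  · rw [inner_sub_prodN P x _ _ zero_mem01, ramp_ev_zero, hlD 0 zero_mem01 hx.2.1, hpair,
      hx.2.1, hy.2.1]; ring
  · rw [inner_sub_prodN P x _ _ one_mem01, ramp_ev_one, hlD 1 one_mem01 hx.2.2, hpair,
      hx.2.2, hy.2.2]; ring
  · intro s hs hs0
    have hs' : s ∈ Icc (0:ℝ) 1 := ⟨hs.1.le, hs.2.le⟩
    have hDs := hDc s hs' hs0
    rw [inner_sub_prodN P x _ _ hs', hpair, hs0]
    have hys := hy.1 s hs'
    rcases le_total s (1/2) with hsτ | hsτ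
    · have hl := ramp_left le_rfl hQint hQh hrc hs.1.le hsτ
      have hq := qq_int x y le_rfl hs.1.le hs.2.le
      set I := ∫ r in (0:ℝ)..s, qq x y r with hI
      rw [hmulint, ← hI] at hl
      have hn1 := norm_nonneg (ev x s - ev x 0)
      have hn2 := norm_nonneg (ev y s - ev y 0)
      have hIp : 0 ≤ I := by linarith [hs.1]
      have a1 := (abs_le.1 (huv 0 zero_mem01 s hs')).2
      have a2 := hD x hxR 0 zero_mem01 s hs'
      rw [sub_zero, abs_of_pos hs.1] at a2
      have a1' : u s - u 0 ≤ K * σ * I :=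
        a1.trans (mul_le_mul_of_nonneg_left (by linarith [hs.1]) (by positivity))
      have a2' : |Dd Φ P x s - Dd Φ P x 0| ≤ K' * I :=
        a2.trans (mul_le_mul_of_nonneg_left (by linarith [hs.1]) hK')
      have := barrier a1' a2' (hlD 0 zero_mem01 hx.2.1) hl (by positivity) hDs hcN.le
      have hb : |l 0| * (K' * I) ≤ (K / cN * σ) * (K' * I) := by gcongr
      have : cN * (M * σ * I) = (K + K / cN * K') * σ * I := by rw [← hcM]; ring
      nlinarith
    · have hl := ramp_right le_rfl hQint hQh hrc hs.2.le (by linarith)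
      have hq := qq_int x y hs.1.le hs.2.le le_rfl
      set I := ∫ r in s..(1:ℝ), qq x y r with hI
      rw [hmulint, ← hI] at hl
      have hn1 := norm_nonneg (ev x 1 - ev x s)
      have hn2 := norm_nonneg (ev y 1 - ev y s)
      have hIp : 0 ≤ I := by linarith [hs.2]
      have a1 := (abs_le.1 (huv s hs' 1 one_mem01)).1
      have a2 := hD x hxR s hs' 1 one_mem01
      rw [abs_of_pos (by linarith [hs.2] : 0 < 1 - s), abs_sub_comm] at a2
      have a1' : u s - u 1 ≤ K * σ * I := by
        have : K * σ * (‖ev x 1 - ev x s‖ + ‖ev y 1 - ev y s‖) ≤ K * σ * I :=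
          mul_le_mul_of_nonneg_left (by linarith [hs.2]) (by positivity)
        linarith
      have a2' : |Dd Φ P x s - Dd Φ P x 1| ≤ K' * I :=
        a2.trans (mul_le_mul_of_nonneg_left (by linarith [hs.2]) hK')
      have := barrier a1' a2' (hlD 1 one_mem01 hx.2.2) hl (by positivity) hDs hcN.le
      have hb : |l 1| * (K' * I) ≤ (K / cN * σ) * (K' * I) := by gcongr
      have : cN * (M * σ * I) = (K + K / cN * K') * σ * I := by rw [← hcM]; ring
      nlinarith
  · have e : y - x - prodN P (ramp (1/2) (l 0) (l 1) h) - (y - x) =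
      -prodN P (ramp (1/2) (l 0) (l 1) h) := by abel
    rw [e, norm_neg, mul_assoc]
    refine (hprod _).trans ?_
    gcongr
    refine (ramp_norm _ _ _ _).trans ?_
    have h1 : ‖(M * σ) • qq x y‖ ≤ (M * σ) * (2 * B + 1) := by
      rw [norm_smul, Real.norm_of_nonneg hMσ]
      gcongr
      linarith [qq_norm x y]
    have h2 : ‖h‖ ≤ ‖(M * σ) • qq x y‖ + γ := by
      refine (norm_add_le _ _).trans ?_
      rw [norm_smul γ, oneL_norm, Real.norm_of_nonneg hγ0, mul_one]
    have h3 := kmul_norm (1/2) h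
    nlinarith

end compA

section compA2
variable {n : ℕ} {Φ : Evec n → ℝ} {δ₀ : ℝ} {G : Evec n → Evec n → ℝ} {ℓ α : ℝ}

theorem unif_subseq (x : ℕ → HH (Evec n)) {B : ℝ} (hB : ∀ k, ‖x k‖ ≤ B) :
    ∃ φ : ℕ → ℕ, StrictMono φ ∧ ∃ c : ℝ → Evec n, Continuous c ∧
      ∀ σ > 0, ∃ N : ℕ, ∀ k ≥ N, ∀ s ∈ Icc (0:ℝ) 1, ‖ev (x (φ k)) s - c s‖ ≤ σ := by
  have hB0 : 0 ≤ B := (norm_nonneg _).trans (hB 0)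
  let f : ℕ → BoundedContinuousFunction (Icc (0:ℝ) 1) (Evec n) := fun k =>
    BoundedContinuousFunction.mkOfCompact
      ⟨fun s => ev (x k) s, (ev_continuous (x k)).comp continuous_subtype_val⟩
  have hfa : ∀ k (s : Icc (0:ℝ) 1), f k s = ev (x k) s := fun k s => rfl
  have hcomp : IsCompact (closure (range f)) := by
    refine BoundedContinuousFunction.arzela_ascoli (Metric.closedBall (0 : Evec n) (2 * B))
      (isCompact_closedBall _ _) (range f) ?_ ?_
    · rintro _ s ⟨k, rfl⟩
      rw [mem_closedBall_zero_iff, hfa]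
      exact (norm_ev_le _ _).trans (by linarith [hB k])
    · apply UniformEquicontinuous.equicontinuous
      refine Metric.uniformEquicontinuous_of_continuity_modulus (fun t => Real.sqrt t * B) ?_ _ ?_
      · have : Continuous (fun t : ℝ => Real.sqrt t * B) := by fun_prop
        simpa using this.tendsto 0
      · rintro s t ⟨_, k, rfl⟩
        show dist (f k s) (f k t) ≤ _
        have key : ∀ s t : Icc (0:ℝ) 1, s ≤ t → dist (f k s) (f k t) ≤ √(dist s t) * B := by
          intro s t hst
          rw [dist_comm, dist_eq_norm, hfa, hfa]
          refine (norm_ev_sub_sq_le (x k) s.2 t.2 hst).trans ?_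
          have e : dist s t = (t : ℝ) - s := by
            rw [Subtype.dist_eq, dist_comm, Real.dist_eq,
              abs_of_nonneg (sub_nonneg.2 (by exact_mod_cast hst))]
          rw [e]
          gcongr
          exact (norm_snd_le _).trans (hB k)
        rcases le_total s t with h | h
        · exact key s t h
        · rw [dist_comm, dist_comm s t]; exact key t s h
  obtain ⟨c0, -, φ, hφ, hlim⟩ := hcomp.tendsto_subseq (fun k => subset_closure (mem_range_self k) :
    ∀ k, f k ∈ closure (range f))
  refine ⟨φ, hφ, fun s => c0 (projIcc 0 1 zero_le_one s), c0.continuous.comp continuous_projIcc,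
    fun σ hσ => ?_⟩
  obtain ⟨N, hN⟩ := Metric.tendsto_atTop.1 hlim σ hσ
  refine ⟨N, fun k hk s hs => ?_⟩
  have h1 := (BoundedContinuousFunction.dist_coe_le_dist (f := f (φ k)) (g := c0) ⟨s, hs⟩).trans
    (hN k hk).le
  rw [dist_eq_norm, hfa] at h1
  beta_reduce
  rw [projIcc_of_mem zero_le_one hs]
  exact h1

theorem compact_A (hG : IsFinslerEnergy n G ℓ α) (hΦ : IsRegularDomain n Φ δ₀)
    (x : ℕ → HH (Evec n)) (hx : ∀ k, MfE Φ (x k)) {B : ℝ} (hB : ∀ k, ‖x k‖ ≤ B)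
    (hc : ∀ k : ℕ, ∀ η, VmE Φ (x k) η → -(1 / ((k:ℝ) + 1)) * ‖η‖ ≤ dJE G (x k) η) :
    ∃ φ : ℕ → ℕ, StrictMono φ ∧ ∃ a, Tendsto (fun k => x (φ k)) atTop (nhds a) := by
  have hB0 : 0 ≤ B := (norm_nonneg _).trans (hB 0)
  obtain ⟨φ, hφ, c, hcc, hunif⟩ := unif_subseq x hB
  refine ⟨φ, hφ, ?_⟩
  obtain ⟨P, ε0, cN, hε0, hcN, hN⟩ := exists_N hΦ hcc
  obtain ⟨Q, hQ, hpair⟩ := pair_lemma hΦ P hcN hN B hB0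
  obtain ⟨K1, hK1, hbd⟩ := dJE_bound hG B
  obtain ⟨K, hK, hmono⟩ := dJE_mono hG B
  have hα := hG.alpha_pos
  -- one-sided test inequality
  have test : ∀ j k : ℕ, ∀ σ : ℝ, σ ≤ 1 → (∀ s, ‖ev (x (φ j)) s - ev (x (φ k)) s‖ ≤ σ) →
      (∀ s ∈ Icc (0:ℝ) 1, ‖ev (x (φ k)) s - c s‖ ≤ ε0) → 1 / ((φ k : ℝ) + 1) ≤ σ →
      -((2 * B + Q + K1 * Q) * σ) ≤ dJE G (x (φ k)) (x (φ j) - x (φ k)) := by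
    intro j k σ hσ1 hσ hkc hkσ
    have hσ0 : 0 ≤ σ := (norm_nonneg _).trans (hσ 0)
    obtain ⟨η, hη, hηn⟩ := hpair (x (φ k)) (x (φ j)) σ (hx _) (hx _) (hB _) (hB _) hkc hσ1 hσ
    have h1 := hc (φ k) η hη
    have h2 : |dJE G (x (φ k)) (η - (x (φ j) - x (φ k)))| ≤ K1 * (Q * σ) :=
      (hbd _ _ ((norm_snd_le _).trans (hB _))).trans (by gcongr)
    rw [dJE_sub hG] at h2
    have h3 := (abs_le.1 h2).2
    have h4 : ‖η‖ ≤ 2 * B + Q := by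
      have e : η = (η - (x (φ j) - x (φ k))) + (x (φ j) - x (φ k)) := by abel
      rw [e]
      refine (norm_add_le _ _).trans ?_
      have := norm_sub_le (x (φ j)) (x (φ k))
      have := hB (φ j)
      have := hB (φ k)
      have : Q * σ ≤ Q * 1 := by gcongr
      linarith
    have h5 : 1 / ((φ k : ℝ) + 1) * ‖η‖ ≤ σ * (2 * B + Q) := by gcongr
    linarith
  apply cauchySeq_tendsto_of_complete
  rw [Metric.cauchySeq_iff]
  intro ε hε
  obtain ⟨K3, hK3⟩ : ∃ K3 : ℝ, K3 = 4 * (2 * B + Q + K1 * Q) + K + 1 := ⟨_, rfl⟩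
  have hK3p : 0 < K3 := by rw [hK3]; positivity
  obtain ⟨σ, hσ⟩ : ∃ σ : ℝ, σ = min 1 (min (ε / 2) (α * (ε / 2) ^ 2 / K3)) := ⟨_, rfl⟩
  have hσ0 : 0 < σ := by rw [hσ]; positivity
  have hσ1 : σ ≤ 1 := by rw [hσ]; exact min_le_left _ _
  have hσ2 : σ ≤ ε / 2 := by rw [hσ]; exact (min_le_right _ _).trans (min_le_left _ _)
  have hσ3 : σ * K3 ≤ α * (ε / 2) ^ 2 := by
    rw [← le_div_iff₀ hK3p, hσ]; exact (min_le_right _ _).trans (min_le_right _ _)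
  obtain ⟨N1, hN1⟩ := hunif (min ε0 (σ / 2)) (by positivity)
  obtain ⟨N2, hN2⟩ := exists_nat_one_div_lt hσ0
  have hN2' : ∀ k ≥ N2, 1 / ((φ k : ℝ) + 1) ≤ σ := by
    intro k hk
    refine le_trans ?_ hN2.le
    have : (N2 : ℝ) ≤ φ k := by exact_mod_cast hk.le.trans (hφ.id_le k)
    gcongr
  refine ⟨max N1 N2, fun j hj k hk => ?_⟩
  have hj1 := hN1 j ((le_max_left _ _).trans hj)
  have hk1 := hN1 k ((le_max_left _ _).trans hk)
  have hj2 := hN2' j ((le_max_right _ _).trans hj)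
  have hk2 := hN2' k ((le_max_right _ _).trans hk)
  have near : ∀ s, ‖ev (x (φ j)) s - ev (x (φ k)) s‖ ≤ σ := by
    intro s
    rw [← ev_clamp _ s, ← ev_clamp (x (φ k)) s]
    have a := (hj1 _ (clamp_mem s)).trans (min_le_right _ _)
    have b := (hk1 _ (clamp_mem s)).trans (min_le_right _ _)
    have := norm_sub_le_norm_sub_add_norm_sub (ev (x (φ j)) (clamp s)) (c (clamp s))
      (ev (x (φ k)) (clamp s))
    rw [norm_sub_rev (c (clamp s))] at this
    linarith
  have t1 := test j k σ hσ1 near (fun s hs => (hk1 s hs).trans (min_le_left _ _)) hk2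
  have t2 := test k j σ hσ1 (fun s => by rw [norm_sub_rev]; exact near s)
    (fun s hs => (hj1 s hs).trans (min_le_left _ _)) hj2
  have e : dJE G (x (φ j)) (x (φ k) - x (φ j)) = - dJE G (x (φ j)) (x (φ j) - x (φ k)) := by
    rw [dJE_sub hG, dJE_sub hG]; ring
  rw [e] at t2
  have hm := hmono (x (φ j)) (x (φ k)) σ (hB _) (hB _) near
  have hd2 : ‖(x (φ j)).2 - (x (φ k)).2‖ < ε := by
    have h1 : α * ‖(x (φ j)).2 - (x (φ k)).2‖ ^ 2 ≤ α * (ε / 2) ^ 2 := by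
      refine le_trans ?_ hσ3
      rw [hK3]; nlinarith
    have h2 := le_of_mul_le_mul_left h1 hα
    have h3 := abs_le_of_sq_le_sq h2 (by positivity)
    linarith [le_abs_self ‖(x (φ j)).2 - (x (φ k)).2‖, (abs_le.1 h3).2]
  have hd1 : ‖(x (φ j)).1 - (x (φ k)).1‖ < ε := by
    have := near 0
    rw [ev_zero, ev_zero] at this
    linarith
  rw [dist_eq_norm]
  exact max_lt hd1 hd2

end compA2

section glueS

theorem glue {X E : Type*} [MetricSpace X] [NormedAddCommGroup E] [NormedSpace ℝ E]
    (D : X → Set E) (hconv : ∀ x, Convex ℝ (D x)) (M : ℝ) (hM0 : 0 ≤ M)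
    (hM : ∀ x, ∀ v ∈ D x, ‖v‖ ≤ M)
    (hloc : ∀ x, ∃ r > 0, ∃ L : ℝ, 0 ≤ L ∧ ∃ w : X → E, (∀ y, dist y x < r → w y ∈ D y) ∧
      ∀ y z, dist y x < r → dist z x < r → ‖w y - w z‖ ≤ L * dist y z) :
    ∃ W : X → E, (∀ x, W x ∈ D x) ∧ ∀ x, ∃ r > 0, ∃ L : ℝ,
      ∀ y z, dist y x < r → dist z x < r → ‖W y - W z‖ ≤ L * dist y z := by
  classical
  choose r hr L hL w hw hwl using hloc
  obtain ⟨v, hvo, hvc, hvf, hvs⟩ := precise_refinement (fun x => Metric.ball x (r x))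
    (fun x => Metric.isOpen_ball) (iUnion_eq_univ_iff.2 fun x => ⟨x, Metric.mem_ball_self (hr x)⟩)
  let ρ : X → X → ℝ := fun i x => if v i = univ then 1 else Metric.infDist x (v i)ᶜ
  have hρ0 : ∀ i x, 0 ≤ ρ i x := by
    intro i x
    simp only [ρ]
    split_ifs
    · exact zero_le_one
    · exact Metric.infDist_nonneg
  have hρv : ∀ i x, x ∉ v i → ρ i x = 0 := by
    intro i x hx
    have : v i ≠ univ := fun h => hx (h ▸ mem_univ x)
    simp only [ρ, if_neg this]
    exact Metric.infDist_zero_of_mem hx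
  have hρp : ∀ i x, x ∈ v i → 0 < ρ i x := by
    intro i x hx
    simp only [ρ]
    split_ifs with h
    · exact one_pos
    · have hne : (v i)ᶜ.Nonempty := nonempty_compl.2 h
      exact ((hvo i).isClosed_compl.notMem_iff_infDist_pos hne).1 (by simpa using hx)
  have hρl : ∀ i y z, |ρ i y - ρ i z| ≤ dist y z := by
    intro i y z
    simp only [ρ]
    split_ifs
    · simp
    · rw [abs_le]
      constructor
      · have := Metric.infDist_le_infDist_add_dist (s := (v i)ᶜ) (x := z) (y := y)
        rw [dist_comm] at this
        linarith
      · have := Metric.infDist_le_infDist_add_dist (s := (v i)ᶜ) (x := y) (y := z)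
        linarith
  have hwD : ∀ i y, y ∈ v i → w i y ∈ D y := fun i y hy => hw i y (hvs i hy)
  let S : X → ℝ := fun x => ∑ᶠ i, ρ i x
  let W : X → E := fun x => ∑ᶠ i, (ρ i x / S x) • w i x
  have hloc : ∀ x, ∃ t > 0, ∃ F : Finset X, ∀ y, dist y x < t → ∀ i, i ∉ F → ρ i y = 0 := by
    intro x
    obtain ⟨t, ht, hfin⟩ := hvf x
    obtain ⟨δ, hδ, hb⟩ := Metric.mem_nhds_iff.1 ht
    refine ⟨δ, hδ, hfin.toFinset, fun y hy i hi => ?_⟩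
    apply hρv
    intro hyv
    apply hi
    rw [Finite.mem_toFinset]
    exact ⟨y, hyv, hb hy⟩
  have hSF : ∀ (F : Finset X) y, (∀ i, i ∉ F → ρ i y = 0) → S y = ∑ i ∈ F, ρ i y := by
    intro F y h
    apply finsum_eq_sum_of_support_subset
    intro i hi
    by_contra hiF
    exact hi (h i hiF)
  have hSp : ∀ y, 0 < S y := by
    intro y
    obtain ⟨t, ht, F, hF⟩ := hloc y
    have hF' := hF y (by simpa using ht)
    rw [hSF F y hF']
    obtain ⟨i, hi⟩ := mem_iUnion.1 (hvc ▸ mem_univ y : y ∈ ⋃ i, v i)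
    have hp := hρp i y hi
    apply Finset.sum_pos' (fun i _ => hρ0 i y)
    refine ⟨i, ?_, hp⟩
    by_contra h
    exact hp.ne' (hF' i h)
  have hWF : ∀ (F : Finset X) y, (∀ i, i ∉ F → ρ i y = 0) →
      S y • W y = ∑ i ∈ F, ρ i y • w i y := by
    intro F y h
    have : W y = ∑ i ∈ F, (ρ i y / S y) • w i y := by
      apply finsum_eq_sum_of_support_subset
      intro i hi
      by_contra hiF
      apply hi
      simp only [h i hiF, zero_div, zero_smul]
    rw [this, Finset.smul_sum]
    refine Finset.sum_congr rfl fun i _ => ?_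
    rw [smul_smul, mul_div_cancel₀ _ (hSp y).ne']
  have hWD : ∀ x, W x ∈ D x := by
    intro x
    apply (hconv x).finsum_mem
    · exact fun i => div_nonneg (hρ0 i x) (hSp x).le
    · obtain ⟨t, ht, F, hF⟩ := hloc x
      have hF' := hF x (by simpa using ht)
      have : ∑ᶠ i, ρ i x / S x = ∑ i ∈ F, ρ i x / S x := by
        apply finsum_eq_sum_of_support_subset
        intro i hi
        by_contra hiF
        apply hi
        simp only [hF' i hiF, zero_div]
      rw [this, ← Finset.sum_div, ← hSF F x hF', div_self (hSp x).ne']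
    · intro i hi
      apply hwD
      by_contra h
      exact hi (by rw [hρv i x h, zero_div])
  refine ⟨W, hWD, fun x => ?_⟩
  obtain ⟨t, ht, F, hF⟩ := hloc x
  have hSl : ∀ y, dist y x < t → |S y - S x| ≤ F.card * dist y x := by
    intro y hy
    rw [hSF F y (hF y hy), hSF F x (hF x (by simpa using ht)), ← Finset.sum_sub_distrib]
    refine (Finset.abs_sum_le_sum_abs _ _).trans ?_
    refine (Finset.sum_le_sum fun i _ => hρl i y x).trans ?_
    simp
  obtain ⟨t', ht'⟩ : ∃ t' : ℝ, t' = min (min t 1) (S x / 2 / (F.card + 1)) := ⟨_, rfl⟩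
  have hSx := hSp x
  have ht'0 : 0 < t' := by rw [ht']; positivity
  have ht1 : t' ≤ t := by rw [ht']; exact (min_le_left _ _).trans (min_le_left _ _)
  have ht2 : t' ≤ 1 := by rw [ht']; exact (min_le_left _ _).trans (min_le_right _ _)
  have ht3 : t' * (F.card + 1) ≤ S x / 2 := by
    rw [← le_div_iff₀ (by positivity), ht']; exact min_le_right _ _
  have hSlow : ∀ y, dist y x < t' → S x / 2 ≤ S y := by
    intro y hy
    have h1 := (abs_le.1 (hSl y (hy.trans_le ht1))).1
    have h2 : F.card * dist y x ≤ F.card * t' := by gcongr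
    nlinarith
  refine ⟨t', ht'0, (S x / 2)⁻¹ * ∑ i ∈ F, (2 * M + (ρ i x + 1) * L i), fun y z hy hz => ?_⟩
  have hFy := hF y (hy.trans_le ht1)
  have hFz := hF z (hz.trans_le ht1)
  have e : S y • (W y - W z) = ∑ i ∈ F, (ρ i y • w i y - ρ i z • w i z - (ρ i y - ρ i z) • W z) := by
    rw [Finset.sum_sub_distrib, Finset.sum_sub_distrib, ← hWF F y hFy, ← hWF F z hFz,
      ← Finset.sum_smul, Finset.sum_sub_distrib, ← hSF F y hFy, ← hSF F z hFz]
    rw [smul_sub, sub_smul]; abel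
  have term : ∀ i ∈ F, ‖ρ i y • w i y - ρ i z • w i z - (ρ i y - ρ i z) • W z‖ ≤
      (2 * M + (ρ i x + 1) * L i) * dist y z := by
    intro i _
    have hWz : ‖(ρ i y - ρ i z) • W z‖ ≤ dist y z * M := by
      rw [norm_smul, Real.norm_eq_abs]
      exact mul_le_mul (hρl i y z) (hM z _ (hWD z)) (norm_nonneg _) dist_nonneg
    have hLL : 0 ≤ (ρ i x + 1) * L i * dist y z := by
      have := hρ0 i x
      have := hL i
      positivity
    have main : ‖ρ i y • w i y - ρ i z • w i z‖ ≤ M * dist y z + (ρ i x + 1) * L i * dist y z := by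
      by_cases hyv : y ∈ v i
      · by_cases hzv : z ∈ v i
        · have e1 : ρ i y • w i y - ρ i z • w i z =
            (ρ i y - ρ i z) • w i z + ρ i y • (w i y - w i z) := by
            rw [smul_sub, sub_smul]; abel
          rw [e1]
          refine (norm_add_le _ _).trans ?_
          rw [norm_smul, norm_smul, Real.norm_eq_abs, Real.norm_eq_abs, abs_of_nonneg (hρ0 i y)]
          have a1 : |ρ i y - ρ i z| * ‖w i z‖ ≤ dist y z * M :=
            mul_le_mul (hρl i y z) (hM z _ (hwD i z hzv)) (norm_nonneg _) dist_nonneg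
          have a2 : ρ i y ≤ ρ i x + 1 := by
            have := (abs_le.1 (hρl i y x)).2
            linarith
          have a3 : ρ i y * ‖w i y - w i z‖ ≤ (ρ i x + 1) * (L i * dist y z) :=
            mul_le_mul a2 (hwl i y z (hvs i hyv) (hvs i hzv)) (norm_nonneg _)
              ((hρ0 i y).trans a2)
          linarith
        · have h0 := hρv i z hzv
          have a := hρl i y z
          rw [h0, sub_zero, abs_of_nonneg (hρ0 i y)] at a
          rw [h0, zero_smul, sub_zero, norm_smul, Real.norm_eq_abs, abs_of_nonneg (hρ0 i y)]
          have a1 : ρ i y * ‖w i y‖ ≤ dist y z * M :=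
            mul_le_mul a (hM y _ (hwD i y hyv)) (norm_nonneg _) dist_nonneg
          linarith
      · have h0 := hρv i y hyv
        by_cases hzv : z ∈ v i
        · have a := hρl i y z
          rw [h0, zero_sub, abs_neg, abs_of_nonneg (hρ0 i z)] at a
          rw [h0, zero_smul, zero_sub, norm_neg, norm_smul, Real.norm_eq_abs,
            abs_of_nonneg (hρ0 i z)]
          have a1 : ρ i z * ‖w i z‖ ≤ dist y z * M :=
            mul_le_mul a (hM z _ (hwD i z hzv)) (norm_nonneg _) dist_nonneg
          linarith
        · rw [h0, hρv i z hzv, zero_smul, zero_smul, sub_zero, norm_zero]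
          have := mul_nonneg hM0 (dist_nonneg (x := y) (y := z))
          linarith
    refine (norm_sub_le _ _).trans ?_
    linarith
  have h1 : S y * ‖W y - W z‖ ≤ (∑ i ∈ F, (2 * M + (ρ i x + 1) * L i)) * dist y z := by
    have : S y * ‖W y - W z‖ = ‖S y • (W y - W z)‖ := by
      rw [norm_smul, Real.norm_of_nonneg (hSp y).le]
    rw [this, e, Finset.sum_mul]
    exact (norm_sum_le _ _).trans (Finset.sum_le_sum term)
  have h2 : S x / 2 * ‖W y - W z‖ ≤ S y * ‖W y - W z‖ := by
    gcongr; exact hSlow y hy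
  rw [mul_assoc, inv_mul_eq_div, le_div_iff₀ (by positivity), mul_comm]
  exact h2.trans h1

end glueS

section slopeS
variable {n : ℕ} {Φ : Evec n → ℝ} {δ₀ : ℝ} {G : Evec n → Evec n → ℝ} {ℓ α : ℝ}

theorem WmE.toV {x ξ : HH (Evec n)} (h : WmE Φ x ξ) : VmE Φ x ξ :=
  ⟨h.1, h.2.1, fun s hs h0 => (h.2.2 s hs h0).le⟩

theorem VmE_smul {x ξ : HH (Evec n)} (h : VmE Φ x ξ) {c : ℝ} (hc : 0 ≤ c) : VmE Φ x (c • ξ) := by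
  refine ⟨?_, ?_, fun s hs h0 => ?_⟩
  · rw [ev_smul, inner_smul_right, h.1, mul_zero]
  · rw [ev_smul, inner_smul_right, h.2.1, mul_zero]
  · rw [ev_smul, inner_smul_right]
    exact mul_nonpos_of_nonneg_of_nonpos hc (h.2.2 s hs h0)

theorem WmE_smul {x ξ : HH (Evec n)} (h : WmE Φ x ξ) {c : ℝ} (hc : 0 < c) : WmE Φ x (c • ξ) := by
  refine ⟨?_, ?_, fun s hs h0 => ?_⟩
  · rw [ev_smul, inner_smul_right, h.1, mul_zero]
  · rw [ev_smul, inner_smul_right, h.2.1, mul_zero]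
  · rw [ev_smul, inner_smul_right]
    exact mul_neg_of_pos_of_neg hc (h.2.2 s hs h0)

theorem WmE_add {x ξ ζ : HH (Evec n)} (h : WmE Φ x ξ) (h' : WmE Φ x ζ) : WmE Φ x (ξ + ζ) := by
  refine ⟨?_, ?_, fun s hs h0 => ?_⟩
  · rw [ev_add, inner_add_right, h.1, h'.1, add_zero]
  · rw [ev_add, inner_add_right, h.2.1, h'.2.1, add_zero]
  · rw [ev_add, inner_add_right]
    exact add_neg (h.2.2 s hs h0) (h'.2.2 s hs h0)

theorem MfE_lim (hΦ : IsRegularDomain n Φ δ₀) {x : ℕ → HH (Evec n)} {a : HH (Evec n)}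
    (hx : ∀ k, MfE Φ (x k)) (hl : Tendsto x atTop (nhds a)) : MfE Φ a := by
  have hev : ∀ s, Tendsto (fun k => Φ (ev (x k) s)) atTop (nhds (Φ (ev a s))) := by
    intro s
    refine (hΦ.smooth.continuous.tendsto _).comp ?_
    rw [tendsto_iff_norm_sub_tendsto_zero] at hl ⊢
    refine squeeze_zero (fun _ => norm_nonneg _) (fun k => ev_near (x k) a s) ?_
    simpa using hl.const_mul 2
  refine ⟨fun s hs => le_of_tendsto (hev s) (Eventually.of_forall fun k => (hx k).1 s hs), ?_, ?_⟩
  · refine tendsto_nhds_unique (hev 0) ?_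
    simp only [(hx _).2.1]; exact tendsto_const_nhds
  · refine tendsto_nhds_unique (hev 1) ?_
    simp only [(hx _).2.2]; exact tendsto_const_nhds

theorem unif_slope (hG : IsFinslerEnergy n G ℓ α) (hΦ : IsRegularDomain n Φ δ₀)
    (C : Set (HH (Evec n))) (hCM : ∀ e ∈ C, MfE Φ e) {B : ℝ} (hCB : ∀ e ∈ C, ‖e‖ ≤ B)
    (hcl : ∀ a, MfE Φ a → (∀ ε > 0, ∃ e ∈ C, ‖e - a‖ < ε) → a ∈ C)
    (hnc : ∀ e ∈ C, ∃ ξ, VmE Φ e ξ ∧ dJE G e ξ < 0) :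
    ∃ μ > 0, ∀ e ∈ C, ∃ ξ, VmE Φ e ξ ∧ ‖ξ‖ ≤ 1 ∧ dJE G e ξ ≤ -μ := by
  by_contra hcon
  push Not at hcon
  have hk : ∀ k : ℕ, ∃ e ∈ C, ∀ ξ, VmE Φ e ξ → ‖ξ‖ ≤ 1 → -(1 / ((k:ℝ) + 1)) < dJE G e ξ :=
    fun k => hcon _ (by positivity)
  choose x hxC hx using hk
  have hslope : ∀ k : ℕ, ∀ η, VmE Φ (x k) η → -(1 / ((k:ℝ) + 1)) * ‖η‖ ≤ dJE G (x k) η := by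
    intro k η hη
    by_cases h0 : ‖η‖ = 0
    · have : η = 0 := norm_eq_zero.1 h0
      have e : dJE G (x k) (0 : HH (Evec n)) = 0 := (dJL hG (x k)).map_zero
      rw [this, norm_zero, mul_zero, e]
    · have hp : 0 < ‖η‖ := lt_of_le_of_ne (norm_nonneg _) (Ne.symm h0)
      have := hx k (‖η‖⁻¹ • η) (VmE_smul hη (by positivity))
        (by rw [norm_smul, norm_inv, norm_norm, inv_mul_cancel₀ h0])
      rw [dJE_smul, inv_mul_eq_div, lt_div_iff₀ hp] at this
      exact this.le
  obtain ⟨φ, hφ, a, ha⟩ := compact_A hG hΦ x (fun k => hCM _ (hxC k)) (fun k => hCB _ (hxC k)) hslope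
  have haM : MfE Φ a := MfE_lim hΦ (fun k => hCM _ (hxC (φ k))) ha
  have haC : a ∈ C := by
    refine hcl a haM fun ε hε => ?_
    obtain ⟨N, hN⟩ := Metric.tendsto_atTop.1 ha ε hε
    exact ⟨x (φ N), hxC _, by rw [← dist_eq_norm]; exact hN N le_rfl⟩
  obtain ⟨ξ, hξ, hneg⟩ := hnc a haC
  obtain ⟨K1, hK1, hbd⟩ := dJE_bound hG B
  obtain ⟨K, hK, hlip⟩ := dJE_lip hG B
  obtain ⟨d, hd⟩ : ∃ d, d = - dJE G a ξ := ⟨_, rfl⟩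
  have hdp : 0 < d := by linarith
  obtain ⟨ε, hε⟩ : ∃ ε, ε = min 1 (d / 4 / (K1 + 1)) := ⟨_, rfl⟩
  have hε0 : 0 < ε := by rw [hε]; positivity
  have hε1 : ε ≤ 1 := by rw [hε]; exact min_le_left _ _
  have hε2 : ε * (K1 + 1) ≤ d / 4 := by
    rw [← le_div_iff₀ (by positivity), hε]; exact min_le_right _ _
  obtain ⟨r, hr, L, w, hw, -⟩ := local_B hΦ haM hξ hε0
  obtain ⟨N1, hN1⟩ := Metric.tendsto_atTop.1 ha
    (min r (d / 4 / (K * ‖ξ‖ + 1))) (by positivity)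
  obtain ⟨N2, hN2⟩ := exists_nat_one_div_lt (by positivity : 0 < d / 4 / (‖ξ‖ + 1))
  let k := max N1 N2
  have hk1 := hN1 k (le_max_left _ _)
  rw [dist_eq_norm] at hk1
  have hk2 : 1 / ((φ k : ℝ) + 1) ≤ d / 4 / (‖ξ‖ + 1) := by
    refine le_trans ?_ hN2.le
    have : (N2 : ℝ) ≤ φ k := by exact_mod_cast (le_max_right N1 N2).trans (hφ.id_le k)
    gcongr
  obtain ⟨hwW, hwn⟩ := hw _ (hCM _ (hxC (φ k))) (hk1.trans_le (min_le_left _ _))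
  have s1 := hslope (φ k) _ hwW.toV
  have s2 : |dJE G (x (φ k)) (w (x (φ k)) - ξ)| ≤ K1 * ε :=
    (hbd _ _ ((norm_snd_le _).trans (hCB _ (hxC _)))).trans (by gcongr)
  rw [dJE_sub hG] at s2
  have s2' := (abs_le.1 s2).2
  have s3 := (abs_le.1 (hlip (x (φ k)) a ξ (hCB _ (hxC _)) (hCB _ haC))).2
  have s4 : K * ‖x (φ k) - a‖ * ‖ξ‖ ≤ d / 4 := by
    have h1 := (hk1.trans_le (min_le_right _ _)).le
    rw [le_div_iff₀ (by positivity)] at h1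
    nlinarith [norm_nonneg (x (φ k) - a)]
  have s5 : ‖w (x (φ k))‖ ≤ ‖ξ‖ + 1 := by
    have e : w (x (φ k)) = (w (x (φ k)) - ξ) + ξ := by abel
    rw [e]
    refine (norm_add_le _ _).trans ?_
    linarith
  have s6 : 1 / ((φ k : ℝ) + 1) * ‖w (x (φ k))‖ ≤ d / 4 := by
    calc _ ≤ d / 4 / (‖ξ‖ + 1) * (‖ξ‖ + 1) := by gcongr
      _ = d / 4 := by field_simp
  linarith

theorem main_E (hG : IsFinslerEnergy n G ℓ α) (hΦ : IsRegularDomain n Φ δ₀)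
    (C : Set (HH (Evec n))) (hCM : ∀ e ∈ C, MfE Φ e) {B : ℝ} (hCB : ∀ e ∈ C, ‖e‖ ≤ B)
    (hcl : ∀ a, MfE Φ a → (∀ ε > 0, ∃ e ∈ C, ‖e - a‖ < ε) → a ∈ C)
    (hnc : ∀ e ∈ C, ∃ ξ, VmE Φ e ξ ∧ dJE G e ξ < 0) :
    ∃ μ > 0, ∃ W : HH (Evec n) → HH (Evec n),
      (∀ e ∈ C, WmE Φ e (W e) ∧ ‖W e‖ ≤ 1 / 3 ∧ dJE G e (W e) ≤ -μ) ∧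
      ∀ x ∈ C, ∃ r > 0, ∃ L : ℝ, 0 ≤ L ∧ ∀ y ∈ C, ∀ z ∈ C, ‖y - x‖ < r → ‖z - x‖ < r →
        ‖W y - W z‖ ≤ L * ‖y - z‖ := by
  classical
  obtain ⟨μ, hμ, hs⟩ := unif_slope hG hΦ C hCM hCB hcl hnc
  refine ⟨μ / 12, by positivity, ?_⟩
  obtain ⟨K1, hK1, hbd⟩ := dJE_bound hG B
  obtain ⟨K, hK, hlip⟩ := dJE_lip hG B
  let D : C → Set (HH (Evec n)) := fun e => {w | WmE Φ e w ∧ ‖w‖ ≤ 1 / 3 ∧ dJE G e w ≤ -(μ / 12)}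
  have hconvD : ∀ x, Convex ℝ (D x) := by
    intro e w hw w' hw' a b ha hb hab
    refine ⟨?_, ?_, ?_⟩
    · rcases ha.eq_or_lt with h | h
      · have : b = 1 := by linarith
        rw [← h, this, zero_smul, zero_add, one_smul]; exact hw'.1
      · rcases hb.eq_or_lt with h' | h'
        · have : a = 1 := by linarith
          rw [← h', this, zero_smul, add_zero, one_smul]; exact hw.1
        · exact WmE_add (WmE_smul hw.1 h) (WmE_smul hw'.1 h')
    · refine (norm_add_le _ _).trans ?_
      rw [norm_smul, norm_smul, Real.norm_of_nonneg ha, Real.norm_of_nonneg hb]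
      have := hw.2.1
      have := hw'.2.1
      nlinarith
    · rw [dJE_add hG, dJE_smul, dJE_smul]
      have := hw.2.2
      have := hw'.2.2
      nlinarith
  have hlocD : ∀ x : C, ∃ r > 0, ∃ L : ℝ, 0 ≤ L ∧ ∃ w : C → HH (Evec n),
      (∀ y, dist y x < r → w y ∈ D y) ∧
      ∀ y z, dist y x < r → dist z x < r → ‖w y - w z‖ ≤ L * dist y z := by
    rintro ⟨x, hx⟩
    obtain ⟨ξ, hξ, hξn, hξd⟩ := hs x hx
    obtain ⟨ε, hε⟩ : ∃ ε, ε = min 1 (μ / 4 / (K1 + 1)) := ⟨_, rfl⟩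
    have hε0 : 0 < ε := by rw [hε]; positivity
    have hε1 : ε ≤ 1 := by rw [hε]; exact min_le_left _ _
    have hε2 : ε * (K1 + 1) ≤ μ / 4 := by
      rw [← le_div_iff₀ (by positivity), hε]; exact min_le_right _ _
    obtain ⟨r, hr, L, w, hw, hwl⟩ := local_B hΦ (hCM x hx) hξ hε0
    refine ⟨min r (μ / 4 / (K + 1)), by positivity, max L 0, le_max_right _ _,
      fun y => (1 / 6 : ℝ) • w y, ?_, ?_⟩
    · rintro ⟨y, hy⟩ hyr
      rw [Subtype.dist_eq, dist_eq_norm] at hyr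
      obtain ⟨hwW, hwn⟩ := hw y (hCM y hy) (hyr.trans_le (min_le_left _ _))
      refine ⟨WmE_smul hwW (by norm_num), ?_, ?_⟩
      · have e : w y = (w y - ξ) + ξ := by abel
        have : ‖w y‖ ≤ 2 := by
          rw [e]
          refine (norm_add_le _ _).trans ?_
          linarith
        rw [norm_smul, Real.norm_of_nonneg (by norm_num)]
        show 1 / 6 * ‖w y‖ ≤ 1 / 3
        linarith
      · show dJE G y ((1 / 6 : ℝ) • w y) ≤ _
        rw [dJE_smul]
        have s2 : |dJE G y (w y - ξ)| ≤ K1 * ε :=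
          (hbd _ _ ((norm_snd_le _).trans (hCB _ hy))).trans (by gcongr)
        rw [dJE_sub hG] at s2
        have s2' := (abs_le.1 s2).2
        have s3 := (abs_le.1 (hlip y x ξ (hCB _ hy) (hCB _ hx))).2
        have s4 : K * ‖y - x‖ * ‖ξ‖ ≤ μ / 4 := by
          have h1 := (hyr.trans_le (min_le_right _ _)).le
          rw [le_div_iff₀ (by positivity)] at h1
          have : K * ‖y - x‖ * ‖ξ‖ ≤ K * ‖y - x‖ * 1 := by gcongr
          have : 0 ≤ ‖y - x‖ := norm_nonneg _
          linarith
        linarith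
    · rintro ⟨y, hy⟩ ⟨z, hz⟩ hyr hzr
      rw [Subtype.dist_eq, dist_eq_norm] at hyr hzr
      have := hwl y z (hCM y hy) (hCM z hz) (hyr.trans_le (min_le_left _ _))
        (hzr.trans_le (min_le_left _ _))
      rw [Subtype.dist_eq, dist_eq_norm]
      rw [← smul_sub, norm_smul, Real.norm_of_nonneg (by norm_num)]
      have h2 : L * ‖y - z‖ ≤ max L 0 * ‖y - z‖ := by gcongr; exact le_max_left _ _
      have h3 := norm_nonneg (w y - w z)
      show 1 / 6 * ‖w y - w z‖ ≤ max L 0 * ‖y - z‖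
      linarith
  obtain ⟨W, hWD, hWl⟩ := glue D hconvD (1 / 3) (by norm_num) (fun x v hv => hv.2.1) hlocD
  refine ⟨fun e => if h : e ∈ C then W ⟨e, h⟩ else 0, fun e he => ?_, fun x hx => ?_⟩
  · simp only [dif_pos he]; exact hWD ⟨e, he⟩
  · obtain ⟨r, hr, L, hL⟩ := hWl ⟨x, hx⟩
    refine ⟨r, hr, max L 0, le_max_right _ _, fun y hy z hz hyr hzr => ?_⟩
    simp only [dif_pos hy, dif_pos hz]
    refine (hL ⟨y, hy⟩ ⟨z, hz⟩ ?_ ?_).trans ?_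
    · rw [Subtype.dist_eq, dist_eq_norm]; exact hyr
    · rw [Subtype.dist_eq, dist_eq_norm]; exact hzr
    · rw [Subtype.dist_eq, dist_eq_norm]
      gcongr
      exact le_max_left _ _

end slopeS

section transferS
variable {n : ℕ} {Φ : Evec n → ℝ} {δ₀ : ℝ} {G : Evec n → Evec n → ℝ} {ℓ α : ℝ}

theorem int_muI_of_Icc {F : Type} [NormedAddCommGroup F] {f : ℝ → F} :
    IntegrableOn f (Icc 0 1) ↔ Integrable f muI := integrableOn_Icc_iff_integrableOn_Ioc

theorem ae_mem01 : ∀ᵐ s ∂muI, s ∈ Ioc (0:ℝ) 1 := ae_restrict_mem measurableSet_Ioc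

theorem deriv_memLp (x : H1Curve n 0 1) : MemLp x.deriv 2 muI :=
  (memLp_two_iff_integrable_sq_norm (int_muI_of_Icc.1 x.deriv_integrable).1).2
    (int_muI_of_Icc.1 x.deriv_sq_integrable)

def toE (x : H1Curve n 0 1) : HH (Evec n) := (x.toFun 0, (deriv_memLp x).toLp x.deriv)

theorem toE_coe (x : H1Curve n 0 1) : (toE x).2 =ᵐ[muI] x.deriv := (deriv_memLp x).coeFn_toLp

theorem ev_toE (x : H1Curve n 0 1) {s : ℝ} (hs : s ∈ Icc (0:ℝ) 1) : ev (toE x) s = x.toFun s := by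
  rw [ev_of_mem _ hs, x.eq_add_integral s hs, ii_congr (toE_coe x) zero_mem01 hs]
  rfl

def ofE (e : HH (Evec n)) : H1Curve n 0 1 where
  toFun := ev e
  deriv := e.2
  deriv_integrable := int_muI_of_Icc.2 (L2_integrable e.2)
  deriv_sq_integrable := int_muI_of_Icc.2 (sq_integrable e.2)
  eq_add_integral := fun t ht => by rw [ev_of_mem e ht, ev_zero]

theorem toE_ofE (e : HH (Evec n)) : toE (ofE e) = e := by
  refine Prod.ext (ev_zero e) ?_
  apply Lp.ext
  exact toE_coe (ofE e)

theorem MfE_toE (x : H1Curve n 0 1) : MfE Φ (toE x) ↔ MemMf Φ x := by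
  unfold MfE MemMf
  rw [ev_toE x zero_mem01, ev_toE x one_mem01]
  refine and_congr_left fun _ => forall₂_congr fun s hs => ?_
  rw [ev_toE x hs]

theorem VmE_toE (x ξ : H1Curve n 0 1) : VmE Φ (toE x) (toE ξ) ↔ MemVminus Φ x ξ := by
  unfold VmE MemVminus
  rw [ev_toE x zero_mem01, ev_toE x one_mem01, ev_toE ξ zero_mem01, ev_toE ξ one_mem01]
  refine and_congr_right fun _ => and_congr_right fun _ => forall₂_congr fun s hs => ?_
  rw [ev_toE x ⟨hs.1.le, hs.2.le⟩, ev_toE ξ ⟨hs.1.le, hs.2.le⟩]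

theorem WmE_toE (x ξ : H1Curve n 0 1) (h : WmE Φ (toE x) (toE ξ)) : MemWminus Φ x ξ := by
  refine ⟨(VmE_toE x ξ).1 h.toV, fun s hs h0 => ?_⟩
  have hs' : s ∈ Icc (0:ℝ) 1 := ⟨hs.1.le, hs.2.le⟩
  have := h.2.2 s hs
  rw [ev_toE x hs', ev_toE ξ hs'] at this
  exact this h0

theorem dJE_toE (x ξ : H1Curve n 0 1) : dJE G (toE x) (toE ξ) = dJ G x ξ := by
  unfold dJE dJ
  rw [← integral_muI]
  congr 1
  apply integral_congr_ae
  filter_upwards [toE_coe x, toE_coe ξ, ae_mem01] with s h1 h2 h3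
  have hs' : s ∈ Icc (0:ℝ) 1 := ⟨h3.1.le, h3.2⟩
  unfold dJint
  rw [h1, h2, ev_toE x hs', ev_toE ξ hs']

theorem norm_snd_toE (x y : H1Curve n 0 1) :
    Real.sqrt (∫ s in (0:ℝ)..1, ‖x.deriv s - y.deriv s‖ ^ 2) = ‖(toE x - toE y).2‖ := by
  have e : ∫ s in (0:ℝ)..1, ‖x.deriv s - y.deriv s‖ ^ 2 = ‖(toE x - toE y).2‖ ^ 2 := by
    rw [← integral_muI, L2_norm_sq]
    apply integral_congr_ae
    filter_upwards [toE_coe x, toE_coe y, Lp.coeFn_sub (toE x).2 (toE y).2] with s h1 h2 h3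
    have : (toE x - toE y).2 s = ((toE x).2 - (toE y).2 : L2 (Evec n)) s := rfl
    rw [this, h3, Pi.sub_apply, h1, h2]
  rw [e, Real.sqrt_sq (norm_nonneg _)]

theorem starDist_eq (x y : H1Curve n 0 1) : starDist x y =
    max ‖ev (toE x - toE y) 0‖ ‖ev (toE x - toE y) 1‖ + ‖(toE x - toE y).2‖ := by
  unfold starDist
  rw [norm_snd_toE, ev_sub, ev_sub, ev_toE x zero_mem01, ev_toE x one_mem01, ev_toE y zero_mem01,
    ev_toE y one_mem01]

theorem starDist_le (x y : H1Curve n 0 1) : starDist x y ≤ 3 * ‖toE x - toE y‖ := by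
  rw [starDist_eq]
  have := max_le (norm_ev_le (toE x - toE y) 0) (norm_ev_le (toE x - toE y) 1)
  have := norm_snd_le (toE x - toE y)
  linarith

theorem le_starDist (x y : H1Curve n 0 1) : ‖toE x - toE y‖ ≤ starDist x y := by
  rw [starDist_eq]
  have h1 := le_max_left ‖ev (toE x - toE y) 0‖ ‖ev (toE x - toE y) 1‖
  have h0 := norm_nonneg (ev (toE x - toE y) 0)
  have h2 := norm_nonneg (toE x - toE y).2
  refine max_le ?_ ?_
  · have e := ev_zero (toE x - toE y)
    rw [← e]
    linarith
  · linarith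

theorem starNorm_ofE (e : HH (Evec n)) : starNorm (ofE e) ≤ 3 * ‖e‖ := by
  have h : ∫ s in (0:ℝ)..1, ‖(ofE e).deriv s‖ ^ 2 = ‖e.2‖ ^ 2 := by
    rw [L2_norm_sq, integral_muI]; rfl
  unfold starNorm
  rw [h, Real.sqrt_sq (norm_nonneg _)]
  have h1 : max ‖(ofE e).toFun 0‖ ‖(ofE e).toFun 1‖ ≤ 2 * ‖e‖ :=
    max_le (norm_ev_le e 0) (norm_ev_le e 1)
  have := norm_snd_le e
  linarith

theorem energy_bound (hG : IsFinslerEnergy n G ℓ α) (x : H1Curve n 0 1) {a : ℝ}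
    (h : energy G x ≤ a) : ‖(toE x).2‖ ^ 2 ≤ 2 * ℓ * a := by
  have hl := hG.one_le_ell
  have e : energy G x = (1 / 2) * ∫ s, G (ev (toE x) s) ((toE x).2 s) ∂muI := by
    unfold energy
    rw [← integral_muI]
    congr 1
    apply integral_congr_ae
    filter_upwards [toE_coe x, ae_mem01] with s h1 h3
    have hs' : s ∈ Icc (0:ℝ) 1 := ⟨h3.1.le, h3.2⟩
    rw [h1, ev_toE x hs']
  rw [e] at h
  have hIntg : Integrable (fun s => G (ev (toE x) s) ((toE x).2 s)) muI := by
    refine ((sq_integrable (toE x).2).const_mul ℓ).mono' ?_ ?_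
    · exact hG.continuous.comp_aestronglyMeasurable
        ((ev_continuous (toE x)).aestronglyMeasurable.prodMk (Lp.aestronglyMeasurable _))
    · refine Eventually.of_forall fun s => ?_
      have h0 : 0 ≤ G (ev (toE x) s) ((toE x).2 s) :=
        le_trans (by positivity) (hG.lower (ev (toE x) s) ((toE x).2 s))
      rw [Real.norm_of_nonneg h0]
      exact hG.upper _ _
  have h1 : ∫ s, (1 / ℓ) * ‖(toE x).2 s‖ ^ 2 ∂muI ≤ ∫ s, G (ev (toE x) s) ((toE x).2 s) ∂muI :=
    integral_mono ((sq_integrable (toE x).2).const_mul _) hIntg fun s => hG.lower _ _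
  rw [integral_const_mul, ← L2_norm_sq, one_div, inv_mul_eq_div, div_le_iff₀ (by linarith)] at h1
  nlinarith

end transferS

section revS
variable {n : ℕ} {Φ : Evec n → ℝ} {δ₀ : ℝ} {G : Evec n → Evec n → ℝ} {ℓ α : ℝ}

theorem flip_mp : MeasurePreserving (fun s : ℝ => 1 - s) muI muI := by
  have h := (Measure.measurePreserving_sub_left (volume : Measure ℝ) (1:ℝ)).restrict_preimage
    (measurableSet_Ioc : MeasurableSet (Ioc (0:ℝ) 1))
  have e : (fun s : ℝ => 1 - s) ⁻¹' Ioc (0:ℝ) 1 = Ico 0 1 := by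
    ext s
    simp only [mem_preimage, mem_Ioc, mem_Ico]
    constructor
    · rintro ⟨h1, h2⟩; constructor <;> linarith
    · rintro ⟨h1, h2⟩; constructor <;> linarith
  rw [e, Measure.restrict_congr_set Ico_ae_eq_Ioc] at h
  exact h

def Rv (e : HH (Evec n)) : HH (Evec n) :=
  (ev e 1, -Lp.compMeasurePreserving (fun s : ℝ => 1 - s) flip_mp e.2)

theorem Rv_coe (e : HH (Evec n)) : (Rv e).2 =ᵐ[muI] fun s => -(e.2 (1 - s)) := by
  filter_upwards [Lp.coeFn_neg (Lp.compMeasurePreserving (fun s : ℝ => 1 - s) flip_mp e.2),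
    Lp.coeFn_compMeasurePreserving e.2 flip_mp] with s h1 h2
  have : (Rv e).2 s = (-Lp.compMeasurePreserving (fun s : ℝ => 1 - s) flip_mp e.2 : L2 (Evec n)) s :=
    rfl
  rw [this, h1, Pi.neg_apply, h2]; rfl

theorem one_sub_mem {s : ℝ} (hs : s ∈ Icc (0:ℝ) 1) : 1 - s ∈ Icc (0:ℝ) 1 :=
  ⟨by linarith [hs.2], by linarith [hs.1]⟩

theorem ev_Rv_mem (e : HH (Evec n)) {s : ℝ} (hs : s ∈ Icc (0:ℝ) 1) :
    ev (Rv e) s = ev e (1 - s) := by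
  rw [ev_of_mem _ hs, ii_congr (Rv_coe e) zero_mem01 hs, intervalIntegral.integral_neg,
    intervalIntegral.integral_comp_sub_left (fun s => e.2 s) 1, sub_zero,
    ← ev_sub_ev e (one_sub_mem hs) one_mem01]
  show ev e 1 + _ = _
  abel

theorem ev_Rv (e : HH (Evec n)) (s : ℝ) : ev (Rv e) s = ev e (1 - s) := by
  rw [← ev_clamp, ev_Rv_mem e (clamp_mem s), ← clamp_one_sub, ev_clamp]

theorem Rv_sub (a b : HH (Evec n)) : Rv a - Rv b = Rv (a - b) := by
  refine Prod.ext ?_ ?_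
  · exact (ev_sub a b 1).symm
  · apply Lp.ext
    have hq := flip_mp.quasiMeasurePreserving.ae (Lp.coeFn_sub a.2 b.2)
    filter_upwards [Rv_coe a, Rv_coe b, Rv_coe (a - b), Lp.coeFn_sub (Rv a).2 (Rv b).2, hq]
      with s h1 h2 h3 h4 h5
    have e1 : (Rv a - Rv b).2 s = ((Rv a).2 - (Rv b).2 : L2 (Evec n)) s := rfl
    have e2 : (a - b).2 (1 - s) = (a.2 - b.2 : L2 (Evec n)) (1 - s) := rfl
    rw [e1, h4, Pi.sub_apply, h1, h2, h3, e2, h5, Pi.sub_apply]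
    abel

theorem Rv_norm (a : HH (Evec n)) : ‖Rv a‖ ≤ 2 * ‖a‖ := by
  refine max_le (norm_ev_le a 1) ?_
  show ‖-Lp.compMeasurePreserving (fun s : ℝ => 1 - s) flip_mp a.2‖ ≤ _
  rw [norm_neg, Lp.norm_compMeasurePreserving]
  linarith [norm_snd_le a, norm_nonneg a]

theorem Rv_WmE {e η : HH (Evec n)} (h : WmE Φ e η) : WmE Φ (Rv e) (Rv η) := by
  refine ⟨?_, ?_, fun s hs h0 => ?_⟩
  · rw [ev_Rv, ev_Rv, sub_zero]; exact h.2.1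
  · rw [ev_Rv, ev_Rv, sub_self]; exact h.1
  · rw [ev_Rv, ev_Rv] at *
    exact h.2.2 (1 - s) ⟨by linarith [hs.2], by linarith [hs.1]⟩ h0

theorem Rv_dJE (hrev : ∀ q v : Evec n, G q (-v) = G q v) (e η : HH (Evec n)) :
    dJE G (Rv e) (Rv η) = dJE G e η := by
  have hq : ∀ q v : Evec n, dqCLM G q (-v) = dqCLM G q v := by
    intro q v
    unfold dqCLM
    simp only [hrev]
  have hv : ∀ q v : Evec n, dvCLM G q (-v) = -dvCLM G q v := by
    intro q v
    unfold dvCLM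
    have := fderiv_comp_smul (𝕜 := ℝ) (f := fun w => G q w) (x := v) (-1)
    simp only [neg_smul, one_smul, hrev] at this
    rw [this, neg_neg]
  unfold dJE
  congr 1
  have e1 : ∫ s, dJint G (Rv e) (Rv η) s ∂muI = ∫ s, dJint G e η (1 - s) ∂muI := by
    apply integral_congr_ae
    filter_upwards [Rv_coe e, Rv_coe η] with s h1 h2
    unfold dJint
    rw [h1, h2, ev_Rv, ev_Rv, hq, hv]
    simp
  rw [e1, integral_muI, integral_muI, intervalIntegral.integral_comp_sub_left (fun s => dJint G e η s)]
  simp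

def revC (x : H1Curve n 0 1) : H1Curve n 0 1 where
  toFun := fun s => x.toFun (1 - s)
  deriv := fun s => -x.deriv (1 - s)
  deriv_integrable := int_muI_of_Icc.2
    ((flip_mp.integrable_comp_of_integrable (int_muI_of_Icc.1 x.deriv_integrable)).neg)
  deriv_sq_integrable := by
    have := flip_mp.integrable_comp_of_integrable (int_muI_of_Icc.1 x.deriv_sq_integrable)
    refine int_muI_of_Icc.2 ?_
    simp only [norm_neg]
    exact this
  eq_add_integral := fun t ht => by
    rw [intervalIntegral.integral_neg, intervalIntegral.integral_comp_sub_left (fun s => x.deriv s) 1,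
      sub_zero, ← ev_toE x (one_sub_mem ht), ← ev_toE x one_mem01,
      ← ii_congr (toE_coe x) (one_sub_mem ht) one_mem01, ← ev_sub_ev _ (one_sub_mem ht) one_mem01]
    abel

theorem revC_rep (x : H1Curve n 0 1) : RevRep x (revC x) := ⟨fun _ => rfl, fun _ => rfl⟩

theorem RevRep.symm {x y : H1Curve n 0 1} (h : RevRep x y) : RevRep y x := by
  refine ⟨fun s => ?_, fun s => ?_⟩
  · rw [h.1, sub_sub_cancel]
  · rw [h.2, sub_sub_cancel, neg_neg]

theorem toE_rev {x y : H1Curve n 0 1} (h : RevRep x y) : toE y = Rv (toE x) := by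
  refine Prod.ext ?_ ?_
  · show y.toFun 0 = ev (toE x) 1
    rw [h.1, sub_zero, ev_toE x one_mem01]
  · apply Lp.ext
    have hq := flip_mp.quasiMeasurePreserving.ae (toE_coe x)
    filter_upwards [toE_coe y, Rv_coe (toE x), hq] with s h1 h2 h3
    rw [h1, h2, h3, h.2]

end revS

/-- Pseudo-gradient vector field: on a closed set `C ⊂ Mf` containing no `V⁻`-critical curve
and with `J(C) ⊂ [a₁,a₂]`, `0 < a₁`, there are `μ_C > 0` and a locally Lipschitz (w.r.t.
`dist_*`) vector field `W` with `W(x) ∈ W⁻(x,Mf)`, `‖W(x)‖_* ≤ 1` and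
`dJ(x)[W(x)] ≤ −μ_C` on `C`; if `G` is reversible and `C` is `ℛ`-invariant, `W` can be chosen
`ℛ`-equivariant. -/
theorem stmt_15 {n : ℕ} (G : Evec n → Evec n → ℝ) (ℓ α : ℝ)
    (hG : IsFinslerEnergy n G ℓ α)
    (Φ : Evec n → ℝ) (δ₀ : ℝ) (hΦ : IsRegularDomain n Φ δ₀)
    (C : Set (H1Curve n 0 1))
    (hCMf : ∀ x ∈ C, MemMf Φ x)
    (hclosed : ∀ y : H1Curve n 0 1, MemMf Φ y →
      (∀ ε > (0:ℝ), ∃ x ∈ C, starDist x y < ε) → y ∈ C)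
    (hnocrit : ∀ x ∈ C, ¬ IsVCritical G Φ x)
    (a₁ a₂ : ℝ) (ha₁ : 0 < a₁) (ha₂ : a₁ ≤ a₂)
    (hJC : ∀ x ∈ C, energy G x ∈ Icc a₁ a₂) :
    ∃ μC > (0:ℝ), ∃ W : H1Curve n 0 1 → H1Curve n 0 1,
      -- W is locally Lipschitz continuous on C with respect to dist_*
      (∀ x ∈ C, ∃ r > (0:ℝ), ∃ L : ℝ, ∀ y ∈ C, ∀ z ∈ C,
        starDist x y < r → starDist x z < r →
          starDist (W y) (W z) ≤ L * starDist y z) ∧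
      (∀ x ∈ C, MemWminus Φ x (W x)) ∧
      (∀ x ∈ C, starNorm (W x) ≤ 1) ∧
      (∀ x ∈ C, dJ G x (W x) ≤ -μC) ∧
      -- equivariance in the reversible, ℛ-invariant case
      ((∀ q v : Evec n, G q (-v) = G q v) →
        (∀ x ∈ C, ∀ y : H1Curve n 0 1, RevRep x y → y ∈ C) →
        ∀ x ∈ C, ∀ y : H1Curve n 0 1, RevRep x y →
          ∀ s : ℝ, (W y).toFun s = (W x).toFun (1 - s)) := by
  obtain ⟨R, hR0, hR⟩ := sub_bound hΦ
  have hl := hG.one_le_ell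
  have ha0 : 0 < a₂ := ha₁.trans_le ha₂
  have hCM : ∀ e ∈ toE '' C, MfE Φ e := by
    rintro _ ⟨x, hx, rfl⟩
    exact (MfE_toE x).2 (hCMf x hx)
  have hCB : ∀ e ∈ toE '' C, ‖e‖ ≤ max R (Real.sqrt (2 * ℓ * a₂)) := by
    rintro _ ⟨x, hx, rfl⟩
    refine max_le_max ?_ ?_
    · exact hR _ (hCMf x hx).2.1.le
    · exact Real.le_sqrt_of_sq_le (energy_bound hG x (hJC x hx).2)
  have hcl : ∀ a, MfE Φ a → (∀ ε > 0, ∃ e ∈ toE '' C, ‖e - a‖ < ε) → a ∈ toE '' C := by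
    intro a ha hε
    refine ⟨ofE a, hclosed (ofE a) ?_ fun ε hε0 => ?_, toE_ofE a⟩
    · rw [← MfE_toE, toE_ofE]; exact ha
    · obtain ⟨_, ⟨x, hx, rfl⟩, h⟩ := hε (ε / 3) (by positivity)
      refine ⟨x, hx, (starDist_le x _).trans_lt ?_⟩
      rw [toE_ofE]
      linarith
  have hnc : ∀ e ∈ toE '' C, ∃ ξ, VmE Φ e ξ ∧ dJE G e ξ < 0 := by
    rintro _ ⟨x, hx, rfl⟩
    by_contra hcon
    push Not at hcon
    refine hnocrit x hx ⟨hCMf x hx, fun ξ hξ => ?_⟩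
    rw [← dJE_toE]
    exact hcon _ ((VmE_toE x ξ).2 hξ)
  obtain ⟨μ, hμ, W, hW, hWl⟩ := main_E hG hΦ (toE '' C) hCM hCB hcl hnc
  have mem : ∀ x ∈ C, toE x ∈ toE '' C := fun x hx => mem_image_of_mem _ hx
  -- common assembly step
  have key : ∀ U : HH (Evec n) → HH (Evec n),
      (∀ e ∈ toE '' C, WmE Φ e (U e) ∧ ‖U e‖ ≤ 1 / 3 ∧ dJE G e (U e) ≤ -(μ / 2)) →
      (∀ x ∈ toE '' C, ∃ r > 0, ∃ L : ℝ, 0 ≤ L ∧ ∀ y ∈ toE '' C, ∀ z ∈ toE '' C,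
        ‖y - x‖ < r → ‖z - x‖ < r → ‖U y - U z‖ ≤ L * ‖y - z‖) →
      (∀ x ∈ C, ∃ r > (0:ℝ), ∃ L : ℝ, ∀ y ∈ C, ∀ z ∈ C,
        starDist x y < r → starDist x z < r →
          starDist (ofE (U (toE y))) (ofE (U (toE z))) ≤ L * starDist y z) ∧
      (∀ x ∈ C, MemWminus Φ x (ofE (U (toE x)))) ∧
      (∀ x ∈ C, starNorm (ofE (U (toE x))) ≤ 1) ∧
      (∀ x ∈ C, dJ G x (ofE (U (toE x))) ≤ -(μ / 2)) := by
    intro U hU hUl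
    refine ⟨fun x hx => ?_, fun x hx => ?_, fun x hx => ?_, fun x hx => ?_⟩
    · obtain ⟨r, hr, L, hL0, hL⟩ := hUl _ (mem x hx)
      refine ⟨r, hr, 3 * L, fun y hy z hz hyr hzr => ?_⟩
      have h1 := hL _ (mem y hy) _ (mem z hz)
        (by rw [norm_sub_rev]; exact (le_starDist x y).trans_lt hyr)
        (by rw [norm_sub_rev]; exact (le_starDist x z).trans_lt hzr)
      refine (starDist_le _ _).trans ?_
      rw [toE_ofE, toE_ofE]
      have h2 : L * ‖toE y - toE z‖ ≤ L * starDist y z := by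
        gcongr; exact le_starDist y z
      linarith
    · apply WmE_toE
      rw [toE_ofE]
      exact (hU _ (mem x hx)).1
    · refine (starNorm_ofE _).trans ?_
      linarith [(hU _ (mem x hx)).2.1]
    · rw [← dJE_toE, toE_ofE]
      exact (hU _ (mem x hx)).2.2
  refine ⟨μ / 2, by positivity, ?_⟩
  by_cases hsym : (∀ q v : Evec n, G q (-v) = G q v) ∧
      (∀ x ∈ C, ∀ y : H1Curve n 0 1, RevRep x y → y ∈ C)
  · obtain ⟨hrev, hinv⟩ := hsym
    have hCR : ∀ e ∈ toE '' C, Rv e ∈ toE '' C ∧ Rv (Rv e) = e := by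
      rintro _ ⟨x, hx, rfl⟩
      have h1 := toE_rev (revC_rep x)
      refine ⟨⟨revC x, hinv x hx _ (revC_rep x), h1⟩, ?_⟩
      rw [← h1]
      exact (toE_rev (revC_rep x).symm).symm
    let U : HH (Evec n) → HH (Evec n) := fun e => (1 / 4 : ℝ) • (W e + Rv (W (Rv e)))
    have hev : ∀ e s, ev (U e) s = (1 / 4 : ℝ) • (ev (W e) s + ev (W (Rv e)) (1 - s)) := by
      intro e s
      simp only [U]
      rw [ev_smul, ev_add, ev_Rv]
    have hU1 : ∀ e ∈ toE '' C,
        WmE Φ e (U e) ∧ ‖U e‖ ≤ 1 / 3 ∧ dJE G e (U e) ≤ -(μ / 2) := by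
      intro e he
      obtain ⟨hRe, hRR⟩ := hCR e he
      obtain ⟨a1, a2, a3⟩ := hW e he
      obtain ⟨b1, b2, b3⟩ := hW _ hRe
      have c1 := Rv_WmE b1
      rw [hRR] at c1
      have c2 := Rv_norm (W (Rv e))
      have c3 := Rv_dJE hrev (Rv e) (W (Rv e))
      rw [hRR] at c3
      refine ⟨WmE_smul (WmE_add a1 c1) (by norm_num), ?_, ?_⟩
      · simp only [U]
        rw [norm_smul, Real.norm_of_nonneg (by norm_num)]
        have := norm_add_le (W e) (Rv (W (Rv e)))
        linarith
      · simp only [U]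
        rw [dJE_smul, dJE_add hG, c3]
        linarith
    have hU2 : ∀ x ∈ toE '' C, ∃ r > 0, ∃ L : ℝ, 0 ≤ L ∧ ∀ y ∈ toE '' C, ∀ z ∈ toE '' C,
        ‖y - x‖ < r → ‖z - x‖ < r → ‖U y - U z‖ ≤ L * ‖y - z‖ := by
      intro x hx
      obtain ⟨r1, hr1, L1, hL1, h1⟩ := hWl x hx
      obtain ⟨r2, hr2, L2, hL2, h2⟩ := hWl (Rv x) (hCR x hx).1
      refine ⟨min r1 (r2 / 2), lt_min hr1 (by linarith), (1 / 4) * (L1 + 4 * L2), by positivity,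
        fun y hy z hz hyr hzr => ?_⟩
      have d : ∀ a b : HH (Evec n), ‖Rv a - Rv b‖ ≤ 2 * ‖a - b‖ := fun a b => by
        rw [Rv_sub]; exact Rv_norm _
      have g1 := h1 y hy z hz (hyr.trans_le (min_le_left _ _)) (hzr.trans_le (min_le_left _ _))
      have g2 := h2 (Rv y) (hCR y hy).1 (Rv z) (hCR z hz).1
        ((d y x).trans_lt (by linarith [hyr.trans_le (min_le_right _ _)]))
        ((d z x).trans_lt (by linarith [hzr.trans_le (min_le_right _ _)]))
      have g3 := d (W (Rv y)) (W (Rv z))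
      have g4 := mul_le_mul_of_nonneg_left (d y z) hL2
      simp only [U]
      rw [← smul_sub, norm_smul, Real.norm_of_nonneg (by norm_num), add_sub_add_comm]
      have g5 := norm_add_le (W y - W z) (Rv (W (Rv y)) - Rv (W (Rv z)))
      linarith
    obtain ⟨k1, k2, k3, k4⟩ := key U hU1 hU2
    · refine ⟨fun x => ofE (U (toE x)), k1, k2, k3, k4, fun _ _ x hx y hxy s => ?_⟩
      show ev (U (toE y)) s = ev (U (toE x)) (1 - s)
      have h1 := toE_rev hxy
      have h2 := (hCR _ (mem x hx)).2
      rw [hev, hev, h1, h2, sub_sub_cancel, add_comm]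
  · obtain ⟨k1, k2, k3, k4⟩ := key W (fun e he => ⟨(hW e he).1, (hW e he).2.1,
      (hW e he).2.2.trans (by linarith)⟩) hWl
    refine ⟨fun x => ofE (W (toE x)), k1, k2, k3, k4, fun h1 h2 => ?_⟩
    exact absurd ⟨h1, h2⟩ hsym

end
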